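/- arXiv:math/0110134 — 5 statements merged into one kernel-verified Lean document; each statement's English description precedes it below -/
import Mathlib

section
/- Let (m_n) be a regular sequence, let D ⊆ ℝ^d and E ⊆ ℝ^e be bounded open sets, let u = (u_1, …, u_e) : D → ℝ^e be a map with u(D) ⊆ E whose components all belong to the Carleman class C(m_n, D), and let g ∈ C(m_n, E). Then the composition g ∘ u belongs to C(m_n, D). -/
open Real Set Filter MeasureTheory
open scoped BigOperators Topology

noncomputable section

/-- A sequence `(m n)` (indexed from 1) of positive reals is *regular* if it is nondecreasing,
grows faster than any power of `n`, satisfies `m (n+1) / m n ≤ n * C ^ n`, and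
`n ↦ log (m n / n!)` is convex. -/
def RegularSeq (m : ℕ → ℝ) : Prop :=
  (∀ n : ℕ, 1 ≤ n → 0 < m n) ∧
  (∀ n : ℕ, 1 ≤ n → m n ≤ m (n + 1)) ∧
  (∀ k : ℕ, Filter.Tendsto (fun n : ℕ => m n / (n : ℝ) ^ k) Filter.atTop Filter.atTop) ∧
  (∃ C : ℝ, 0 < C ∧ ∀ n : ℕ, 1 ≤ n → m (n + 1) / m n ≤ (n : ℝ) * C ^ n) ∧
  (∀ n : ℕ, 1 ≤ n →
    Real.log (m (n + 1) / (Nat.factorial (n + 1) : ℝ)) ≤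
      (Real.log (m n / (Nat.factorial n : ℝ)) +
        Real.log (m (n + 2) / (Nat.factorial (n + 2) : ℝ))) / 2)

/-- `u` belongs to the Carleman class `C(m_n, D)`: it is `C^∞` on `D` and there is `C > 0`
with `‖∂^α u‖ ≤ C^{|α|} m_{|α|}` on `D` for every order `|α| ≥ 1`. -/
def CarlemanClass {E F : Type*} [NormedAddCommGroup E] [NormedSpace ℝ E]
    [NormedAddCommGroup F] [NormedSpace ℝ F]
    (m : ℕ → ℝ) (D : Set E) (u : E → F) : Prop :=
  ContDiffOn ℝ (⊤ : ℕ∞) u D ∧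
  ∃ C : ℝ, 0 < C ∧ ∀ n : ℕ, 1 ≤ n → ∀ x ∈ D,
    ‖iteratedFDerivWithin ℝ n u D x‖ ≤ C ^ n * m n

lemma cc_mono (a : ℕ → ℝ) (h : ∀ n, a (n+1) ≤ (a n + a (n+2)) / 2) (i j : ℕ) :
    a (j+1) - a j ≤ a (i+j+1) - a (i+j) := by
  induction i with
  | zero => simp
  | succ i ih =>
    have := h (i+j)
    have e1 : i + 1 + j = i + j + 1 := by ring
    rw [e1]
    have e2 : a (i+j+1+1) = a (i+j+2) := rfl
    linarith

lemma cc_super (a : ℕ → ℝ) (h : ∀ n, a (n+1) ≤ (a n + a (n+2)) / 2) (i j : ℕ) :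
    a i + a j ≤ a 0 + a (i+j) := by
  induction j with
  | zero => simp [add_comm]
  | succ j ih =>
    have := cc_mono a h i j
    rw [← add_assoc]
    linarith

lemma cc_sum (a : ℕ → ℝ) (h : ∀ n, a (n+1) ≤ (a n + a (n+2)) / 2) {ι : Type*}
    (s : Finset ι) (f : ι → ℕ) :
    ∑ i ∈ s, a (f i) ≤ (s.card : ℝ) * a 0 + (a (∑ i ∈ s, f i) - a 0) := by
  classical
  induction s using Finset.induction_on with
  | empty => simp
  | insert x s hx ih =>
    rw [Finset.sum_insert hx, Finset.sum_insert hx, Finset.card_insert_of_notMem hx]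
    have := cc_super a h (f x) (∑ i ∈ s, f i)
    push_cast
    linarith

lemma cc_partSize {n : ℕ} (c : OrderedFinpartition n) : ∑ i, c.partSize i = n := by
  have := c.sum_sigma_eq_sum (fun _ => (1 : ℕ))
  simpa using this

lemma cc_M (M : ℕ → ℝ) (hpos : ∀ n, 1 ≤ n → 0 < M n)
    (h : ∀ n, 1 ≤ n → Real.log (M (n+1)) ≤ (Real.log (M n) + Real.log (M (n+2))) / 2)
    {n : ℕ} (hn : 1 ≤ n) (c : OrderedFinpartition n) :
    M c.length * ∏ i, M (c.partSize i) ≤ M 1 ^ c.length * M n := by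
  set a : ℕ → ℝ := fun j => Real.log (M (j+1)) with ha
  have hc : ∀ n, a (n+1) ≤ (a n + a (n+2)) / 2 := fun n => h (n+1) (by omega)
  have hM : ∀ j, 1 ≤ j → M j = Real.exp (a (j-1)) := by
    intro j hj
    simp only [ha]
    rw [Nat.sub_add_cancel hj, Real.exp_log (hpos j hj)]
  have hk : 1 ≤ c.length := c.length_pos hn
  rw [hM _ hk, hM n hn, hM 1 le_rfl,
    Finset.prod_congr rfl (fun i _ => hM (c.partSize i) (c.partSize_pos i)),
    ← Real.exp_sum, ← Real.exp_nat_mul, ← Real.exp_add, ← Real.exp_add, Real.exp_le_exp]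
  have h1 := cc_sum a hc Finset.univ (fun i => c.partSize i - 1)
  have h2 : ∑ i, (c.partSize i - 1) + c.length = n := by
    have : ∑ i, ((c.partSize i - 1) + 1) = n := by
      refine Eq.trans ?_ (cc_partSize c)
      exact Finset.sum_congr rfl (fun i _ => Nat.sub_add_cancel (c.partSize_pos i))
    rw [Finset.sum_add_distrib] at this
    simpa using this
  have h3 := cc_super a hc (c.length - 1) (∑ i, (c.partSize i - 1))
  have h4 : c.length - 1 + ∑ i, (c.partSize i - 1) = n - 1 := by omega
  rw [h4] at h3
  simp only [Finset.card_univ, Fintype.card_fin] at h1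
  simp only [Nat.sub_self]
  linarith

lemma cc_count (x : ℝ) (hx : 0 ≤ x) (n : ℕ) :
    ∑ c : OrderedFinpartition n,
      x ^ c.length * (c.length.factorial : ℝ) * ∏ i, ((c.partSize i).factorial : ℝ)
      ≤ (n.factorial : ℝ) * (x + 2) ^ n := by
  induction n with
  | zero =>
    rw [Fintype.sum_unique]
    simp
  | succ n ih =>
    rw [← (OrderedFinpartition.extendEquiv n).sum_comp, Fintype.sum_sigma]
    have key : ∀ c : OrderedFinpartition n,
        ∑ o : Option (Fin c.length),
          (x ^ ((OrderedFinpartition.extendEquiv n) ⟨c, o⟩).length *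
            (((OrderedFinpartition.extendEquiv n) ⟨c, o⟩).length.factorial : ℝ) *
            ∏ i, ((((OrderedFinpartition.extendEquiv n) ⟨c, o⟩).partSize i).factorial : ℝ))
        ≤ ((n + 1 : ℝ) * (x + 2)) * (x ^ c.length * (c.length.factorial : ℝ) *
            ∏ i, ((c.partSize i).factorial : ℝ)) := by
      intro c
      rw [Fintype.sum_option]
      set P : ℝ := ∏ i, ((c.partSize i).factorial : ℝ) with hP
      have hP0 : 0 ≤ P := by positivity
      have e1 : (x ^ ((OrderedFinpartition.extendEquiv n) ⟨c, none⟩).length *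
            (((OrderedFinpartition.extendEquiv n) ⟨c, none⟩).length.factorial : ℝ) *
            ∏ i, ((((OrderedFinpartition.extendEquiv n) ⟨c, none⟩).partSize i).factorial : ℝ))
          = x ^ (c.length + 1) * ((c.length + 1).factorial : ℝ) * P := by
        change x ^ (c.length + 1) * ((c.length + 1).factorial : ℝ) *
          ∏ i : Fin (c.length + 1),
            (((Fin.cons 1 c.partSize : Fin (c.length + 1) → ℕ) i).factorial : ℝ) = _
        rw [Fin.prod_univ_succ]
        simp [hP]
      have e2 : ∀ k : Fin c.length,
          (x ^ ((OrderedFinpartition.extendEquiv n) ⟨c, some k⟩).length *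
            (((OrderedFinpartition.extendEquiv n) ⟨c, some k⟩).length.factorial : ℝ) *
            ∏ i, ((((OrderedFinpartition.extendEquiv n) ⟨c, some k⟩).partSize i).factorial : ℝ))
          = x ^ c.length * (c.length.factorial : ℝ) * P * ((c.partSize k : ℝ) + 1) := by
        intro k
        change x ^ c.length * (c.length.factorial : ℝ) *
          ∏ i : Fin c.length,
            ((Function.update c.partSize k (c.partSize k + 1) i).factorial : ℝ) = _
        rw [hP, ← Finset.mul_prod_erase Finset.univ _ (Finset.mem_univ k),
          ← Finset.mul_prod_erase Finset.univ (fun i => ((c.partSize i).factorial : ℝ))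
            (Finset.mem_univ k)]
        rw [Finset.prod_congr rfl (g := fun i => ((c.partSize i).factorial : ℝ))
          (fun i hi => by rw [Function.update_of_ne (Finset.ne_of_mem_erase hi)])]
        rw [Function.update_self, Nat.factorial_succ]
        push_cast
        ring
      rw [e1, Finset.sum_congr rfl (fun k _ => e2 k), ← Finset.mul_sum,
        Finset.sum_add_distrib]
      have h1 : ∑ i, (c.partSize i : ℝ) = n := by exact_mod_cast cc_partSize c
      rw [h1, Nat.factorial_succ]
      simp only [Finset.sum_const, Finset.card_univ, Fintype.card_fin, nsmul_eq_mul, mul_one]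
      have hl : (c.length : ℝ) ≤ n := by exact_mod_cast c.length_le
      have hQ : 0 ≤ x ^ c.length * (c.length.factorial : ℝ) * P := by positivity
      have : x * (c.length + 1) + (n + c.length) ≤ (n + 1 : ℝ) * (x + 2) := by nlinarith
      calc _ = (x * (c.length + 1) + (n + c.length)) *
              (x ^ c.length * (c.length.factorial : ℝ) * P) := by push_cast; ring
        _ ≤ _ := by gcongr
    refine (Finset.sum_le_sum (fun c _ => key c)).trans ?_
    rw [← Finset.mul_sum]
    refine (mul_le_mul_of_nonneg_left ih (by positivity)).trans (le_of_eq ?_)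
    rw [Nat.factorial_succ]
    push_cast
    ring

lemma cc_pi {d e : ℕ} (m : ℕ → ℝ) (hm : ∀ n, 1 ≤ n → 0 < m n)
    (D : Set (Fin d → ℝ)) (hD : IsOpen D) (u : (Fin d → ℝ) → (Fin e → ℝ))
    (hu : ∀ i : Fin e, CarlemanClass m D (fun x => u x i)) : CarlemanClass m D u := by
  have hcd : ContDiffOn ℝ (⊤ : ℕ∞) u D := contDiffOn_pi.2 fun i => (hu i).1
  refine ⟨hcd, ?_⟩
  choose C hC0 hC using fun i => (hu i).2
  have hS : ∀ i, C i ≤ 1 + ∑ i, C i := fun i => by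
    have := Finset.single_le_sum (f := C) (fun i _ => (hC0 i).le) (Finset.mem_univ i)
    linarith
  have hS0 : 0 < 1 + ∑ i, C i := by
    have := Finset.sum_nonneg (s := Finset.univ) (f := C) (fun i _ => (hC0 i).le)
    linarith
  refine ⟨1 + ∑ i, C i, hS0, fun n hn x hx => ?_⟩
  have hmn := hm n hn
  refine ContinuousMultilinearMap.opNorm_le_bound (by positivity) fun v => ?_
  rw [pi_norm_le_iff_of_nonneg (by positivity)]
  intro i
  have h1 := (ContinuousLinearMap.proj (R := ℝ) (φ := fun _ : Fin e => ℝ) i).iteratedFDerivWithin_comp_left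
    (hcd x hx) hD.uniqueDiffOn hx (i := n) (by exact_mod_cast le_top)
  have h2 : iteratedFDerivWithin ℝ n u D x v i =
      iteratedFDerivWithin ℝ n (fun x => u x i) D x v := by
    change _ = iteratedFDerivWithin ℝ n
      ((ContinuousLinearMap.proj (R := ℝ) (φ := fun _ : Fin e => ℝ) i) ∘ u) D x v
    rw [h1]
    rfl
  rw [h2]
  refine (ContinuousMultilinearMap.le_opNorm _ v).trans ?_
  gcongr
  refine (hC i n hn x hx).trans ?_
  have := (hC0 i).le
  have := hS i
  gcongr

lemma cc_main {d e : ℕ} (m : ℕ → ℝ) (hm : RegularSeq m)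
    (D : Set (Fin d → ℝ)) (E : Set (Fin e → ℝ))
    (hDopen : IsOpen D) (hEopen : IsOpen E)
    (u : (Fin d → ℝ) → (Fin e → ℝ))
    (hu : CarlemanClass m D u)
    (humaps : Set.MapsTo u D E)
    (g : (Fin e → ℝ) → ℝ) (hg : CarlemanClass m E g) :
    CarlemanClass m D (g ∘ u) := by
  obtain ⟨hpos, -, -, -, hconv⟩ := hm
  obtain ⟨hucd, B, hB0, hB⟩ := hu
  obtain ⟨hgcd, A, hA0, hA⟩ := hg
  refine ⟨hgcd.comp hucd humaps, ?_⟩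
  set M : ℕ → ℝ := fun n => m n / (n.factorial : ℝ) with hMdef
  have hMpos : ∀ n, 1 ≤ n → 0 < M n := fun n hn => div_pos (hpos n hn) (by positivity)
  have hmM : ∀ n, m n = n.factorial * M n := fun n => by
    simp only [hMdef]; field_simp
  have hM1 := hMpos 1 le_rfl
  refine ⟨B * (A * M 1 + 2), by positivity, fun n hn x hx => ?_⟩
  have hT := (hgcd.ftaylorSeriesWithin hEopen.uniqueDiffOn).comp
    (hucd.ftaylorSeriesWithin hDopen.uniqueDiffOn) humaps
  have hEq := hT.eq_iteratedFDerivWithin_of_uniqueDiffOn (m := n) (by exact_mod_cast le_top)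
    hDopen.uniqueDiffOn hx
  rw [← hEq]
  have hMn := hMpos n hn
  calc ‖((ftaylorSeriesWithin ℝ g E (u x)).taylorComp (ftaylorSeriesWithin ℝ u D x)) n‖
      ≤ ∑ c : OrderedFinpartition n, B ^ n * M n * ((A * M 1) ^ c.length *
          (c.length.factorial : ℝ) * ∏ i, ((c.partSize i).factorial : ℝ)) := by
        refine (norm_sum_le _ _).trans (Finset.sum_le_sum fun c _ => ?_)
        refine (c.norm_compAlongOrderedFinpartition_le _ _).trans ?_
        have h1 : ‖ftaylorSeriesWithin ℝ g E (u x) c.length‖ ≤ A ^ c.length * m c.length :=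
          hA _ (c.length_pos hn) _ (humaps hx)
        have h2 : ∏ i, ‖ftaylorSeriesWithin ℝ u D x (c.partSize i)‖ ≤
            ∏ i, (B ^ c.partSize i * m (c.partSize i)) :=
          Finset.prod_le_prod (fun _ _ => norm_nonneg _)
            (fun i _ => hB _ (c.partSize_pos i) x hx)
        have h3 : ∏ i, (B ^ c.partSize i * m (c.partSize i)) =
            B ^ n * ((∏ i, ((c.partSize i).factorial : ℝ)) * ∏ i, M (c.partSize i)) := by
          rw [Finset.prod_mul_distrib, Finset.prod_pow_eq_pow_sum, cc_partSize,
            Finset.prod_congr rfl (fun i _ => hmM (c.partSize i)), Finset.prod_mul_distrib]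
        have h4 := cc_M M hMpos hconv hn c
        have hml := hpos _ (c.length_pos hn)
        calc _ ≤ (A ^ c.length * m c.length) * ∏ i, (B ^ c.partSize i * m (c.partSize i)) :=
              mul_le_mul h1 h2 (Finset.prod_nonneg fun _ _ => norm_nonneg _) (by positivity)
          _ = (A ^ c.length * B ^ n * c.length.factorial *
              ∏ i, ((c.partSize i).factorial : ℝ)) *
                (M c.length * ∏ i, M (c.partSize i)) := by
              rw [h3, hmM]; ring
          _ ≤ (A ^ c.length * B ^ n * c.length.factorial *
              ∏ i, ((c.partSize i).factorial : ℝ)) * (M 1 ^ c.length * M n) := by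
              gcongr
          _ = _ := by rw [mul_pow]; ring
    _ ≤ B ^ n * M n * ((n.factorial : ℝ) * (A * M 1 + 2) ^ n) := by
        rw [← Finset.mul_sum]
        exact mul_le_mul_of_nonneg_left (cc_count _ (by positivity) n) (by positivity)
    _ = _ := by rw [hmM n, mul_pow]; ring

/-- Composition of Carleman-class functions is a Carleman-class function. -/
theorem carleman_comp {d e : ℕ} (m : ℕ → ℝ) (hm : RegularSeq m)
    (D : Set (Fin d → ℝ)) (E : Set (Fin e → ℝ))
    (hDopen : IsOpen D) (hDbdd : Bornology.IsBounded D)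
    (hEopen : IsOpen E) (hEbdd : Bornology.IsBounded E)
    (u : (Fin d → ℝ) → (Fin e → ℝ))
    (hu : ∀ i : Fin e, CarlemanClass m D (fun x => u x i))
    (humaps : Set.MapsTo u D E)
    (g : (Fin e → ℝ) → ℝ) (hg : CarlemanClass m E g) :
    CarlemanClass m D (g ∘ u) := by
  exact cc_main m hm D E hDopen hEopen u (cc_pi m hm.1 D hDopen u hu) humaps g hg
end
end

section
/- Let (m_n) be a regular sequence and let F(t, z) be a real-valued function of (t, z) ∈ ℝ × ℝ^N which belongs to the Carleman class C(m_n, W) for some bounded open neighborhood W of a point (t₀, z₀), with F(t₀, z₀) = 0 and ∂F/∂t(t₀, z₀) ≠ 0. Then there exist an open neighborhood V of z₀ and a C^∞ function t* : V → ℝ with t*(z₀) = t₀ and F(t*(z), z) = 0 for all z ∈ V, and t* belongs to C(m_n, V). -/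
open Real Set Filter MeasureTheory
open scoped BigOperators Topology

noncomputable section

open scoped Nat in
lemma cif_term (w : ℕ → ℝ) (hw0 : ∀ n, 0 ≤ w n) (hw : ∀ a b, w a * w b ≤ w (a + b))
    {A B C0 D : ℝ} (hA : 0 ≤ A) (hB : 0 ≤ B) (hC0 : 0 ≤ C0) (hD : 0 ≤ D) (q r s k j : ℕ) (hj : j ≤ k)
    (a b : ℝ) (_ha0 : 0 ≤ a) (hb0 : 0 ≤ b)
    (ha : a ≤ A * C0 ^ j * (j ! : ℝ) * w (r + j))
    (hb : b ≤ B * D ^ (k - j) * ((q + (k - j))! : ℝ) * w (s + (k - j))) :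
    (k.choose j : ℝ) * a * b ≤
      A * B * (C0 ^ j * D ^ (k - j)) * ((q + k)! : ℝ) * w (r + s + k) := by
  have h1 : (k.choose j : ℝ) * (j ! : ℝ) * ((q + (k - j))! : ℝ) ≤ ((q + k)! : ℝ) := by
    have e := Nat.choose_mul_factorial_mul_factorial (n := q + k) (k := j) (by omega)
    have e2 : q + k - j = q + (k - j) := by omega
    rw [e2] at e
    rw [← e]
    push_cast
    gcongr
    omega
  have h2 : w (r + j) * w (s + (k - j)) ≤ w (r + s + k) := by
    have := hw (r + j) (s + (k - j))
    have e : r + j + (s + (k - j)) = r + s + k := by omega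
    rwa [e] at this
  have p1 := hw0 (r + j)
  have p2 := hw0 (s + (k - j))
  calc (k.choose j : ℝ) * a * b
      ≤ (k.choose j : ℝ) * (A * C0 ^ j * (j ! : ℝ) * w (r + j)) *
        (B * D ^ (k - j) * ((q + (k - j))! : ℝ) * w (s + (k - j))) := by gcongr
    _ = A * B * (C0 ^ j * D ^ (k - j)) * ((k.choose j : ℝ) * (j ! : ℝ) * ((q + (k - j))! : ℝ)) *
        (w (r + j) * w (s + (k - j))) := by ring
    _ ≤ _ := by gcongr

open scoped Nat in
lemma cif_sum (w : ℕ → ℝ) (hw0 : ∀ n, 0 ≤ w n) (hw : ∀ a b, w a * w b ≤ w (a + b))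
    {A B C0 D : ℝ} (hA : 0 ≤ A) (hB : 0 ≤ B) (hC0 : 0 ≤ C0) (hD : 2 * C0 ≤ D) (q r s k : ℕ)
    (a b : ℕ → ℝ) (ha0 : ∀ j, 0 ≤ a j) (hb0 : ∀ j, 0 ≤ b j)
    (ha : ∀ j ≤ k, a j ≤ A * C0 ^ j * (j ! : ℝ) * w (r + j))
    (hb : ∀ j ≤ k, b j ≤ B * D ^ j * ((q + j)! : ℝ) * w (s + j)) :
    ∑ j ∈ Finset.range (k + 1), (k.choose j : ℝ) * a j * b (k - j) ≤
      2 * A * B * D ^ k * ((q + k)! : ℝ) * w (r + s + k) := by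
  have hD0 : 0 ≤ D := by linarith
  have p3 := hw0 (r + s + k)
  calc ∑ j ∈ Finset.range (k + 1), (k.choose j : ℝ) * a j * b (k - j)
      ≤ ∑ j ∈ Finset.range (k + 1),
        (A * B * D ^ k * ((q + k)! : ℝ) * w (r + s + k)) * (1 / 2 : ℝ) ^ j := by
        apply Finset.sum_le_sum
        intro j hj
        have hj' : j ≤ k := by simpa [Nat.lt_succ_iff] using hj
        refine (cif_term w hw0 hw hA hB hC0 hD0 q r s k j hj' _ _ (ha0 _) (hb0 _) (ha j hj')
          (hb (k - j) (by omega))).trans ?_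
        have : C0 ^ j * D ^ (k - j) ≤ D ^ k * (1 / 2) ^ j := by
          calc C0 ^ j * D ^ (k - j) ≤ (D * (1 / 2)) ^ j * D ^ (k - j) := by
                gcongr; linarith
            _ = D ^ (j + (k - j)) * (1 / 2) ^ j := by rw [mul_pow, pow_add]; ring
            _ = _ := by congr 2; omega
        calc _ ≤ A * B * (D ^ k * (1 / 2) ^ j) * ((q + k)! : ℝ) * w (r + s + k) := by gcongr
          _ = _ := by ring
    _ = (A * B * D ^ k * ((q + k)! : ℝ) * w (r + s + k)) *
        ∑ j ∈ Finset.range (k + 1), (1 / 2 : ℝ) ^ j := by rw [Finset.mul_sum]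
    _ ≤ (A * B * D ^ k * ((q + k)! : ℝ) * w (r + s + k)) * 2 := by
        gcongr
        exact sum_geometric_two_le _
    _ = _ := by ring

open scoped Nat in
lemma cif_sum' (w : ℕ → ℝ) (hw0 : ∀ n, 0 ≤ w n) (hw : ∀ a b, w a * w b ≤ w (a + b))
    {A B D : ℝ} (hA : 0 ≤ A) (hB : 0 ≤ B) (hD : 0 ≤ D) (r s k : ℕ)
    (a b : ℕ → ℝ) (ha0 : ∀ j, 0 ≤ a j) (hb0 : ∀ j, 0 ≤ b j)
    (ha : ∀ j ≤ k, a j ≤ A * D ^ j * (j ! : ℝ) * w (r + j))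
    (hb : ∀ j ≤ k, b j ≤ B * D ^ j * (j ! : ℝ) * w (s + j)) :
    ∑ j ∈ Finset.range (k + 1), (k.choose j : ℝ) * a j * b (k - j) ≤
      A * B * D ^ k * ((k + 1)! : ℝ) * w (r + s + k) := by
  calc ∑ j ∈ Finset.range (k + 1), (k.choose j : ℝ) * a j * b (k - j)
      ≤ ∑ j ∈ Finset.range (k + 1), (A * B * D ^ k * (k ! : ℝ) * w (r + s + k)) := by
        apply Finset.sum_le_sum
        intro j hj
        have hj' : j ≤ k := by simpa [Nat.lt_succ_iff] using hj
        have := cif_term w hw0 hw hA hB hD hD 0 r s k j hj' _ _ (ha0 _) (hb0 _) (ha j hj')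
          (by simpa using hb (k - j) (by omega))
        rw [← pow_add] at this
        have e : j + (k - j) = k := by omega
        simpa [e] using this
    _ = _ := by
      rw [Finset.sum_const, Finset.card_range, Nat.factorial_succ, nsmul_eq_mul]
      push_cast; ring

open scoped Nat in
/-- closure of the class under the flow-type composition -/
lemma cif_main {E Y : Type} [NormedAddCommGroup E] [NormedSpace ℝ E]
    [NormedAddCommGroup Y] [NormedSpace ℝ Y]
    (w : ℕ → ℝ) (hw0 : ∀ n, 0 ≤ w n) (hw : ∀ a b, w a * w b ≤ w (a + b))
    (W : Set Y) (hWo : IsOpen W) (V : Set E) (hVo : IsOpen V) (g : E → Y) (hg : MapsTo g V W)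
    (P : Y → E →L[ℝ] Y) (hP : ContDiffOn ℝ (⊤ : ℕ∞) P W)
    (hd : ∀ z ∈ V, HasFDerivAt g (P (g z)) z)
    {A C0 D : ℝ} (hA : 0 ≤ A) (hC0 : 0 ≤ C0) (hD : 2 * C0 ≤ D)
    (hPb : ∀ k : ℕ, ∀ p ∈ W, ‖iteratedFDerivWithin ℝ k P W p‖ ≤ A * C0 ^ k * (k ! : ℝ) * w k)
    (n : ℕ) : ∀ (X : Type) [NormedAddCommGroup X] [NormedSpace ℝ X] (H : Y → X) (q : ℕ) (B : ℝ),
      0 ≤ B → ContDiffOn ℝ (⊤ : ℕ∞) H W →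
      (∀ k : ℕ, ∀ p ∈ W, ‖iteratedFDerivWithin ℝ k H W p‖ ≤
        B * D ^ k * ((q + k)! : ℝ) * w (q + k)) →
      ∀ z ∈ V, ‖iteratedFDerivWithin ℝ n (H ∘ g) V z‖ ≤
        B * (2 * A * D) ^ n * ((q + n)! : ℝ) * w (q + n) := by
  have hD0 : 0 ≤ D := by linarith
  induction n with
  | zero =>
    intro X _ _ H q B hB hH hb z hz
    have := hb 0 (g z) (hg hz)
    simpa using this
  | succ n ih =>
    intro X _ _ H q B hB hH hb z hz
    set H1 : Y → E →L[ℝ] X := fun p => (fderivWithin ℝ H W p).comp (P p) with hH1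
    have hfd : ContDiffOn ℝ (⊤ : ℕ∞) (fderivWithin ℝ H W) W :=
      hH.fderivWithin hWo.uniqueDiffOn (by simp)
    have hH1c : ContDiffOn ℝ (⊤ : ℕ∞) H1 W := hfd.clm_comp hP
    have hH1b : ∀ k : ℕ, ∀ p ∈ W, ‖iteratedFDerivWithin ℝ k H1 W p‖ ≤
        (2 * A * D * B) * D ^ k * ((q + 1 + k)! : ℝ) * w (q + 1 + k) := by
      intro k p hp
      have h1 := ((ContinuousLinearMap.compL ℝ E Y X).flip).norm_iteratedFDerivWithin_le_of_bilinear_of_le_one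
        hP hfd hWo.uniqueDiffOn hp (n := k) (by exact_mod_cast le_top)
        (by rw [ContinuousLinearMap.opNorm_flip]; exact ContinuousLinearMap.norm_compL_le ℝ E Y X)
      refine h1.trans ?_
      have h2 := cif_sum w hw0 hw hA (B := B * D) (by positivity) hC0 hD (q + 1) 0 (q + 1) k
        (fun j => ‖iteratedFDerivWithin ℝ j P W p‖)
        (fun j => ‖iteratedFDerivWithin ℝ j (fderivWithin ℝ H W) W p‖)
        (fun _ => norm_nonneg _) (fun _ => norm_nonneg _)
        (fun j _ => by simpa using hPb j p hp)
        (fun j _ => by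
          rw [norm_iteratedFDerivWithin_fderivWithin hWo.uniqueDiffOn hp]
          refine (hb (j + 1) p hp).trans (le_of_eq ?_)
          rw [show q + (j + 1) = q + 1 + j by ring]; ring)
      refine h2.trans (le_of_eq ?_)
      rw [show 0 + (q + 1) + k = q + 1 + k by ring]; ring
    have h3 := ih (E →L[ℝ] X) H1 (q + 1) (2 * A * D * B) (by positivity) hH1c hH1b z hz
    rw [← norm_iteratedFDerivWithin_fderivWithin hVo.uniqueDiffOn hz]
    have hcong : ∀ y ∈ V, fderivWithin ℝ (H ∘ g) V y = (H1 ∘ g) y := by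
      intro y hy
      rw [fderivWithin_of_isOpen hVo hy]
      have hHd : HasFDerivAt H (fderivWithin ℝ H W (g y)) (g y) := by
        have := (hH.differentiableOn (by simp)) (g y) (hg hy)
        exact this.hasFDerivWithinAt.hasFDerivAt (hWo.mem_nhds (hg hy))
      exact (hHd.comp y (hd y hy)).fderiv
    rw [iteratedFDerivWithin_congr hcong hz]
    refine h3.trans (le_of_eq ?_)
    rw [show q + (n + 1) = q + 1 + n by ring]; ring

open scoped Nat in
lemma cif_inv {Y : Type} [NormedAddCommGroup Y] [NormedSpace ℝ Y]
    (w : ℕ → ℝ) (hw0 : ∀ n, 0 ≤ w n) (hw1 : 1 ≤ w 0) (hw : ∀ a b, w a * w b ≤ w (a + b))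
    (W : Set Y) (hWo : IsOpen W) (h : Y → ℝ) (hh : ContDiffOn ℝ (⊤ : ℕ∞) h W)
    {A C0 c : ℝ} (hA : 0 ≤ A) (hC0 : 0 ≤ C0) (hc : 0 < c)
    (hb : ∀ k : ℕ, ∀ p ∈ W, ‖iteratedFDerivWithin ℝ k h W p‖ ≤ A * C0 ^ k * (k ! : ℝ) * w k)
    (hlow : ∀ p ∈ W, c ≤ |h p|) :
    ∃ B D : ℝ, 0 ≤ B ∧ 0 ≤ D ∧ ContDiffOn ℝ (⊤ : ℕ∞) (fun p => (h p)⁻¹) W ∧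
      ∀ k : ℕ, ∀ p ∈ W, ‖iteratedFDerivWithin ℝ k (fun p => (h p)⁻¹) W p‖ ≤
        B * D ^ k * (k ! : ℝ) * w k := by
  have hne : ∀ p ∈ W, h p ≠ 0 := fun p hp h0 => by
    have := hlow p hp; rw [h0, abs_zero] at this; linarith
  have hu : ContDiffOn ℝ (⊤ : ℕ∞) (fun p => (h p)⁻¹) W := hh.inv hne
  set u : Y → ℝ := fun p => (h p)⁻¹ with hudef
  set B : ℝ := c⁻¹ with hB
  have hB0 : 0 ≤ B := by positivity
  set D : ℝ := 2 * (2 * C0) + 2 * (A * C0) * B * 1 with hDdef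
  have hD0 : 0 ≤ D := by positivity
  have hD2 : 2 * (2 * C0) ≤ D := by rw [hDdef]; nlinarith [mul_nonneg (mul_nonneg hA hC0) hB0]
  have hfd : ContDiffOn ℝ (⊤ : ℕ∞) (fderivWithin ℝ h W) W :=
      hh.fderivWithin hWo.uniqueDiffOn (by simp)
  refine ⟨B, D, hB0, hD0, hu, ?_⟩
  intro k p hp
  induction k using Nat.strong_induction_on with
  | _ k ih =>
  rcases k with _ | n
  · simp only [norm_iteratedFDerivWithin_zero, pow_zero, Nat.factorial_zero, Nat.cast_one, mul_one]
    have : ‖u p‖ ≤ B := by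
      rw [hudef, hB]; simp only [norm_inv, Real.norm_eq_abs]
      exact inv_anti₀ hc (hlow p hp)
    nlinarith
  · rw [← norm_iteratedFDerivWithin_fderivWithin hWo.uniqueDiffOn hp]
    set v : Y → (Y →L[ℝ] ℝ) := fun p => u p • (fderivWithin ℝ h W p) with hv
    have hvc : ContDiffOn ℝ (⊤ : ℕ∞) v W := hu.smul hfd
    have hcong : ∀ y ∈ W, fderivWithin ℝ u W y = -(u y • v y) := by
      intro y hy
      have hd : HasFDerivWithinAt h (fderivWithin ℝ h W y) W y :=
        ((hh.differentiableOn (by simp)) y hy).hasFDerivWithinAt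
      have h1 := (hasDerivAt_inv (hne y hy)).comp_hasFDerivWithinAt y hd
      have h2 := h1.fderivWithin (hWo.uniqueDiffOn y hy)
      have h3 : fderivWithin ℝ u W y = (-(h y ^ 2)⁻¹) • fderivWithin ℝ h W y := h2
      rw [h3]
      ext x
      simp only [hv, hudef, smul_apply, neg_apply, smul_eq_mul]
      have := hne y hy
      field_simp
    rw [iteratedFDerivWithin_congr hcong hp]
    have e0 : iteratedFDerivWithin ℝ n (fun y => -(u y • v y)) W p
        = - iteratedFDerivWithin ℝ n (fun y => (u y • v y)) W p :=
      iteratedFDerivWithin_neg_apply hWo.uniqueDiffOn hp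
    rw [e0, norm_neg]
    have hvb : ∀ j ≤ n, ‖iteratedFDerivWithin ℝ j v W p‖ ≤
        (2 * (A * C0) * B) * D ^ j * (j ! : ℝ) * w (1 + j) := by
      intro j hj
      have h1 := ((ContinuousLinearMap.lsmul ℝ ℝ : ℝ →L[ℝ] (Y →L[ℝ] ℝ) →L[ℝ] (Y →L[ℝ] ℝ)).flip).norm_iteratedFDerivWithin_le_of_bilinear_of_le_one
        hfd hu hWo.uniqueDiffOn hp (n := j) (by exact_mod_cast le_top)
        (by rw [ContinuousLinearMap.opNorm_flip]; exact ContinuousLinearMap.opNorm_lsmul_le)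
      refine h1.trans ?_
      have h2 := cif_sum w hw0 hw (A := A * C0) (C0 := 2 * C0) (by positivity) hB0 (by positivity)
        hD2 0 1 0 j
        (fun j => ‖iteratedFDerivWithin ℝ j (fderivWithin ℝ h W) W p‖)
        (fun j => ‖iteratedFDerivWithin ℝ j u W p‖)
        (fun _ => norm_nonneg _) (fun _ => norm_nonneg _)
        (fun i hi => by
          rw [norm_iteratedFDerivWithin_fderivWithin hWo.uniqueDiffOn hp]
          refine (hb (i + 1) p hp).trans ?_
          have p1 := hw0 (1 + i)
          have h5 : ((i + 1 : ℕ) : ℝ) ≤ 2 ^ i := by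
            exact_mod_cast Nat.succ_le_of_lt (Nat.lt_two_pow_self)
          rw [Nat.factorial_succ, add_comm i 1, mul_pow]
          push_cast at h5 ⊢
          calc A * C0 ^ (1 + i) * ((1 + (i : ℝ)) * (i ! : ℝ)) * w (1 + i)
              = A * C0 * C0 ^ i * (((i : ℝ) + 1) * (i ! : ℝ)) * w (1 + i) := by ring
            _ ≤ A * C0 * C0 ^ i * (2 ^ i * (i ! : ℝ)) * w (1 + i) := by gcongr
            _ = _ := by ring)
        (fun i hi => by simpa using ih i (by omega))
      refine h2.trans (le_of_eq ?_)
      simp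
    have h1 := norm_iteratedFDerivWithin_smul_le hu hvc hWo.uniqueDiffOn hp (n := n)
      (by exact_mod_cast le_top)
    refine h1.trans ?_
    have h2 := cif_sum' w hw0 hw hB0 (B := 2 * (A * C0) * B) (by positivity) hD0 0 1 n
        (fun j => ‖iteratedFDerivWithin ℝ j u W p‖)
        (fun j => ‖iteratedFDerivWithin ℝ j v W p‖)
        (fun _ => norm_nonneg _) (fun _ => norm_nonneg _)
        (fun i hi => by simpa using ih i (by omega))
        hvb
    refine h2.trans ?_
    rw [show 0 + 1 + n = n + 1 by ring, pow_succ]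
    have p1 := hw0 (n + 1)
    have : 2 * (A * C0) * B ≤ D := by rw [hDdef]; linarith
    calc B * (2 * (A * C0) * B) * D ^ n * ((n + 1)! : ℝ) * w (n + 1)
        ≤ B * D * D ^ n * ((n + 1)! : ℝ) * w (n + 1) := by gcongr
      _ = _ := by ring

open scoped Nat in
lemma cif_weights (m : ℕ → ℝ) (hm : RegularSeq m) :
    ∃ w : ℕ → ℝ, (∀ n, 0 < w n) ∧ w 0 = 1 ∧ (∀ a b, w a * w b ≤ w (a + b)) ∧
      ∀ n, m (n + 1) = m 1 * ((n + 1)! : ℝ) * w n := by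
  obtain ⟨hpos, -, -, -, hconv⟩ := hm
  have hp : ∀ n, 0 < m (n + 1) := fun n => hpos (n + 1) (by omega)
  have h1 : 0 < m 1 := hp 0
  set w : ℕ → ℝ := fun n => m (n + 1) / ((n + 1)! : ℝ) / m 1 with hw
  have hwp : ∀ n, 0 < w n := fun n => by
    have := hp n
    simp only [hw]; positivity
  have hw0 : w 0 = 1 := by simp [hw, h1.ne']
  have hc : ∀ n, w (n + 1) * w (n + 1) ≤ w n * w (n + 2) := by
    intro n
    have h := hconv (n + 1) (by omega)
    have p1 := hp n
    have p2 := hp (n + 1)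
    have p3 := hp (n + 2)
    have q1 : 0 < m (n + 1) / ((n + 1)! : ℝ) := by positivity
    have q2 : 0 < m (n + 1 + 1) / ((n + 1 + 1)! : ℝ) := by positivity
    have q3 : 0 < m (n + 1 + 2) / ((n + 1 + 2)! : ℝ) := by
      have : 0 < m (n + 1 + 2) := p3
      positivity
    have h' : Real.log (m (n + 1 + 1) / ((n + 1 + 1)! : ℝ) * (m (n + 1 + 1) / ((n + 1 + 1)! : ℝ)))
        ≤ Real.log (m (n + 1) / ((n + 1)! : ℝ) * (m (n + 1 + 2) / ((n + 1 + 2)! : ℝ))) := by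
      rw [Real.log_mul q2.ne' q2.ne', Real.log_mul q1.ne' q3.ne']
      linarith
    have h'' := (Real.log_le_log_iff (by positivity) (by positivity)).1 h'
    have e1 : w (n + 1) * w (n + 1) = (m (n + 1 + 1) / ((n + 1 + 1)! : ℝ) *
        (m (n + 1 + 1) / ((n + 1 + 1)! : ℝ))) / (m 1 * m 1) := by
      simp only [hw]; field_simp
    have e2 : w n * w (n + 2) = (m (n + 1) / ((n + 1)! : ℝ) *
        (m (n + 1 + 2) / ((n + 1 + 2)! : ℝ))) / (m 1 * m 1) := by
      have e3 : n + 2 + 1 = n + 1 + 2 := by ring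
      simp only [hw, e3]; field_simp
    rw [e1, e2]
    gcongr
  -- ratios are monotone
  have hr : Monotone (fun n => w (n + 1) / w n) := by
    apply monotone_nat_of_le_succ
    intro n
    rw [div_le_div_iff₀ (hwp _) (hwp _)]
    have := hc n
    linarith
  refine ⟨w, hwp, hw0, ?_, ?_⟩
  · intro a b
    induction b with
    | zero => simp [hw0]
    | succ b ih =>
      have h2 : w (b + 1) = w b * (w (b + 1) / w b) := by have := (hwp b).ne'; field_simp
      have h3 : w (a + b + 1) = w (a + b) * (w (a + b + 1) / w (a + b)) := by
        have := (hwp (a + b)).ne'; field_simp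
      have h4 : w (b + 1) / w b ≤ w (a + b + 1) / w (a + b) := hr (show b ≤ a + b by omega)
      rw [← add_assoc, h3, h2, ← mul_assoc]
      have := hwp b
      have := hwp (b + 1)
      have := hwp (a + b)
      gcongr
  · intro n
    simp only [hw]
    field_simp

open scoped Nat in
lemma cif_left {Y X Z : Type} [NormedAddCommGroup Y] [NormedSpace ℝ Y]
    [NormedAddCommGroup X] [NormedSpace ℝ X] [NormedAddCommGroup Z] [NormedSpace ℝ Z]
    (W : Set Y) (hWo : IsOpen W) (L : X →L[ℝ] Z) (f : Y → X) (hf : ContDiffOn ℝ (⊤ : ℕ∞) f W)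
    (k : ℕ) (p : Y) (hp : p ∈ W) :
    ‖iteratedFDerivWithin ℝ k (fun y => L (f y)) W p‖ ≤ ‖L‖ * ‖iteratedFDerivWithin ℝ k f W p‖ := by
  have := L.iteratedFDerivWithin_comp_left (hf p hp) hWo.uniqueDiffOn hp (i := k)
    (by exact_mod_cast le_top)
  change ‖iteratedFDerivWithin ℝ k (L ∘ f) W p‖ ≤ _
  rw [this]
  exact L.norm_compContinuousMultilinearMap_le _

/-- the linear map `T ↦ (v ↦ (-T (0,v), T (1,0) • v))` -/
def cifL (E : Type) [NormedAddCommGroup E] [NormedSpace ℝ E] :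
    ((ℝ × E) →L[ℝ] ℝ) →L[ℝ] (E →L[ℝ] (ℝ × E)) :=
  (ContinuousLinearMap.apply ℝ ℝ ((1 : ℝ), (0 : E))).smulRight (ContinuousLinearMap.inr ℝ ℝ E) -
    (ContinuousLinearMap.compL ℝ E ℝ (ℝ × E) (ContinuousLinearMap.inl ℝ ℝ E)) ∘L
      ((ContinuousLinearMap.compL ℝ E (ℝ × E) ℝ).flip (ContinuousLinearMap.inr ℝ ℝ E))

lemma cifL_apply (E : Type) [NormedAddCommGroup E] [NormedSpace ℝ E]
    (T : (ℝ × E) →L[ℝ] ℝ) (v : E) : cifL E T v = (-T (0, v), T (1, 0) • v) := by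
  simp [cifL]

set_option maxHeartbeats 1600000 in
open scoped Nat in
lemma cif_core {N : ℕ} (m : ℕ → ℝ) (hm : RegularSeq m)
    (F : ℝ × (Fin N → ℝ) → ℝ) (t₀ : ℝ) (z₀ : Fin N → ℝ)
    (W : Set (ℝ × (Fin N → ℝ))) (hWo : IsOpen W)
    (hW : (t₀, z₀) ∈ W) (hF : CarlemanClass m W F)
    (hF0 : F (t₀, z₀) = 0) (c : ℝ) (hc : 0 < c)
    (hlow : ∀ p ∈ W, c ≤ |fderivWithin ℝ F W p (1, 0)|) :
    ∃ V : Set (Fin N → ℝ), IsOpen V ∧ z₀ ∈ V ∧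
      ∃ tstar : (Fin N → ℝ) → ℝ,
        ContDiffOn ℝ (⊤ : ℕ∞) tstar V ∧ tstar z₀ = t₀ ∧
        (∀ z ∈ V, F (tstar z, z) = 0) ∧
        CarlemanClass m V tstar := by
  obtain ⟨w, hwp, hw1, hw, hmw⟩ := cif_weights m hm
  have hw0 : ∀ n, 0 ≤ w n := fun n => (hwp n).le
  have hm1 : 0 < m 1 := hm.1 1 le_rfl
  obtain ⟨hFc, C, hC, hFb⟩ := hF
  set T := fderivWithin ℝ F W with hT
  have hTc : ContDiffOn ℝ (⊤ : ℕ∞) T W := hFc.fderivWithin hWo.uniqueDiffOn (by simp)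
  have hTb : ∀ k : ℕ, ∀ p ∈ W, ‖iteratedFDerivWithin ℝ k T W p‖ ≤
      (C * m 1) * (2 * C) ^ k * (k ! : ℝ) * w k := by
    intro k p hp
    rw [hT, norm_iteratedFDerivWithin_fderivWithin hWo.uniqueDiffOn hp]
    refine (hFb (k + 1) (by omega) p hp).trans ?_
    rw [hmw, Nat.factorial_succ]
    have h5 : ((k + 1 : ℕ) : ℝ) ≤ 2 ^ k := by
      exact_mod_cast Nat.succ_le_of_lt (Nat.lt_two_pow_self)
    have := hw0 k
    rw [Nat.cast_mul]
    calc C ^ (k + 1) * (m 1 * (((k + 1 : ℕ) : ℝ) * (k ! : ℝ)) * w k)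
        ≤ C ^ (k + 1) * (m 1 * (2 ^ k * (k ! : ℝ)) * w k) := by gcongr
      _ = _ := by rw [mul_pow]; ring
  set h : ℝ × (Fin N → ℝ) → ℝ := fun p => T p (1, 0) with hh
  set ev := ContinuousLinearMap.apply ℝ ℝ ((1 : ℝ), (0 : Fin N → ℝ)) with hev
  have hhc : ContDiffOn ℝ (⊤ : ℕ∞) h W := hTc.clm_apply contDiffOn_const
  have hhb : ∀ k : ℕ, ∀ p ∈ W, ‖iteratedFDerivWithin ℝ k h W p‖ ≤
      (‖ev‖ * (C * m 1)) * (2 * C) ^ k * (k ! : ℝ) * w k := by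
    intro k p hp
    refine (cif_left W hWo ev T hTc k p hp).trans ?_
    calc _ ≤ ‖ev‖ * ((C * m 1) * (2 * C) ^ k * (k ! : ℝ) * w k) := by gcongr; exact hTb k p hp
      _ = _ := by ring
  obtain ⟨B, D, hB, hD, huc, hub⟩ := cif_inv w hw0 hw1.ge hw W hWo h hhc (by positivity)
    (by positivity) hc hhb hlow
  have hne : ∀ p ∈ W, h p ≠ 0 := fun p hp h0 => by
    have h5 : c ≤ |h p| := hlow p hp
    rw [h0, abs_zero] at h5; linarith
  set u : ℝ × (Fin N → ℝ) → ℝ := fun p => (h p)⁻¹ with hu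
  have hLc : ContDiffOn ℝ (⊤ : ℕ∞) (fun p => cifL (Fin N → ℝ) (T p)) W :=
    (cifL (Fin N → ℝ)).contDiff.comp_contDiffOn hTc
  set C1 : ℝ := 2 * C + 2 * D with hC1
  have hC10 : 0 ≤ C1 := by positivity
  have hLb : ∀ k : ℕ, ∀ p ∈ W,
      ‖iteratedFDerivWithin ℝ k (fun p => cifL (Fin N → ℝ) (T p)) W p‖ ≤
      (‖cifL (Fin N → ℝ)‖ * (C * m 1)) * C1 ^ k * (k ! : ℝ) * w k := by
    intro k p hp
    refine (cif_left W hWo (cifL (Fin N → ℝ)) T hTc k p hp).trans ?_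
    have := hw0 k
    calc _ ≤ ‖cifL (Fin N → ℝ)‖ * ((C * m 1) * (2 * C) ^ k * (k ! : ℝ) * w k) := by
          gcongr; exact hTb k p hp
      _ ≤ ‖cifL (Fin N → ℝ)‖ * ((C * m 1) * C1 ^ k * (k ! : ℝ) * w k) := by
          gcongr; linarith
      _ = _ := by ring
  set P : ℝ × (Fin N → ℝ) → (Fin N → ℝ) →L[ℝ] (ℝ × (Fin N → ℝ)) :=
    fun p => u p • cifL (Fin N → ℝ) (T p) with hP
  have hPc : ContDiffOn ℝ (⊤ : ℕ∞) P W := huc.smul hLc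
  set A : ℝ := 2 * B * (‖cifL (Fin N → ℝ)‖ * (C * m 1)) with hA
  have hA0 : 0 ≤ A := by positivity
  have hPb : ∀ k : ℕ, ∀ p ∈ W, ‖iteratedFDerivWithin ℝ k P W p‖ ≤
      A * C1 ^ k * (k ! : ℝ) * w k := by
    intro k p hp
    refine (norm_iteratedFDerivWithin_smul_le huc hLc hWo.uniqueDiffOn hp (n := k)
      (by exact_mod_cast le_top)).trans ?_
    have h2 := cif_sum w hw0 hw hB (B := ‖cifL (Fin N → ℝ)‖ * (C * m 1)) (by positivity) hD
      (D := C1) (by linarith) 0 0 0 k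
        (fun j => ‖iteratedFDerivWithin ℝ j u W p‖)
        (fun j => ‖iteratedFDerivWithin ℝ j (fun p => cifL (Fin N → ℝ) (T p)) W p‖)
        (fun _ => norm_nonneg _) (fun _ => norm_nonneg _)
        (fun i hi => by simpa using hub i p hp)
        (fun i hi => by simpa using hLb i p hp)
    refine h2.trans (le_of_eq ?_)
    simp [hA]
  have hPapp : ∀ p ∈ W, ∀ v, P p v = (-(u p * T p (0, v)), v) := by
    intro p hp v
    have h5 : u p * T p (1, 0) = 1 := inv_mul_cancel₀ (hne p hp)
    simp only [hP, smul_apply, cifL_apply]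
    rw [Prod.smul_mk, smul_smul, h5]
    simp
  -- the local diffeomorphism
  set Q : ℝ × (Fin N → ℝ) → ℝ × (Fin N → ℝ) := fun p => (F p, p.2) with hQ
  have hQc : ∀ p ∈ W, ContDiffAt ℝ (⊤ : ℕ∞) Q p := fun p hp =>
    (hFc.contDiffAt (hWo.mem_nhds hp)).prodMk contDiffAt_snd
  have hQe : ∀ p ∈ W, ∃ e : (ℝ × (Fin N → ℝ)) ≃L[ℝ] (ℝ × (Fin N → ℝ)),
      HasFDerivAt Q (e : (ℝ × (Fin N → ℝ)) →L[ℝ] (ℝ × (Fin N → ℝ))) p ∧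
      ∀ v, e.symm (0, v) = P p v := by
    intro p hp
    have h5 : u p * T p (1, 0) = 1 := inv_mul_cancel₀ (hne p hp)
    have hdec : ∀ (s : ℝ) (v : Fin N → ℝ), T p (s, v) = s * T p (1, 0) + T p (0, v) := by
      intro s v
      have : ((s, v) : ℝ × (Fin N → ℝ)) = s • (1, 0) + (0, v) := by simp
      rw [this, map_add, map_smul, smul_eq_mul]
    refine ⟨ContinuousLinearEquiv.equivOfInverse
      ((T p).prod (ContinuousLinearMap.snd ℝ ℝ (Fin N → ℝ)))
      ((ContinuousLinearMap.fst ℝ ℝ (Fin N → ℝ)).smulRight (u p, (0 : Fin N → ℝ)) +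
        (P p) ∘L (ContinuousLinearMap.snd ℝ ℝ (Fin N → ℝ))) ?_ ?_, ?_, ?_⟩
    · rintro ⟨s, v⟩
      simp only [ContinuousLinearMap.prod_apply, add_apply,
        ContinuousLinearMap.smulRight_apply, ContinuousLinearMap.coe_fst',
        ContinuousLinearMap.coe_snd', ContinuousLinearMap.comp_apply, hPapp p hp]
      rw [hdec s v]
      ext
      · simp
        linear_combination s * h5
      · simp
    · rintro ⟨s, v⟩
      simp only [ContinuousLinearMap.prod_apply, add_apply,
        ContinuousLinearMap.smulRight_apply, ContinuousLinearMap.coe_fst',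
        ContinuousLinearMap.coe_snd', ContinuousLinearMap.comp_apply, hPapp p hp]
      ext
      · simp
        rw [hdec]
        linear_combination (s - T p (0, v)) * h5
      · simp
    · have h6 : HasFDerivAt F (T p) p :=
        ((hFc.differentiableOn (by simp)) p hp).hasFDerivWithinAt.hasFDerivAt (hWo.mem_nhds hp)
      exact h6.prodMk hasFDerivAt_snd
    · intro v
      change (0 : ℝ) • (u p, (0 : Fin N → ℝ)) + P p v = P p v
      rw [zero_smul, zero_add]
  obtain ⟨e0, he0, -⟩ := hQe _ hW
  set R := (hQc _ hW).toOpenPartialHomeomorph Q he0 (by simp) with hR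
  have hRQ : ∀ p, R p = Q p := fun p => rfl
  have hRs : (t₀, z₀) ∈ R.source := (hQc _ hW).mem_toOpenPartialHomeomorph_source he0 (by simp)
  set g : (Fin N → ℝ) → ℝ × (Fin N → ℝ) := fun z => R.symm (0, z) with hg
  have hR0 : R (t₀, z₀) = (0, z₀) := by rw [hRQ, hQ]; simp [hF0]
  have hg0 : g z₀ = (t₀, z₀) := by
    simp only [hg]; rw [← hR0]; exact R.left_inv hRs
  set V : Set (Fin N → ℝ) := (fun z => ((0 : ℝ), z)) ⁻¹' (R.target ∩ R.symm ⁻¹' W) with hV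
  have hVo : IsOpen V := (R.isOpen_inter_preimage_symm hWo).preimage (by fun_prop)
  have hz0 : z₀ ∈ V := by
    refine ⟨?_, ?_⟩
    · change ((0 : ℝ), z₀) ∈ R.target
      rw [← hR0]; exact R.map_source hRs
    · change g z₀ ∈ W
      rw [hg0]; exact hW
  have hgW : MapsTo g V W := fun z hz => hz.2
  have hQg : ∀ z ∈ V, Q (g z) = (0, z) := fun z hz => R.right_inv hz.1
  have hgd : ∀ z ∈ V, HasFDerivAt g (P (g z)) z := by
    intro z hz
    obtain ⟨e, he, hes⟩ := hQe (g z) (hgW hz)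
    have h6 := R.hasFDerivAt_symm (a := ((0 : ℝ), z)) hz.1 he
    have h7 : HasFDerivAt (fun z : Fin N → ℝ => ((0 : ℝ), z))
      (ContinuousLinearMap.inr ℝ ℝ (Fin N → ℝ)) z := hasFDerivAt_prodMk_right 0 z
    have h8 := h6.comp z h7
    have h9 : P (g z) = (e.symm : (ℝ × (Fin N → ℝ)) →L[ℝ] (ℝ × (Fin N → ℝ))) ∘L
        (ContinuousLinearMap.inr ℝ ℝ (Fin N → ℝ)) := by
      refine ContinuousLinearMap.ext fun v => ?_
      rw [← hes v]; rfl
    rw [h9]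
    exact h8
  have hgc : ContDiffOn ℝ (⊤ : ℕ∞) g V := by
    intro z hz
    obtain ⟨e, he, hes⟩ := hQe (g z) (hgW hz)
    have h6 := R.contDiffAt_symm (a := ((0 : ℝ), z)) hz.1 he (hQc (g z) (hgW hz))
    exact (h6.comp z (contDiffAt_const.prodMk contDiffAt_id)).contDiffWithinAt
  have hgb := fun k => cif_main w hw0 hw W hWo V hVo g hgW P hPc hgd hA0 hC10 le_rfl hPb k
    _ P 0 A hA0 hPc (by
      intro j p hp
      refine (hPb j p hp).trans ?_
      have := hw0 j
      simp only [zero_add]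
      gcongr
      linarith)
  have htc : ContDiffOn ℝ (⊤ : ℕ∞) (fun z => (g z).1) V := hgc.fst
  refine ⟨V, hVo, hz0, fun z => (g z).1, htc, by simp [hg0], ?_, htc, ?_⟩
  · intro z hz
    have h6 := hQg z hz
    have h7 : (g z).2 = z := congrArg Prod.snd h6
    have h8 : F (g z) = 0 := congrArg Prod.fst h6
    have h9 : g z = ((g z).1, z) := Prod.ext rfl h7
    change F ((g z).1, z) = 0
    rw [← h9, h8]
  · set K : ℝ := 2 * A * (2 * C1) with hK
    have hK0 : 0 ≤ K := by positivity
    have hA1 : 0 ≤ A / m 1 := by positivity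
    have hf1 : ‖ContinuousLinearMap.fst ℝ ℝ (Fin N → ℝ)‖ ≤ 1 :=
      ContinuousLinearMap.norm_fst_le ℝ ℝ (Fin N → ℝ)
    refine ⟨A / m 1 + K + 1, by linarith, ?_⟩
    intro n hn z hz
    obtain ⟨k, rfl⟩ : ∃ k, n = k + 1 := ⟨n - 1, by omega⟩
    have h1 := cif_left V hVo (ContinuousLinearMap.fst ℝ ℝ (Fin N → ℝ)) g hgc (k + 1) z hz
    have h2 : ‖iteratedFDerivWithin ℝ (k + 1) g V z‖ ≤ A * K ^ k * (k ! : ℝ) * w k := by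
      rw [← norm_iteratedFDerivWithin_fderivWithin hVo.uniqueDiffOn hz]
      have hcong : ∀ y ∈ V, fderivWithin ℝ g V y = (P ∘ g) y := by
        intro y hy
        rw [fderivWithin_of_isOpen hVo hy]
        exact (hgd y hy).fderiv
      rw [iteratedFDerivWithin_congr hcong hz]
      simpa using hgb k z hz
    have h3 : A * K ^ k * (k ! : ℝ) * w k ≤ (A / m 1 + K + 1) ^ (k + 1) * m (k + 1) := by
      have p1 := hw0 k
      calc A * K ^ k * (k ! : ℝ) * w k
          ≤ A * K ^ k * ((k + 1)! : ℝ) * w k := by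
            gcongr
            omega
        _ = K ^ k * (A / m 1) * m (k + 1) := by
            rw [hmw k]; field_simp
        _ ≤ (A / m 1 + K + 1) ^ k * (A / m 1 + K + 1) * m (k + 1) := by
            have := hm.1 (k + 1) (by omega)
            gcongr <;> linarith
        _ = _ := by rw [pow_succ]
    calc _ ≤ _ := h1
      _ ≤ 1 * ‖iteratedFDerivWithin ℝ (k + 1) g V z‖ := by gcongr
      _ ≤ _ := by rw [one_mul]; exact h2.trans h3

/-- Carleman-class implicit function theorem: if `F ∈ C(m_n, W)`, `F (t₀, z₀) = 0` and
`∂F/∂t (t₀, z₀) ≠ 0`, then the local solution `t*` of `F (t*(z), z) = 0` belongs to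
`C(m_n, V)` on a neighbourhood `V` of `z₀`. -/
theorem carleman_implicit_function {N : ℕ} (m : ℕ → ℝ) (hm : RegularSeq m)
    (F : ℝ × (Fin N → ℝ) → ℝ) (t₀ : ℝ) (z₀ : Fin N → ℝ)
    (W : Set (ℝ × (Fin N → ℝ))) (hWopen : IsOpen W) (hWbdd : Bornology.IsBounded W)
    (hW : (t₀, z₀) ∈ W) (hF : CarlemanClass m W F)
    (hF0 : F (t₀, z₀) = 0)
    (hFt : fderiv ℝ F (t₀, z₀) (1, 0) ≠ 0) :
    ∃ V : Set (Fin N → ℝ), IsOpen V ∧ z₀ ∈ V ∧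
      ∃ tstar : (Fin N → ℝ) → ℝ,
        ContDiffOn ℝ (⊤ : ℕ∞) tstar V ∧ tstar z₀ = t₀ ∧
        (∀ z ∈ V, F (tstar z, z) = 0) ∧
        CarlemanClass m V tstar := by
  obtain ⟨hFc, C, hC, hFb⟩ := hF
  set h : ℝ × (Fin N → ℝ) → ℝ := fun p => fderivWithin ℝ F W p (1, 0) with hh
  have hhc : ContinuousOn h W :=
    ((hFc.fderivWithin (m := (⊤ : ℕ∞)) hWopen.uniqueDiffOn (by simp)).clm_apply
      contDiffOn_const).continuousOn
  have hh0 : 0 < |h (t₀, z₀)| := by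
    rw [abs_pos]
    simp only [hh]
    rw [fderivWithin_of_isOpen hWopen hW]
    exact hFt
  set c : ℝ := |h (t₀, z₀)| / 2 with hc
  have hc0 : 0 < c := by positivity
  set W' : Set (ℝ × (Fin N → ℝ)) := W ∩ (fun p => |h p|) ⁻¹' Ioi c with hW'
  have hWo' : IsOpen W' := hhc.abs.isOpen_inter_preimage hWopen isOpen_Ioi
  have hmem : (t₀, z₀) ∈ W' := ⟨hW, by
    change c < |h (t₀, z₀)|
    linarith⟩
  refine cif_core m hm F t₀ z₀ W' hWo' hmem ⟨hFc.mono inter_subset_left, C, hC, ?_⟩ hF0 c hc0 ?_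
  · intro n hn x hx
    rw [iteratedFDerivWithin_of_isOpen n hWo' hx, ← iteratedFDerivWithin_of_isOpen n hWopen hx.1]
    exact hFb n hn x hx.1
  · intro p hp
    rw [fderivWithin_of_isOpen hWo' hp, ← fderivWithin_of_isOpen hWopen hp.1]
    exact le_of_lt hp.2
end
end

section
/- Let (m_n) be a regular sequence and let f : ℝ × ℝ^N → ℝ^N be a map whose components belong to the Carleman class C(m_n, D) for every bounded open set D ⊆ ℝ^{1+N}. Suppose U ⊆ ℝ^N is open, a > 0, and for every z₀ ∈ U the Cauchy problem ∂z/∂t = f(t, z(t)), z(0) = z₀, has a continuously differentiable solution z(t; z₀) defined for t ∈ (−a, a). Then the map (t, z₀) ↦ z(t; z₀) belongs (componentwise) to C(m_n, D) for every bounded open set D with compact closure contained in (−a, a) × U. -/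
open Real Set Filter MeasureTheory
open scoped BigOperators Topology

noncomputable section

def PP : ℕ → ℝ → ℝ
  | 0, _ => 1
  | n + 1, x => x * PP n (x + 2)

lemma PP_nonneg (n : ℕ) : ∀ x : ℝ, 0 ≤ x → 0 ≤ PP n x := by
  induction n with
  | zero => intro x _; simp [PP]
  | succ n ih => intro x hx; simp only [PP]; exact mul_nonneg hx (ih _ (by linarith))

lemma PP_right (n : ℕ) : ∀ x : ℝ, PP (n + 1) x = PP n x * (x + 2 * n) := by
  induction n with
  | zero => intro x; simp [PP]
  | succ n ih =>
    intro x
    rw [PP, ih]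
    conv_rhs => rw [PP]
    push_cast; ring

lemma PP_ge (n : ℕ) : (n.factorial : ℝ) ≤ PP n 1 := by
  induction n with
  | zero => simp [PP]
  | succ n ih =>
    rw [PP_right, Nat.factorial_succ]
    push_cast
    have : (0:ℝ) ≤ n := by positivity
    have h2 : (0:ℝ) ≤ n.factorial := by positivity
    nlinarith

lemma PP_le (n : ℕ) : PP n 1 ≤ 2 ^ n * (n.factorial : ℝ) := by
  induction n with
  | zero => simp [PP]
  | succ n ih =>
    rw [PP_right, Nat.factorial_succ, pow_succ]
    push_cast
    have : (0:ℝ) ≤ n := by positivity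
    have h2 : (0:ℝ) ≤ 2 ^ n * (n.factorial : ℝ) := by positivity
    nlinarith

lemma PP_conv (n : ℕ) : ∀ x y : ℝ,
    ∑ p ∈ Finset.HasAntidiagonal.antidiagonal n, (n.choose p.1 : ℝ) * (PP p.1 x * PP p.2 y) = PP n (x + y) := by
  induction n with
  | zero => intro x y; simp [PP]
  | succ n ih =>
    intro x y
    rw [Finset.sum_antidiagonal_choose_succ_mul (fun i j => PP i x * PP j y)]
    have h1 : ∑ p ∈ Finset.HasAntidiagonal.antidiagonal n, (n.choose p.1 : ℝ) * (PP p.1 x * PP (p.2 + 1) y)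
        = y * PP n (x + (y + 2)) := by
      rw [← ih, Finset.mul_sum]
      refine Finset.sum_congr rfl fun p _ => ?_
      rw [PP]; ring
    have h2 : ∑ p ∈ Finset.HasAntidiagonal.antidiagonal n, (n.choose p.2 : ℝ) * (PP (p.1 + 1) x * PP p.2 y)
        = x * PP n ((x + 2) + y) := by
      rw [← ih, Finset.mul_sum]
      refine Finset.sum_congr rfl fun p hp => ?_
      have : n.choose p.2 = n.choose p.1 := by
        rw [← Finset.HasAntidiagonal.mem_antidiagonal.mp hp]
        exact Nat.choose_symm_add.symm
      rw [PP, this]; ring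
    rw [h1, h2, PP, show x + (y + 2) = x + y + 2 by ring, show x + 2 + y = x + y + 2 by ring]
    ring

structure LC (μ : ℕ → ℝ) : Prop where
  pos : ∀ n, 0 < μ n
  conv : ∀ p q, μ p * μ q ≤ μ 0 * μ (p + q)

lemma conv_bound {μ : ℕ → ℝ} (hμ : LC μ) {A B β x y : ℝ} (hA : 0 ≤ A) (hB : 0 ≤ B)
    (hβ : 0 ≤ β) (hx : 0 ≤ x) (hy : 0 ≤ y) (p q n : ℕ) (a b : ℕ → ℝ)
    (hb0 : ∀ i, 0 ≤ b i)
    (ha : ∀ i ≤ n, a i ≤ A * β ^ i * PP i x * μ (i + p))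
    (hb : ∀ i ≤ n, b i ≤ B * β ^ i * PP i y * μ (i + q)) :
    ∑ i ∈ Finset.range (n + 1), (n.choose i : ℝ) * a i * b (n - i) ≤
      A * B * β ^ n * PP n (x + y) * (μ 0 * μ (n + (p + q))) := by
  rw [← Finset.Nat.sum_antidiagonal_eq_sum_range_succ
    (fun i j => (n.choose i : ℝ) * a i * b j), ← PP_conv, Finset.mul_sum, Finset.sum_mul]
  refine Finset.sum_le_sum fun ij hij => ?_
  obtain ⟨i, j⟩ := ij
  have hij' : i + j = n := Finset.HasAntidiagonal.mem_antidiagonal.mp hij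
  have hPi := PP_nonneg i x hx
  have hPj := PP_nonneg j y hy
  have h1 := ha i (by omega)
  have h2 := hb j (by omega)
  have h3 := hμ.conv (i + p) (j + q)
  have e : i + p + (j + q) = n + (p + q) := by omega
  rw [e] at h3
  have hp1 := (hμ.pos (i+p)).le
  calc (n.choose i : ℝ) * a i * b j
      ≤ (n.choose i : ℝ) * (A * β ^ i * PP i x * μ (i + p)) * (B * β ^ j * PP j y * μ (j + q)) := by
        have := hb0 j
        gcongr
    _ = (n.choose i : ℝ) * A * B * β ^ n * PP i x * PP j y * (μ (i + p) * μ (j + q)) := by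
        rw [← hij', pow_add]; ring
    _ ≤ (n.choose i : ℝ) * A * B * β ^ n * PP i x * PP j y * (μ 0 * μ (n + (p + q))) := by
        gcongr
    _ = _ := by ring

section general
variable {D E F G : Type} [NormedAddCommGroup D] [NormedSpace ℝ D]
  [NormedAddCommGroup E] [NormedSpace ℝ E] [NormedAddCommGroup F] [NormedSpace ℝ F]
  [NormedAddCommGroup G] [NormedSpace ℝ G]

lemma bil_bound {μ : ℕ → ℝ} (hμ : LC μ) {A B β x y : ℝ} (hA : 0 ≤ A) (hB : 0 ≤ B)
    (hβ : 0 ≤ β) (hx : 0 ≤ x) (hy : 0 ≤ y) (p q n : ℕ)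
    (L : E →L[ℝ] F →L[ℝ] G) (hL : ‖L‖ ≤ 1) {f : D → E} {g : D → F} {s : Set D} (hs : IsOpen s)
    (hf : ContDiffOn ℝ (⊤ : ℕ∞) f s) (hg : ContDiffOn ℝ (⊤ : ℕ∞) g s) {u : D} (hu : u ∈ s)
    (ha : ∀ i ≤ n, ‖iteratedFDerivWithin ℝ i f s u‖ ≤ A * β ^ i * PP i x * μ (i + p))
    (hb : ∀ i ≤ n, ‖iteratedFDerivWithin ℝ i g s u‖ ≤ B * β ^ i * PP i y * μ (i + q)) :
    ‖iteratedFDerivWithin ℝ n (fun v => L (f v) (g v)) s u‖ ≤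
      A * B * β ^ n * PP n (x + y) * (μ 0 * μ (n + (p + q))) := by
  refine (L.norm_iteratedFDerivWithin_le_of_bilinear_of_le_one hf hg hs.uniqueDiffOn hu
    (n := n) (by exact_mod_cast le_top) hL).trans ?_
  exact conv_bound hμ hA hB hβ hx hy p q n _ _ (fun _ => norm_nonneg _) ha hb

lemma bil_contDiffOn (L : E →L[ℝ] F →L[ℝ] G) {f : D → E} {g : D → F} {s : Set D}
    (hf : ContDiffOn ℝ (⊤ : ℕ∞) f s) (hg : ContDiffOn ℝ (⊤ : ℕ∞) g s) :
    ContDiffOn ℝ (⊤ : ℕ∞) (fun v => L (f v) (g v)) s :=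
  (L.contDiff.comp_contDiffOn hf).clm_apply hg

end general

lemma comp_bound {μ : ℕ → ℝ} (hμ : LC μ) {κ b β : ℝ} (hκ : 0 ≤ κ) (hb : 0 ≤ b)
    (hβ : κ * b * μ 0 ≤ β)
    {X : Type} [NormedAddCommGroup X] [NormedSpace ℝ X]
    {ψ : X → X} {Φ : X → X →L[ℝ] X} {s Ω : Set X} (hs : IsOpen s) (hΩ : IsOpen Ω)
    (hmap : MapsTo ψ s Ω) (hψ : ContDiffOn ℝ (⊤ : ℕ∞) ψ s) (hΦ : ContDiffOn ℝ (⊤ : ℕ∞) Φ Ω)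
    (hψ' : ∀ y ∈ s, HasFDerivAt ψ (Φ (ψ y)) y)
    (hΦb : ∀ k, ∀ γ ∈ Ω, ‖iteratedFDerivWithin ℝ k Φ Ω γ‖ ≤ κ * b ^ k * k.factorial * μ k)
    (n : ℕ) : ∀ (F : Type) [NormedAddCommGroup F] [NormedSpace ℝ F] (Θ : X → F) (j : ℕ),
      ContDiffOn ℝ (⊤ : ℕ∞) Θ Ω →
      (∀ k, ∀ γ ∈ Ω, ‖iteratedFDerivWithin ℝ k Θ Ω γ‖ ≤
        κ * b ^ (j + k) * (j + k).factorial * μ (j + k)) →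
      ∀ y ∈ s, ‖iteratedFDerivWithin ℝ n (Θ ∘ ψ) s y‖ ≤
        κ * b ^ j * j.factorial * β ^ n * PP n (j + 1) * μ (n + j) := by
  have hμ0 := hμ.pos 0
  have hβ0 : 0 ≤ β := le_trans (by positivity) hβ
  induction n using Nat.strong_induction_on with
  | _ n ih =>
    intro F _ _ Θ j hΘ hΘb y hy
    cases n with
    | zero =>
      have := hΘb 0 (ψ y) (hmap hy)
      simpa [PP] using this
    | succ n =>
      rw [← norm_iteratedFDerivWithin_fderivWithin hs.uniqueDiffOn hy]
      have hEq : EqOn (fderivWithin ℝ (Θ ∘ ψ) s)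
          (fun v => ContinuousLinearMap.compL ℝ X X F ((fderivWithin ℝ Θ Ω ∘ ψ) v) ((Φ ∘ ψ) v)) s := by
        intro v hv
        have h1 : HasFDerivAt Θ (fderivWithin ℝ Θ Ω (ψ v)) (ψ v) := by
          have h2 := (hΘ.differentiableOn (by simp)).differentiableAt (hΩ.mem_nhds (hmap hv))
          rw [fderivWithin_of_isOpen hΩ (hmap hv)]
          exact h2.hasFDerivAt
        exact ((h1.comp v (hψ' v hv)).hasFDerivWithinAt).fderivWithin (hs.uniqueDiffOn v hv)
      rw [iteratedFDerivWithin_congr hEq hy]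
      have hΘ' : ContDiffOn ℝ (⊤ : ℕ∞) (fderivWithin ℝ Θ Ω) Ω :=
        hΘ.fderivWithin hΩ.uniqueDiffOn (by simp)
      have key := bil_bound hμ (A := κ * b ^ (j+1) * (j+1).factorial) (B := κ) (β := β)
        (x := (j + 1 : ℕ) + 1) (y := (0 : ℕ) + 1) (by positivity) hκ hβ0 (by positivity) (by positivity) (j+1) 0 n
        (ContinuousLinearMap.compL ℝ X X F) (ContinuousLinearMap.norm_compL_le ℝ X X F) hs
        (hΘ'.comp hψ hmap) (hΦ.comp hψ hmap) hy
        (fun i hi => ih i (by omega) _ (fderivWithin ℝ Θ Ω) (j+1) hΘ' (fun k γ hγ => by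
          rw [norm_iteratedFDerivWithin_fderivWithin hΩ.uniqueDiffOn hγ]
          have := hΘb (k+1) γ hγ
          rwa [show j + (k+1) = j + 1 + k by ring] at this) y hy)
        (fun i hi => by
          have := ih i (by omega) _ Φ 0 hΦ (fun k γ hγ => by simpa using hΦb k γ hγ) y hy
          simpa using this)
      refine key.trans ?_
      have e1 : ((j + 1 : ℕ) : ℝ) + 1 + ((0 : ℕ) + 1) = (j : ℝ) + 1 + 2 := by push_cast; ring
      rw [e1, PP, show n + (j + 1 + 0) = n + 1 + j by ring, Nat.factorial_succ]
      have hP := PP_nonneg n ((j : ℝ) + 1 + 2) (by positivity)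
      have hm := (hμ.pos (n + 1 + j)).le
      calc _ = (κ * b * μ 0) * (κ * b ^ j * j.factorial * β ^ n * ((j+1) * PP n (j+1+2)) * μ (n+1+j)) := by
            push_cast; ring
        _ ≤ β * (κ * b ^ j * j.factorial * β ^ n * ((j+1) * PP n (j+1+2)) * μ (n+1+j)) := by
            gcongr
        _ = _ := by ring

set_option maxHeartbeats 1000000 in
lemma inv_bound {μ : ℕ → ℝ} (hμ : LC μ) {κ lam β : ℝ} (hκ : 0 ≤ κ) (hl : 0 ≤ lam)
    (hβ0 : 0 ≤ β) (hβ : κ * lam * (μ 0) ^ 2 ≤ β)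
    {X : Type} [NormedAddCommGroup X] [NormedSpace ℝ X]
    {R : Type} [NormedRing R] [NormedAlgebra ℝ R] [CompleteSpace R]
    {A : X → R} {Ω : Set X} (hΩ : IsOpen Ω)
    (hA : ContDiffOn ℝ (⊤ : ℕ∞) A Ω) (hu : ∀ γ ∈ Ω, IsUnit (A γ))
    (hAb : ∀ k, ∀ γ ∈ Ω, ‖iteratedFDerivWithin ℝ (k + 1) A Ω γ‖ ≤
      lam * β ^ k * PP k 1 * μ (k + 1))
    (h0 : ∀ γ ∈ Ω, ‖Ring.inverse (A γ)‖ ≤ κ * μ 0) :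
    ContDiffOn ℝ (⊤ : ℕ∞) (fun γ => Ring.inverse (A γ)) Ω ∧
    ∀ n, ∀ γ ∈ Ω, ‖iteratedFDerivWithin ℝ n (fun γ => Ring.inverse (A γ)) Ω γ‖ ≤
      κ * β ^ n * PP n 1 * μ n := by
  have hsm : ContDiffOn ℝ (⊤ : ℕ∞) (fun γ => Ring.inverse (A γ)) Ω := by
    intro γ hγ
    obtain ⟨v, hv⟩ := hu γ hγ
    have := contDiffAt_ringInverse (n := (⊤ : ℕ∞)) ℝ v
    rw [hv] at this
    exact this.comp_contDiffWithinAt γ (hA γ hγ)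
  refine ⟨hsm, ?_⟩
  intro n
  induction n using Nat.strong_induction_on with
  | _ n ih =>
    intro y hy
    cases n with
    | zero => simpa [PP] using h0 y hy
    | succ n =>
      rw [← norm_iteratedFDerivWithin_fderivWithin hΩ.uniqueDiffOn hy]
      set Φ := (fun γ => Ring.inverse (A γ)) with hΦ
      let T := ContinuousLinearMap.mulLeftRight ℝ R
      let L2 := ContinuousLinearMap.compL ℝ X R R
      have hEq : EqOn (fderivWithin ℝ Φ Ω)
          (-(fun v => L2 ((fun w => T (Φ w) (Φ w)) v) ((fderivWithin ℝ A Ω) v))) Ω := by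
        intro γ hγ
        have h1 : HasFDerivAt A (fderivWithin ℝ A Ω γ) γ := by
          have h2 := (hA.differentiableOn (by simp)).differentiableAt (hΩ.mem_nhds hγ)
          rw [fderivWithin_of_isOpen hΩ hγ]
          exact h2.hasFDerivAt
        obtain ⟨v, hv⟩ := hu γ hγ
        have h2 := hasFDerivAt_ringInverse (𝕜 := ℝ) v
        have h3 : (↑v⁻¹ : R) = Φ γ := by rw [hΦ]; simp [← hv]
        rw [hv, h3] at h2
        have h4 := ((h2.comp γ h1).hasFDerivWithinAt (s := Ω)).fderivWithin (hΩ.uniqueDiffOn γ hγ)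
        rw [show Φ = Ring.inverse ∘ A from rfl, h4]
        rw [ContinuousLinearMap.neg_comp]
        rfl
      rw [iteratedFDerivWithin_congr hEq hy, iteratedFDerivWithin_neg_apply hΩ.uniqueDiffOn hy,
        norm_neg]
      have hA' : ContDiffOn ℝ (⊤ : ℕ∞) (fderivWithin ℝ A Ω) Ω :=
        hA.fderivWithin hΩ.uniqueDiffOn (by simp)
      have hTs : ContDiffOn ℝ (⊤ : ℕ∞) (fun w => T (Φ w) (Φ w)) Ω :=
        bil_contDiffOn T hsm hsm
      have hT := ContinuousLinearMap.opNorm_mulLeftRight_le ℝ R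
      have hμ0 := (hμ.pos 0).le
      have k1 : ∀ i ≤ n, ‖iteratedFDerivWithin ℝ i (fun w => T (Φ w) (Φ w)) Ω y‖ ≤
          (κ * κ * μ 0) * β ^ i * PP i 2 * μ (i + 0) := by
        intro i hi
        have := bil_bound hμ hκ hκ hβ0 zero_le_one zero_le_one 0 0 i T hT hΩ hsm hsm hy
          (fun k hk => ih k (by omega) y hy) (fun k hk => ih k (by omega) y hy)
        refine this.trans (le_of_eq ?_)
        rw [show (1:ℝ) + 1 = 2 by norm_num]
        simp only [add_zero]; ring
      have k2 := bil_bound hμ (by positivity) hl hβ0 zero_le_two zero_le_one 0 1 n L2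
        (ContinuousLinearMap.norm_compL_le _ _ _ _) hΩ hTs hA' hy k1
        (fun i hi => by
          rw [norm_iteratedFDerivWithin_fderivWithin hΩ.uniqueDiffOn hy]
          exact hAb i y hy)
      refine k2.trans ?_
      have hP := PP_nonneg n 3 (by positivity)
      have hm := (hμ.pos (n + 1)).le
      rw [PP, show (1:ℝ) + 2 = 3 by norm_num, show (2:ℝ) + 1 = 3 by norm_num,
        show n + (0 + 1) = n + 1 by ring]
      calc _ = (κ * lam * μ 0 ^ 2) * (κ * β ^ n * PP n 3 * μ (n+1)) := by ring
        _ ≤ β * (κ * β ^ n * PP n 3 * μ (n+1)) := by gcongr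
        _ = _ := by ring

lemma aux_poly (k : ℕ) : ((k : ℝ) + 1) * (k + 2) ≤ 2 * 4 ^ k := by
  induction k with
  | zero => norm_num
  | succ k ih =>
    push_cast
    rw [pow_succ]
    have : (0:ℝ) ≤ k := by positivity
    nlinarith

theorem carl_inverse {μ : ℕ → ℝ} (hμ : LC μ) {X : Type} [NormedAddCommGroup X] [NormedSpace ℝ X]
    [CompleteSpace X] {G : X → X} (hG : ContDiff ℝ (⊤ : ℕ∞) G) {γ₀ : X} {r C : ℝ} (hr : 0 < r)
    (hC : 0 < C)
    (hb : ∀ n, ∀ γ ∈ Metric.ball γ₀ r,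
      ‖iteratedFDeriv ℝ (n + 1) G γ‖ ≤ C ^ (n + 1) * ((n + 1).factorial * μ n))
    (hu : IsUnit (fderiv ℝ G γ₀)) :
    ∃ (ψ : X → X) (s : Set X), IsOpen s ∧ G γ₀ ∈ s ∧ ContDiffOn ℝ (⊤ : ℕ∞) ψ s ∧
      (∀ y ∈ s, G (ψ y) = y) ∧ ∃ K : ℝ, 0 < K ∧ ∀ n, ∀ y ∈ s,
        ‖iteratedFDerivWithin ℝ (n + 1) ψ s y‖ ≤ K ^ (n + 1) * ((n + 1).factorial * μ n) := by
  have hμ0 := hμ.pos 0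
  set A := fderiv ℝ G with hA
  have hAs : ContDiff ℝ (⊤ : ℕ∞) A := hG.fderiv_right (by simp)
  obtain ⟨v, hv⟩ := hu
  -- the open set
  have hunit : ∀ᶠ γ in 𝓝 γ₀, IsUnit (A γ) :=
    hAs.continuous.continuousAt.eventually (by rw [← hv]; exact Units.isOpen.mem_nhds v.isUnit)
  have hcont : ContinuousAt (fun γ => ‖Ring.inverse (A γ)‖) γ₀ := by
    have h1 : ContinuousAt Ring.inverse (A γ₀) := by
      rw [← hv]; exact NormedRing.inverse_continuousAt v
    exact (h1.comp hAs.continuous.continuousAt).norm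
  set κ₀ := ‖Ring.inverse (A γ₀)‖ + 1 with hκ₀
  have hinv : ∀ᶠ γ in 𝓝 γ₀, ‖Ring.inverse (A γ)‖ < κ₀ :=
    hcont.eventually (gt_mem_nhds (by rw [hκ₀]; linarith))
  obtain ⟨Ω, hΩsub, hΩ, hγΩ⟩ := mem_nhds_iff.mp
    (hunit.and (hinv.and (Metric.ball_mem_nhds γ₀ hr)))
  set κ := κ₀ / μ 0 with hκ
  have hκ₀pos : 0 < κ₀ := by positivity
  have hκpos : 0 < κ := by positivity
  set lam := 2 * C ^ 2 with hlam
  set β := max (4 * C) (κ * lam * (μ 0) ^ 2) with hβ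
  have hβ4 : 4 * C ≤ β := le_max_left _ _
  have hβ0 : 0 < β := lt_of_lt_of_le (by positivity) hβ4
  have hAb : ∀ k, ∀ γ ∈ Ω, ‖iteratedFDerivWithin ℝ (k + 1) A Ω γ‖ ≤
      lam * β ^ k * PP k 1 * μ (k + 1) := by
    intro k γ hγ
    rw [iteratedFDerivWithin_of_isOpen (k+1) hΩ hγ, hA, norm_iteratedFDeriv_fderiv]
    refine (hb (k+1) γ (hΩsub hγ).2.2).trans ?_
    have hmp := (hμ.pos (k+1)).le
    have h1 := PP_ge k
    have h2 := aux_poly k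
    calc C ^ (k + 1 + 1) * ((k + 1 + 1).factorial * μ (k + 1))
        = C ^ 2 * C ^ k * (((k : ℝ) + 1) * (k + 2)) * k.factorial * μ (k + 1) := by
          rw [Nat.factorial_succ, Nat.factorial_succ]; push_cast; ring
      _ ≤ C ^ 2 * C ^ k * (2 * 4 ^ k) * PP k 1 * μ (k + 1) := by gcongr
      _ = lam * (4 * C) ^ k * PP k 1 * μ (k + 1) := by rw [hlam, mul_pow]; ring
      _ ≤ _ := by
        have := PP_nonneg k 1 zero_le_one
        gcongr
  obtain ⟨hΦs, hΦb⟩ := inv_bound hμ hκpos.le (by positivity) hβ0.le (le_max_right _ _) hΩ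
    hAs.contDiffOn (fun γ hγ => (hΩsub hγ).1) hAb
    (fun γ hγ => by
      rw [hκ, div_mul_cancel₀ _ hμ0.ne']
      exact (hΩsub hγ).2.1.le)
  -- the local inverse
  have hG0 : HasFDerivAt G ((ContinuousLinearEquiv.unitsEquiv ℝ X v : X ≃L[ℝ] X) : X →L[ℝ] X) γ₀ := by
    have : ((ContinuousLinearEquiv.unitsEquiv ℝ X v : X ≃L[ℝ] X) : X →L[ℝ] X) = fderiv ℝ G γ₀ := by
      rw [← hA, ← hv]; rfl
    rw [this]
    exact (hG.differentiable (by simp)).differentiableAt.hasFDerivAt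
  set e := (hG.contDiffAt (x := γ₀)).toOpenPartialHomeomorph G hG0 (by simp) with he
  have heG : ∀ x, e x = G x := fun x => rfl
  set s := e.target ∩ e.symm ⁻¹' Ω with hs
  have hsO : IsOpen s := e.symm.isOpen_inter_preimage hΩ
  have hγs : γ₀ ∈ e.source := ContDiffAt.mem_toOpenPartialHomeomorph_source _ hG0 (by simp)
  have hmem : G γ₀ ∈ s := by
    refine ⟨e.map_source hγs, ?_⟩
    show e.symm (e γ₀) ∈ Ω
    rw [e.left_inv hγs]; exact hγΩ
  have hloc : ∀ y ∈ s, ContDiffAt ℝ (⊤ : ℕ∞) e.symm y ∧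
      HasFDerivAt e.symm (Ring.inverse (A (e.symm y))) y := by
    intro y hy
    obtain ⟨w, hw⟩ := (hΩsub hy.2).1
    have h1 : ((ContinuousLinearEquiv.unitsEquiv ℝ X w : X ≃L[ℝ] X) : X →L[ℝ] X)
        = fderiv ℝ G (e.symm y) := by
      rw [← hA]; exact hw
    have h2 : HasFDerivAt e ((ContinuousLinearEquiv.unitsEquiv ℝ X w : X ≃L[ℝ] X) : X →L[ℝ] X)
        (e.symm y) := by
      rw [h1]
      exact (hG.differentiable (by simp)).differentiableAt.hasFDerivAt
    refine ⟨e.contDiffAt_symm hy.1 h2 hG.contDiffAt, ?_⟩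
    have h3 := e.hasFDerivAt_symm hy.1 h2
    have h4 : Ring.inverse (A (e.symm y)) =
      ((ContinuousLinearEquiv.unitsEquiv ℝ X w : X ≃L[ℝ] X).symm : X →L[ℝ] X) := by
      rw [← hw, Ring.inverse_unit]; rfl
    rw [h4]; exact h3
  have hψs : ContDiffOn ℝ (⊤ : ℕ∞) e.symm s := fun y hy => (hloc y hy).1.contDiffWithinAt
  refine ⟨e.symm, s, hsO, hmem, hψs, fun y hy => e.right_inv hy.1, ?_⟩
  set b := 2 * β with hbdef
  set β₂ := κ * b * μ 0 with hβ₂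
  have hβ₂pos : 0 < β₂ := by positivity
  have hΦb' : ∀ k, ∀ γ ∈ Ω, ‖iteratedFDerivWithin ℝ k (fun γ => Ring.inverse (A γ)) Ω γ‖ ≤
      κ * b ^ k * k.factorial * μ k := by
    intro k γ hγ
    refine (hΦb k γ hγ).trans ?_
    have h1 := PP_le k
    have hmp := (hμ.pos k).le
    calc κ * β ^ k * PP k 1 * μ k ≤ κ * β ^ k * (2 ^ k * k.factorial) * μ k := by gcongr
      _ = _ := by rw [hbdef, mul_pow]; ring
  have hfin := fun n => comp_bound hμ hκpos.le (b := b) (by positivity) le_rfl hsO hΩ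
    (ψ := e.symm) (fun y hy => hy.2) hψs hΦs (fun y hy => (hloc y hy).2) hΦb' n _
    (fun γ => Ring.inverse (A γ)) 0 hΦs (fun k γ hγ => by simpa using hΦb' k γ hγ)
  set K := max κ (2 * β₂) with hK
  have hKpos : 0 < K := lt_of_lt_of_le hκpos (le_max_left _ _)
  refine ⟨K, hKpos, fun n y hy => ?_⟩
  rw [← norm_iteratedFDerivWithin_fderivWithin hsO.uniqueDiffOn hy]
  have hEq : EqOn (fderivWithin ℝ e.symm s) ((fun γ => Ring.inverse (A γ)) ∘ e.symm) s :=
    fun y hy => (hloc y hy).2.hasFDerivWithinAt.fderivWithin (hsO.uniqueDiffOn y hy)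
  rw [iteratedFDerivWithin_congr hEq hy]
  refine (hfin n y hy).trans ?_
  have h1 := PP_le n
  have hmp := (hμ.pos n).le
  simp only [pow_zero, Nat.factorial_zero, Nat.cast_one, mul_one, Nat.cast_zero, zero_add, add_zero]
  calc κ * β₂ ^ n * PP n 1 * μ n ≤ κ * β₂ ^ n * (2 ^ n * n.factorial) * μ n := by gcongr
    _ = κ * (2 * β₂) ^ n * (n.factorial * μ n) := by rw [mul_pow 2 β₂]; ring
    _ ≤ K * K ^ n * ((n+1).factorial * μ n) := by
      gcongr
      · exact le_max_left _ _
      · exact le_max_right _ _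
      · omega
    _ = _ := by rw [pow_succ]; ring

section nemytskii
variable {K : Type} [TopologicalSpace K] [CompactSpace K]
variable {E : Type} [NormedAddCommGroup E] [NormedSpace ℝ E]

def nem {F : Type} [NormedAddCommGroup F] (g : C(E, F)) : C(K, E) → C(K, F) := fun γ => g.comp γ

def TT (K E F : Type) [TopologicalSpace K] [CompactSpace K] [NormedAddCommGroup E] [NormedSpace ℝ E]
    [NormedAddCommGroup F] [NormedSpace ℝ F] :
    C(K, E →L[ℝ] F) →L[ℝ] C(K, E) →L[ℝ] C(K, F) :=
  LinearMap.mkContinuous₂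
    (LinearMap.mk₂ ℝ (fun (A : C(K, E →L[ℝ] F)) (γ : C(K, E)) =>
      (⟨fun t => A t (γ t), by fun_prop⟩ : C(K, F)))
      (fun _ _ _ => by ext; simp) (fun _ _ _ => by ext; simp) (fun _ _ _ => by ext; simp)
      (fun _ _ _ => by ext; simp))
    1
    (fun A γ => by
      rw [one_mul, ContinuousMap.norm_le _ (by positivity)]
      intro t
      refine ((A t).le_opNorm (γ t)).trans ?_
      gcongr
      · exact A.norm_coe_le_norm t
      · exact γ.norm_coe_le_norm t)

variable {F : Type} [NormedAddCommGroup F] [NormedSpace ℝ F]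

lemma TT_apply (A : C(K, E →L[ℝ] F)) (γ : C(K, E)) (t : K) : TT K E F A γ t = A t (γ t) := rfl

set_option maxSynthPendingDepth 5 in
lemma TT_norm : ‖TT K E F‖ ≤ 1 := LinearMap.mkContinuous₂_norm_le _ zero_le_one _

lemma nem_hasFDerivAt [ProperSpace E] (g : C(E, F)) (hg : ContDiff ℝ (⊤ : ℕ∞) g)
    (g' : C(E, E →L[ℝ] F)) (hg' : ∀ x, g' x = fderiv ℝ g x) (γ : C(K, E)) :
    HasFDerivAt (nem (K := K) g) (TT K E F (nem g' γ)) γ := by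
  rw [hasFDerivAt_iff_isLittleO_nhds_zero, Asymptotics.isLittleO_iff]
  intro ε hε
  have hc : IsCompact (Metric.closedBall (0 : E) (‖γ‖ + 1)) := isCompact_closedBall _ _
  have hu := hc.uniformContinuousOn_of_continuous g'.continuous.continuousOn
  rw [Metric.uniformContinuousOn_iff] at hu
  obtain ⟨δ, hδ, hd⟩ := hu ε hε
  filter_upwards [Metric.ball_mem_nhds (0 : C(K, E)) (lt_min hδ one_pos)] with h hh
  rw [mem_ball_zero_iff, lt_min_iff] at hh
  rw [ContinuousMap.norm_le _ (by positivity)]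
  intro t
  show ‖g (γ t + h t) - g (γ t) - g' (γ t) (h t)‖ ≤ _
  have ht := h.norm_coe_le_norm t
  have hγt := γ.norm_coe_le_norm t
  have hin : ∀ x ∈ Metric.closedBall (γ t) ‖h‖, x ∈ Metric.closedBall (0 : E) (‖γ‖ + 1) := by
    intro x hx
    rw [mem_closedBall_iff_norm] at hx
    rw [mem_closedBall_zero_iff]
    have := norm_sub_norm_le x (γ t)
    linarith
  have := (convex_closedBall (γ t) ‖h‖).norm_image_sub_le_of_norm_fderiv_le' (𝕜 := ℝ) (f := g)
    (φ := g' (γ t)) (C := ε) (x := γ t) (y := γ t + h t)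
    (fun x _ => (hg.differentiable (by simp)).differentiableAt)
    (fun x hx => by
      rw [← hg', ← dist_eq_norm]
      refine (hd x (hin x hx) (γ t) (hin _ (Metric.mem_closedBall_self (norm_nonneg _))) ?_).le
      exact lt_of_le_of_lt hx hh.1)
    (Metric.mem_closedBall_self (norm_nonneg _))
    (by simpa [mem_closedBall_iff_norm] using ht)
  simp only [add_sub_cancel_left] at this
  exact this.trans (by gcongr)

lemma nem_fderiv [ProperSpace E] (g : C(E, F)) (hg : ContDiff ℝ (⊤ : ℕ∞) g) :
    ∃ g' : C(E, E →L[ℝ] F), ContDiff ℝ (⊤ : ℕ∞) g' ∧ (∀ x, g' x = fderiv ℝ g x) ∧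
      fderiv ℝ (nem (K := K) g) = TT K E F ∘ nem g' := by
  have h1 : ContDiff ℝ (⊤ : ℕ∞) (fderiv ℝ g) := hg.fderiv_right (by simp)
  refine ⟨⟨fderiv ℝ g, h1.continuous⟩, h1, fun _ => rfl, ?_⟩
  funext γ
  exact (nem_hasFDerivAt g hg _ (fun _ => rfl) γ).fderiv

lemma nem_contDiff_nat [ProperSpace E] (n : ℕ) : ∀ (F : Type) [NormedAddCommGroup F] [NormedSpace ℝ F]
    (g : C(E, F)), ContDiff ℝ (⊤ : ℕ∞) g → ContDiff ℝ n (nem (K := K) g) := by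
  induction n with
  | zero =>
    intro F _ _ g hg
    refine contDiff_zero.2 ?_
    exact ContinuousMap.continuous_postcomp g
  | succ n ih =>
    intro F _ _ g hg
    obtain ⟨g', h1, h2, h3⟩ := nem_fderiv (K := K) g hg
    push_cast
    rw [contDiff_succ_iff_fderiv]
    refine ⟨fun γ => (nem_hasFDerivAt g hg g' h2 γ).differentiableAt, by simp, ?_⟩
    rw [h3]
    exact (TT K E F).contDiff.comp (ih _ g' h1)

lemma nem_contDiff [ProperSpace E] (g : C(E, F)) (hg : ContDiff ℝ (⊤ : ℕ∞) g) :
    ContDiff ℝ (⊤ : ℕ∞) (nem (K := K) g) :=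
  contDiff_infty.2 fun n => nem_contDiff_nat n F g hg

lemma nem_bound [ProperSpace E] (n : ℕ) : ∀ (F : Type) [NormedAddCommGroup F] [NormedSpace ℝ F]
    (g : C(E, F)), ContDiff ℝ (⊤ : ℕ∞) g → ∀ (γ : C(K, E)) (B : ℝ), 0 ≤ B →
    (∀ t, ‖iteratedFDeriv ℝ n g (γ t)‖ ≤ B) → ‖iteratedFDeriv ℝ n (nem (K := K) g) γ‖ ≤ B := by
  induction n with
  | zero =>
    intro F _ _ g hg γ B hB h
    rw [norm_iteratedFDeriv_zero, ContinuousMap.norm_le _ hB]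
    intro t
    have := h t
    rwa [norm_iteratedFDeriv_zero] at this
  | succ n ih =>
    intro F _ _ g hg γ B hB h
    obtain ⟨g', h1, h2, h3⟩ := nem_fderiv (K := K) g hg
    rw [← norm_iteratedFDeriv_fderiv, h3]
    have h4 := (TT K E F).norm_iteratedFDeriv_comp_left (n := n)
      (nem_contDiff (K := K) g' h1).contDiffAt (x := γ) (by exact_mod_cast le_top)
    refine h4.trans ?_
    have h5 := ih _ g' h1 γ B hB (fun t => by
      have := h t
      rw [← norm_iteratedFDeriv_fderiv] at this
      rwa [show (g' : E → E →L[ℝ] F) = fderiv ℝ g from funext h2])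
    calc _ ≤ 1 * B := mul_le_mul TT_norm h5 (norm_nonneg _) zero_le_one
      _ = B := one_mul B

end nemytskii

section volterra
variable {E : Type} [NormedAddCommGroup E] [NormedSpace ℝ E] [CompleteSpace E]

/-- extension of a curve on the unit interval to the line -/
def extc (γ : C(unitInterval, E)) : ℝ → E := fun s => γ (Set.projIcc 0 1 zero_le_one s)

lemma ext_cont (γ : C(unitInterval, E)) : Continuous (extc γ) :=
  γ.continuous.comp continuous_projIcc

lemma ext_int (γ : C(unitInterval, E)) (a b : ℝ) : IntervalIntegrable (extc γ) volume a b :=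
  (ext_cont γ).intervalIntegrable a b

lemma ext_of_mem (γ : C(unitInterval, E)) {s : ℝ} (hs : s ∈ unitInterval) : extc γ s = γ ⟨s, hs⟩ := by
  unfold extc
  rw [Set.projIcc_of_mem zero_le_one hs]

def VV (E : Type) [NormedAddCommGroup E] [NormedSpace ℝ E] [CompleteSpace E] :
    C(unitInterval, E) →L[ℝ] C(unitInterval, E) :=
  LinearMap.mkContinuous
    { toFun := fun γ => ⟨fun t => ∫ s in (0:ℝ)..t, extc γ s,
        (intervalIntegral.continuous_primitive (ext_int γ) 0).comp continuous_subtype_val⟩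
      map_add' := fun γ η => by
        ext t
        exact intervalIntegral.integral_add (ext_int γ _ _) (ext_int η _ _)
      map_smul' := fun c γ => by
        ext t
        exact intervalIntegral.integral_smul c (extc γ) }
    1
    (fun γ => by
      rw [one_mul, ContinuousMap.norm_le _ (norm_nonneg _)]
      intro t
      have h := intervalIntegral.norm_integral_le_of_norm_le_const (a := (0:ℝ)) (b := t)
        (f := extc γ) (C := ‖γ‖) (fun s _ => γ.norm_coe_le_norm _)
      refine h.trans ?_
      rw [sub_zero, abs_of_nonneg t.2.1]
      exact mul_le_of_le_one_right (norm_nonneg _) t.2.2)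

lemma VV_apply (γ : C(unitInterval, E)) (t : unitInterval) :
    VV E γ t = ∫ s in (0:ℝ)..t, extc γ s := rfl

lemma VV_norm : ‖VV E‖ ≤ 1 := LinearMap.mkContinuous_norm_le _ zero_le_one _

lemma VT_pow_bound (A : C(unitInterval, E →L[ℝ] E)) (n : ℕ) (h : C(unitInterval, E)) :
    ∀ t : unitInterval, ‖(((VV E).comp (TT unitInterval E E A)) ^ n) h t‖ ≤
      ‖A‖ ^ n * (t : ℝ) ^ n / n.factorial * ‖h‖ := by
  induction n with
  | zero => intro t; simpa using h.norm_coe_le_norm t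
  | succ n ih =>
    intro t
    rw [pow_succ']
    set w := (((VV E).comp (TT unitInterval E E A)) ^ n) h with hw
    show ‖VV E (TT unitInterval E E A w) t‖ ≤ _
    rw [VV_apply]
    have h1 : ‖∫ s in (0:ℝ)..t, extc (TT unitInterval E E A w) s‖ ≤
        ∫ s in (0:ℝ)..t, ‖A‖ * (‖A‖ ^ n / n.factorial * ‖h‖) * s ^ n := by
      refine intervalIntegral.norm_integral_le_of_norm_le t.2.1 ?_
        (by apply Continuous.intervalIntegrable; fun_prop)
      refine Filter.Eventually.of_forall fun s hs => ?_
      have hsI : s ∈ unitInterval := ⟨hs.1.le, hs.2.trans t.2.2⟩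
      rw [ext_of_mem _ hsI, TT_apply]
      refine ((A _).le_opNorm _).trans ?_
      have h2 := ih ⟨s, hsI⟩
      calc _ ≤ ‖A‖ * (‖A‖ ^ n * s ^ n / n.factorial * ‖h‖) := by
            gcongr
            exact A.norm_coe_le_norm _
        _ = _ := by ring
    refine h1.trans (le_of_eq ?_)
    rw [intervalIntegral.integral_const_mul, integral_pow, Nat.factorial_succ]
    have : ((n : ℝ) + 1) ≠ 0 := by positivity
    have : (n.factorial : ℝ) ≠ 0 := by positivity
    push_cast
    field_simp
    rw [zero_pow (by omega)]
    ring

lemma unit_of_pow {X : Type} [NormedAddCommGroup X] [NormedSpace ℝ X] [CompleteSpace X]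
    {B : X →L[ℝ] X} (n : ℕ) (hnorm : ‖B ^ n‖ < 1) : IsUnit (1 - B) := by
  have hu : IsUnit (1 - B ^ n) := isUnit_one_sub_of_norm_lt_one hnorm
  have hg : (1 - B) * (∑ i ∈ Finset.range n, B ^ i) = 1 - B ^ n := mul_neg_geom_sum B n
  have hcomm : Commute (1 - B) (∑ i ∈ Finset.range n, B ^ i) := by
    show _ = _
    rw [hg, geom_sum_mul_neg]
  rw [← hg] at hu
  exact (hcomm.isUnit_mul_iff.1 hu).1

lemma VT_unit (A : C(unitInterval, E →L[ℝ] E)) :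
    IsUnit (1 - (VV E).comp (TT unitInterval E E A)) := by
  set B := (VV E).comp (TT unitInterval E E A) with hB
  have hlim := FloorSemiring.tendsto_pow_div_factorial_atTop ‖A‖
  obtain ⟨n, hn⟩ := (hlim.eventually (gt_mem_nhds (zero_lt_one))).exists
  have hnorm : ‖B ^ n‖ < 1 := by
    refine lt_of_le_of_lt ?_ hn
    refine ContinuousLinearMap.opNorm_le_bound _ (by positivity) fun h => ?_
    rw [ContinuousMap.norm_le _ (by positivity)]
    intro t
    refine (VT_pow_bound A n h t).trans ?_
    have : (t : ℝ) ^ n ≤ 1 := pow_le_one₀ t.2.1 t.2.2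
    gcongr
    exact mul_le_of_le_one_right (by positivity) this
  exact unit_of_pow n hnorm

end volterra

structure Mon (m : ℕ → ℝ) : Prop where
  pos : ∀ n, 1 ≤ n → 0 < m n
  mono : ∀ j k, 1 ≤ j → j ≤ k → m j ≤ m k

lemma absorb {B C : ℝ} (hB : 0 ≤ B) (hC : 0 ≤ C) {n : ℕ} (hn : 1 ≤ n) :
    B * C ^ n ≤ ((B + 1) * C) ^ n := by
  rw [mul_pow]
  gcongr
  calc B ≤ B + 1 := by linarith
    _ ≤ (B + 1) ^ n := le_self_pow₀ (by linarith) (by omega)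

section cb
variable {E F G : Type} [NormedAddCommGroup E] [NormedSpace ℝ E] [NormedAddCommGroup F]
  [NormedSpace ℝ F] [NormedAddCommGroup G] [NormedSpace ℝ G] {m : ℕ → ℝ}

def CBOn (m : ℕ → ℝ) (s : Set E) (u : E → F) : Prop :=
  ∃ C : ℝ, 0 < C ∧ ∀ n : ℕ, 1 ≤ n → ∀ x ∈ s, ‖iteratedFDeriv ℝ n u x‖ ≤ C ^ n * m n

lemma CBOn.of_const (hm : Mon m) {s : Set E} {u : E → F} {B C : ℝ} (hB : 0 ≤ B) (hC : 0 < C)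
    (h : ∀ n : ℕ, 1 ≤ n → ∀ x ∈ s, ‖iteratedFDeriv ℝ n u x‖ ≤ B * C ^ n * m n) : CBOn m s u :=
  ⟨(B + 1) * C, by positivity, fun n hn x hx => (h n hn x hx).trans
    (mul_le_mul_of_nonneg_right (absorb hB hC.le hn) (hm.pos n hn).le)⟩

lemma CBOn.add (hm : Mon m) {s : Set E} {u v : E → F} (hus : ContDiff ℝ (⊤ : ℕ∞) u)
    (hvs : ContDiff ℝ (⊤ : ℕ∞) v) (hu : CBOn m s u) (hv : CBOn m s v) :
    CBOn m s (fun x => u x + v x) := by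
  obtain ⟨C, hC, hu⟩ := hu
  obtain ⟨C', hC', hv⟩ := hv
  refine CBOn.of_const hm (B := 2) (C := max C C') zero_le_two (lt_max_of_lt_left hC) ?_
  intro n hn x hx
  have e : iteratedFDeriv ℝ n (fun x => u x + v x) x =
      iteratedFDeriv ℝ n u x + iteratedFDeriv ℝ n v x :=
    iteratedFDeriv_add_apply (hus.contDiffAt.of_le (by exact_mod_cast le_top))
      (hvs.contDiffAt.of_le (by exact_mod_cast le_top))
  rw [e]
  have hp := (hm.pos n hn).le
  have h1 : C ^ n * m n ≤ (max C C') ^ n * m n := by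
    gcongr; exact le_max_left _ _
  have h2 : C' ^ n * m n ≤ (max C C') ^ n * m n := by
    gcongr; exact le_max_right _ _
  have := norm_add_le (iteratedFDeriv ℝ n u x) (iteratedFDeriv ℝ n v x)
  have := hu n hn x hx
  have := hv n hn x hx
  linarith

lemma clm_iter (L : E →L[ℝ] F) (n : ℕ) (hn : 1 ≤ n) (x : E) : ‖iteratedFDeriv ℝ n L x‖ ≤ ‖L‖ := by
  obtain ⟨k, rfl⟩ := Nat.exists_eq_add_of_le' hn
  rw [← norm_iteratedFDeriv_fderiv]
  have : fderiv ℝ L = fun _ => L := by funext y; exact L.fderiv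
  rw [this]
  cases k with
  | zero => rw [norm_iteratedFDeriv_zero]
  | succ k =>
    rw [iteratedFDeriv_succ_const]
    simp

lemma CBOn.clm (hm : Mon m) (s : Set E) (L : E →L[ℝ] F) : CBOn m s L := by
  have h1 := hm.pos 1 le_rfl
  refine CBOn.of_const hm (B := ‖L‖ / m 1) (C := 1) (by positivity) one_pos ?_
  intro n hn x _
  refine (clm_iter L n hn x).trans ?_
  rw [one_pow, mul_one, div_mul_eq_mul_div, le_div_iff₀ h1]
  exact mul_le_mul_of_nonneg_left (hm.mono 1 n le_rfl hn) (norm_nonneg _)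

lemma CBOn.clm_left (hm : Mon m) {s : Set E} {u : E → F} (hus : ContDiff ℝ (⊤ : ℕ∞) u)
    (hu : CBOn m s u) (L : F →L[ℝ] G) : CBOn m s (fun x => L (u x)) := by
  obtain ⟨C, hC, hu⟩ := hu
  refine CBOn.of_const hm (B := ‖L‖) (C := C) (norm_nonneg _) hC ?_
  intro n hn x hx
  have h := L.norm_iteratedFDeriv_comp_left (n := n) (hus.contDiffAt (x := x)) (by exact_mod_cast le_top)
  refine h.trans ?_
  rw [mul_assoc]
  exact mul_le_mul_of_nonneg_left (hu n hn x hx) (norm_nonneg _)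

lemma CBOn.clm_right (hm : Mon m) {s : Set F} {u : F → G} (hus : ContDiff ℝ (⊤ : ℕ∞) u)
    (hu : CBOn m s u) (L : E →L[ℝ] F) : CBOn m (L ⁻¹' s) (fun x => u (L x)) := by
  obtain ⟨C, hC, hu⟩ := hu
  refine ⟨C * (‖L‖ + 1), by positivity, ?_⟩
  intro n hn x hx
  have e : iteratedFDeriv ℝ n (u ∘ L) x = _ :=
    L.iteratedFDeriv_comp_right hus x (i := n) (by exact_mod_cast le_top)
  show ‖iteratedFDeriv ℝ n (u ∘ L) x‖ ≤ _
  rw [e]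
  refine (ContinuousMultilinearMap.norm_compContinuousLinearMap_le _ _).trans ?_
  rw [Finset.prod_const, Finset.card_univ, Fintype.card_fin]
  have hp := (hm.pos n hn).le
  calc _ ≤ (C ^ n * m n) * (‖L‖ + 1) ^ n := by
        gcongr
        · exact hu n hn _ hx
        · linarith
    _ = _ := by rw [mul_pow]; ring

lemma CBOn.sum (hm : Mon m) {s : Set E} {ι : Type} (S : Finset ι) {u : ι → E → F}
    (hus : ∀ i, ContDiff ℝ (⊤ : ℕ∞) (u i))
    (hu : ∀ i, CBOn m s (u i)) : CBOn m s (fun x => ∑ i ∈ S, u i x) := by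
  classical
  induction S using Finset.induction_on with
  | empty => 
    simp only [Finset.sum_empty]
    exact CBOn.clm hm s (0 : E →L[ℝ] F)
  | insert i S hi ih =>
    simp only [Finset.sum_insert hi]
    exact CBOn.add hm (hus i) (ContDiff.sum fun j _ => hus j) (hu i) ih

lemma CBOn.linmul (hm : Mon m) {s : Set E} (ℓ : E →L[ℝ] ℝ) {v : E → ℝ}
    (hvs : ContDiff ℝ (⊤ : ℕ∞) v) (hv : CBOn m s v) {R : ℝ} (hR : 0 ≤ R) (hℓ : ∀ x ∈ s, |ℓ x| ≤ R)
    (hvb : ∀ x ∈ s, |v x| ≤ R) : CBOn m s (fun x => ℓ x * v x) := by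
  obtain ⟨C, hC, hv⟩ := hv
  have h1 := hm.pos 1 le_rfl
  set C₁ := max C 1 with hC₁
  have hC₁1 : 1 ≤ C₁ := le_max_right _ _
  set B := R / m 1 + 1 with hB
  have hB1 : 1 ≤ B := by rw [hB]; have : 0 ≤ R / m 1 := by positivity
                         linarith
  have hB0 : 0 ≤ B := by linarith
  refine CBOn.of_const hm (B := (R + ‖ℓ‖) * B) (C := 2 * C₁) (by positivity) (by positivity) ?_
  intro n hn x hx
  have hp := (hm.pos n hn).le
  have hL : ∀ i, ‖iteratedFDeriv ℝ i ℓ x‖ ≤ R + ‖ℓ‖ := by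
    intro i
    rcases Nat.eq_zero_or_pos i with rfl | hi
    · rw [norm_iteratedFDeriv_zero]
      have := hℓ x hx
      have := norm_nonneg ℓ
      rw [Real.norm_eq_abs]; linarith
    · have := clm_iter ℓ i hi x
      linarith
  have hV : ∀ j ≤ n, ‖iteratedFDeriv ℝ j v x‖ ≤ B * C₁ ^ n * m n := by
    intro j hj
    rcases Nat.eq_zero_or_pos j with rfl | hj0
    · rw [norm_iteratedFDeriv_zero, Real.norm_eq_abs]
      have h2 : R ≤ B * m 1 := by
        rw [hB, add_mul, div_mul_cancel₀ _ h1.ne']; linarith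
      calc |v x| ≤ B * m 1 := (hvb x hx).trans h2
        _ ≤ B * 1 * m n := by
          rw [mul_one]; gcongr; exact hm.mono 1 n le_rfl hn
        _ ≤ B * C₁ ^ n * m n := by
          gcongr; exact one_le_pow₀ hC₁1
    · have hp' := (hm.pos j hj0).le
      calc _ ≤ C ^ j * m j := hv j hj0 x hx
        _ ≤ C₁ ^ j * m j := by gcongr; exact le_max_left _ _
        _ ≤ C₁ ^ n * m n := by
          gcongr
          exact hm.mono j n hj0 hj
        _ = 1 * C₁ ^ n * m n := by ring
        _ ≤ _ := by gcongr
  refine (norm_iteratedFDeriv_mul_le (ℓ.contDiff (n := (⊤ : ℕ∞))) hvs x (n := n) (by exact_mod_cast le_top)).trans ?_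
  calc _ ≤ ∑ i ∈ Finset.range (n + 1), (n.choose i : ℝ) * (R + ‖ℓ‖) * (B * C₁ ^ n * m n) := by
        refine Finset.sum_le_sum fun i hi => ?_
        gcongr
        · exact hL i
        · exact hV _ (by omega)
    _ = (∑ i ∈ Finset.range (n + 1), (n.choose i : ℝ)) * ((R + ‖ℓ‖) * (B * C₁ ^ n * m n)) := by
        rw [Finset.sum_mul]
        refine Finset.sum_congr rfl fun i _ => by ring
    _ = 2 ^ n * ((R + ‖ℓ‖) * (B * C₁ ^ n * m n)) := by
        have e : (∑ i ∈ Finset.range (n + 1), (n.choose i : ℝ)) = 2 ^ n := by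
          exact_mod_cast Nat.sum_range_choose n
        rw [e]
    _ = _ := by rw [mul_pow]; ring

end cb

lemma Mon.of_regular {m : ℕ → ℝ} (hm : RegularSeq m) : Mon m := by
  obtain ⟨h1, h2, -⟩ := hm
  refine ⟨h1, fun j k hj hjk => ?_⟩
  induction k, hjk using Nat.le_induction with
  | base => exact le_rfl
  | succ k hk ih => exact ih.trans (h2 k (by omega))

lemma LC.of_regular {m : ℕ → ℝ} (hm : RegularSeq m) :
    LC (fun n => m (n + 1) / (n + 1).factorial) := by
  obtain ⟨h1, -, -, -, h5⟩ := hm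
  set μ : ℕ → ℝ := (fun n => m (n + 1) / (n + 1).factorial) with hμ
  have hpos : ∀ n, 0 < μ n := fun n => div_pos (h1 _ (by omega)) (by positivity)
  have hsq : ∀ n, μ (n + 1) * μ (n + 1) ≤ μ n * μ (n + 2) := by
    intro n
    have h : Real.log (μ (n + 1)) ≤ (Real.log (μ n) + Real.log (μ (n + 2))) / 2 :=
      h5 (n + 1) (by omega)
    rw [← Real.log_le_log_iff (mul_pos (hpos _) (hpos _)) (mul_pos (hpos _) (hpos _)),
      Real.log_mul (hpos _).ne' (hpos _).ne', Real.log_mul (hpos _).ne' (hpos _).ne']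
    linarith
  -- ratios are nondecreasing
  have hr : Monotone (fun n => μ (n + 1) / μ n) := by
    refine monotone_nat_of_le_succ fun n => ?_
    rw [div_le_div_iff₀ (hpos _) (hpos _)]
    have := hsq n
    show μ (n + 1) * μ (n + 1) ≤ μ (n + 2) * μ n
    linarith
  refine ⟨hpos, fun p q => ?_⟩
  induction q with
  | zero => simp [mul_comm]
  | succ q ih =>
    have h := hr (show q ≤ p + q by omega)
    have hq := hpos q
    have hpq := hpos (p + q)
    calc μ p * μ (q + 1) = (μ p * μ q) * (μ (q + 1) / μ q) := by field_simp
      _ ≤ (μ 0 * μ (p + q)) * (μ (p + q + 1) / μ (p + q)) := by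
        have := (hpos 0).le
        have := (hpos (q+1)).le
        exact mul_le_mul ih h (by positivity) (by positivity)
      _ = μ 0 * μ (p + (q + 1)) := by
        rw [show p + (q + 1) = p + q + 1 by ring]; field_simp

section flow
variable {E : Type} [NormedAddCommGroup E] [NormedSpace ℝ E]

def constC (E : Type) [NormedAddCommGroup E] [NormedSpace ℝ E] : E →L[ℝ] C(unitInterval, E) :=
  LinearMap.mkContinuous
    { toFun := fun x => ContinuousMap.const _ x
      map_add' := fun _ _ => rfl
      map_smul' := fun _ _ => rfl }
    1
    (fun x => by
      rw [one_mul, ContinuousMap.norm_le _ (norm_nonneg _)]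
      intro t
      exact le_rfl)

lemma constC_apply (x : E) (t : unitInterval) : constC E x t = x := rfl

variable [CompleteSpace E]

lemma int_unique [ProperSpace E] (g : C(E, E)) (hg : ContDiff ℝ (⊤ : ℕ∞) g) (p : E)
    (γ η : C(unitInterval, E)) (hγ : γ = constC E p + VV E (nem g γ))
    (hη : η = constC E p + VV E (nem g η)) : γ = η := by
  set R := max ‖γ‖ ‖η‖ with hR
  obtain ⟨K, hK⟩ : ∃ K, LipschitzOnWith K g (Metric.closedBall 0 R) :=
    ContDiffOn.exists_lipschitzOnWith (n := ((⊤ : ℕ∞) : WithTop ℕ∞)) hg.contDiffOn (by simp)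
      (convex_closedBall 0 R) (isCompact_closedBall 0 R)
  have key : ∀ ζ : C(unitInterval, E), ζ = constC E p + VV E (nem g ζ) → ‖ζ‖ ≤ R →
      ∃ x : ℝ → E, ContinuousOn x (Set.Icc 0 1) ∧
        (∀ t ∈ Set.Ico (0:ℝ) 1, HasDerivWithinAt x (g (x t)) (Set.Ici t) t) ∧
        (∀ t ∈ Set.Ico (0:ℝ) 1, x t ∈ Metric.closedBall (0 : E) R) ∧ x 0 = p ∧
        ∀ t : unitInterval, x t = ζ t := by
    intro ζ hζ hn
    have he : ∀ t : unitInterval, p + ∫ s in (0:ℝ)..t, extc (nem g ζ) s = ζ t := by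
      intro t
      conv_rhs => rw [hζ]
      rfl
    have hd : ∀ t : ℝ, HasDerivAt (fun τ : ℝ => p + ∫ s in (0:ℝ)..τ, extc (nem g ζ) s)
        (extc (nem g ζ) t) t := by
      intro t
      refine HasDerivAt.const_add p ?_
      exact intervalIntegral.integral_hasDerivAt_right (ext_int _ _ _)
        ((ext_cont _).stronglyMeasurableAtFilter _ _) (ext_cont _).continuousAt
    refine ⟨_, fun t _ => (hd t).continuousAt.continuousWithinAt, ?_, ?_, by simp, he⟩
    · intro t ht
      have ht' : t ∈ unitInterval := ⟨ht.1, ht.2.le⟩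
      have h1 := he ⟨t, ht'⟩
      simp only at h1
      simp only [h1]
      have h2 := (hd t).hasDerivWithinAt (s := Set.Ici t)
      rw [ext_of_mem _ ht'] at h2
      exact h2
    · intro t ht
      have ht' : t ∈ unitInterval := ⟨ht.1, ht.2.le⟩
      have h1 := he ⟨t, ht'⟩
      simp only at h1
      simp only [h1, mem_closedBall_zero_iff]
      exact (ζ.norm_coe_le_norm _).trans hn
  obtain ⟨x, hx1, hx2, hx3, hx4, hx5⟩ := key γ hγ (le_max_left _ _)
  obtain ⟨y, hy1, hy2, hy3, hy4, hy5⟩ := key η hη (le_max_right _ _)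
  have := ODE_solution_unique_of_mem_Icc_right (v := fun _ => g) (K := K)
    (s := fun _ => Metric.closedBall 0 R) (a := 0) (b := 1) (fun _ _ => hK) hx1 hx2 hx3 hy1 hy2 hy3
    (hx4.trans hy4.symm)
  ext t
  rw [← hx5, ← hy5]
  exact this t.2

lemma flow_local [ProperSpace E] {m : ℕ → ℝ} (hm : RegularSeq m) (g : C(E, E))
    (hg : ContDiff ℝ (⊤ : ℕ∞) g) (hb : ∀ R, 0 < R → CBOn m (Metric.ball (0 : E) R) g)
    (p : E) (γ : C(unitInterval, E)) (hγ : γ = constC E p + VV E (nem g γ)) :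
    ∃ (ψ : C(unitInterval, E) → C(unitInterval, E)) (s : Set C(unitInterval, E)),
      IsOpen s ∧ constC E p ∈ s ∧ ContDiffOn ℝ (⊤ : ℕ∞) ψ s ∧
      (∀ y ∈ s, ψ y = y + VV E (nem g (ψ y))) ∧
      ∃ K : ℝ, 0 < K ∧ ∀ n, 1 ≤ n → ∀ y ∈ s, ‖iteratedFDerivWithin ℝ n ψ s y‖ ≤ K ^ n * m n := by
  have hM := Mon.of_regular hm
  have hs := nem_contDiff (K := unitInterval) g hg
  set G : C(unitInterval, E) → C(unitInterval, E) :=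
    fun γ => ContinuousLinearMap.id ℝ _ γ + (-VV E) (nem g γ) with hGd
  have hG : ContDiff ℝ (⊤ : ℕ∞) G := (ContinuousLinearMap.id ℝ _).contDiff.add
    ((-VV E).contDiff.comp hs)
  have hnb : CBOn m (Metric.ball γ 1) (nem (K := unitInterval) g) := by
    obtain ⟨C, hC, h⟩ := hb (‖γ‖ + 1) (by positivity)
    refine ⟨C, hC, fun n hn x hx => ?_⟩
    refine nem_bound n E g hg x _ (mul_nonneg (pow_nonneg hC.le _) (hM.pos n hn).le) fun t => ?_
    refine h n hn _ ?_
    rw [mem_ball_zero_iff]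
    rw [mem_ball_iff_norm] at hx
    have := norm_sub_norm_le x γ
    have := x.norm_coe_le_norm t
    linarith
  obtain ⟨C, hC, hCb⟩ : CBOn m (Metric.ball γ 1) G :=
    CBOn.add hM (ContinuousLinearMap.id ℝ _).contDiff ((-VV E).contDiff.comp hs)
      (CBOn.clm hM _ _) (CBOn.clm_left hM hs hnb (-VV E))
  have hfac : ∀ n : ℕ, (((n + 1).factorial : ℕ) : ℝ) * (m (n + 1) / (n + 1).factorial) = m (n + 1) := by
    intro n
    have : (((n + 1).factorial : ℕ) : ℝ) ≠ 0 := by positivity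
    field_simp
  obtain ⟨g', h1, h2, h3⟩ := nem_fderiv (K := unitInterval) g hg
  have hu : IsUnit (fderiv ℝ G γ) := by
    have h4 : HasFDerivAt G (ContinuousLinearMap.id ℝ _ + (-VV E).comp (TT unitInterval E E (nem g' γ))) γ :=
      (ContinuousLinearMap.id ℝ _).hasFDerivAt.add
        ((-VV E).hasFDerivAt.comp γ (nem_hasFDerivAt g hg g' h2 γ))
    rw [h4.fderiv]
    have h5 := VT_unit (nem g' γ)
    convert h5 using 1
    rw [ContinuousLinearMap.neg_comp, ← sub_eq_add_neg]
    rfl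
  have hGγ : G γ = constC E p := by
    show γ + -(VV E (nem g γ)) = _
    rw [← sub_eq_add_neg, sub_eq_iff_eq_add]
    exact hγ
  obtain ⟨ψ, s, hs1, hs2, hs3, hs4, K, hK, hs5⟩ := carl_inverse (LC.of_regular hm) hG one_pos hC
    (γ₀ := γ) (fun n x hx => by rw [hfac]; exact hCb (n + 1) (by omega) x hx) hu
  refine ⟨ψ, s, hs1, hGγ ▸ hs2, hs3, ?_, K, hK, ?_⟩
  · intro y hy
    have : ψ y + -(VV E (nem g (ψ y))) = y := hs4 y hy
    rw [← sub_eq_add_neg, sub_eq_iff_eq_add] at this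
    exact this
  · intro n hn y hy
    obtain ⟨k, rfl⟩ := Nat.exists_eq_add_of_le' hn
    have := hs5 k y hy
    rwa [hfac] at this
end flow

section main
variable {N : ℕ}

/-- the extended phase space -/
abbrev PS (N : ℕ) : Type := ℝ × ℝ × (Fin N → ℝ)

def ell (N : ℕ) : PS N →L[ℝ] ℝ :=
  (ContinuousLinearMap.fst ℝ ℝ (Fin N → ℝ)).comp (ContinuousLinearMap.snd ℝ ℝ (ℝ × (Fin N → ℝ)))

def prj (N : ℕ) : PS N →L[ℝ] ℝ × (Fin N → ℝ) :=
  (ContinuousLinearMap.fst ℝ ℝ (ℝ × (Fin N → ℝ))).prod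
    ((ContinuousLinearMap.snd ℝ ℝ (Fin N → ℝ)).comp
      (ContinuousLinearMap.snd ℝ ℝ (ℝ × (Fin N → ℝ))))

def inj3 (i : Fin N) : ℝ →L[ℝ] PS N :=
  (ContinuousLinearMap.inr ℝ ℝ (ℝ × (Fin N → ℝ))).comp
    ((ContinuousLinearMap.inr ℝ ℝ (Fin N → ℝ)).comp
      (ContinuousLinearMap.single ℝ (fun _ : Fin N => ℝ) i))

def gf (f : ℝ × (Fin N → ℝ) → (Fin N → ℝ)) : PS N → PS N := fun q =>
  (ContinuousLinearMap.inl ℝ ℝ (ℝ × (Fin N → ℝ))).comp (ell N) q +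
    ∑ i, inj3 i (ell N q * f (prj N q) i)

lemma gf_apply (f : ℝ × (Fin N → ℝ) → (Fin N → ℝ)) (s h : ℝ) (y : Fin N → ℝ) :
    gf f (s, h, y) = (h, 0, h • f (s, y)) := by
  have e : ∀ i, inj3 i (ell N (s, h, y) * f (prj N (s, h, y)) i) =
      ((0 : ℝ), (0 : ℝ), (Pi.single i (h * f (s, y) i) : Fin N → ℝ)) := fun i => rfl
  have e0 : (ContinuousLinearMap.inl ℝ ℝ (ℝ × (Fin N → ℝ))).comp (ell N) (s, h, y) =
      (h, (0 : ℝ), (0 : Fin N → ℝ)) := rfl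
  unfold gf
  rw [e0]
  simp only [e]
  refine Prod.ext ?_ (Prod.ext ?_ ?_)
  · simp [Prod.fst_sum]
  · simp [Prod.fst_sum, Prod.snd_sum]
  · simp only [Prod.snd_add, Prod.snd_sum, zero_add]
    rw [Finset.univ_sum_single]
    rfl

lemma f_smooth {m : ℕ → ℝ} (u : ℝ × (Fin N → ℝ) → ℝ)
    (hf : ∀ D : Set (ℝ × (Fin N → ℝ)), IsOpen D → Bornology.IsBounded D → CarlemanClass m D u) :
    ContDiff ℝ (⊤ : ℕ∞) u ∧ ∀ R, CBOn m (Metric.ball 0 R) u := by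
  constructor
  · rw [contDiff_iff_contDiffAt]
    intro x
    have h := (hf (Metric.ball x 1) Metric.isOpen_ball Metric.isBounded_ball).1
    exact h.contDiffAt (Metric.ball_mem_nhds x one_pos)
  · intro R
    obtain ⟨-, C, hC, h⟩ := hf (Metric.ball 0 R) Metric.isOpen_ball Metric.isBounded_ball
    refine ⟨C, hC, fun n hn x hx => ?_⟩
    rw [← iteratedFDerivWithin_of_isOpen n Metric.isOpen_ball hx]
    exact h n hn x hx

lemma gf_smooth {m : ℕ → ℝ} (hm : RegularSeq m) (f : ℝ × (Fin N → ℝ) → (Fin N → ℝ))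
    (hf : ∀ i : Fin N, ∀ D : Set (ℝ × (Fin N → ℝ)), IsOpen D → Bornology.IsBounded D →
      CarlemanClass m D (fun q => f q i)) :
    ContDiff ℝ (⊤ : ℕ∞) (gf f) ∧ ∀ R, 0 < R → CBOn m (Metric.ball (0 : PS N) R) (gf f) := by
  have hM := Mon.of_regular hm
  have hfs : ∀ i, ContDiff ℝ (⊤ : ℕ∞) (fun q => f (prj N q) i) := fun i =>
    (f_smooth _ (hf i)).1.comp (prj N).contDiff
  have hls : ∀ i, ContDiff ℝ (⊤ : ℕ∞) (fun q => ell N q * f (prj N q) i) := fun i =>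
    (ell N).contDiff.mul (hfs i)
  have hjs : ∀ i, ContDiff ℝ (⊤ : ℕ∞) (fun q => inj3 i (ell N q * f (prj N q) i)) := fun i =>
    (inj3 i).contDiff.comp (hls i)
  refine ⟨((ContinuousLinearMap.inl ℝ ℝ (ℝ × (Fin N → ℝ))).comp (ell N)).contDiff.add
    (ContDiff.sum fun i _ => hjs i), ?_⟩
  intro R hR
  refine CBOn.add hM ((ContinuousLinearMap.inl ℝ ℝ (ℝ × (Fin N → ℝ))).comp (ell N)).contDiff
    (ContDiff.sum fun i _ => hjs i) (CBOn.clm hM _ _) ?_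
  refine CBOn.sum hM _ hjs fun i => ?_
  refine CBOn.clm_left hM (hls i) ?_ (inj3 i)
  have hc : IsCompact (Metric.closedBall (0 : PS N) R) := isCompact_closedBall 0 R
  obtain ⟨B1, hB1⟩ := hc.exists_bound_of_continuousOn (ell N).continuous.continuousOn
  obtain ⟨B2, hB2⟩ := hc.exists_bound_of_continuousOn (hfs i).continuous.continuousOn
  have h0 : (0 : PS N) ∈ Metric.closedBall (0 : PS N) R := Metric.mem_closedBall_self hR.le
  refine CBOn.linmul hM (ell N) (hfs i) (R := max B1 B2) ?_ ?_ ?_ ?_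
  · obtain ⟨C, hC, h⟩ := CBOn.clm_right hM (f_smooth _ (hf i)).1
      ((f_smooth _ (hf i)).2 ((‖prj N‖ + 1) * R)) (prj N)
    refine ⟨C, hC, fun n hn x hx => h n hn x ?_⟩
    rw [mem_ball_zero_iff] at hx
    rw [Set.mem_preimage, mem_ball_zero_iff]
    refine ((prj N).le_opNorm x).trans_lt ?_
    have := norm_nonneg (prj N)
    have := norm_nonneg x
    nlinarith
  · exact (norm_nonneg _).trans ((hB1 0 h0).trans (le_max_left _ _))
  · exact fun x hx => (hB1 x (Metric.ball_subset_closedBall hx)).trans (le_max_left _ _)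
  · exact fun x hx => (hB2 x (Metric.ball_subset_closedBall hx)).trans (le_max_right _ _)

lemma curve_exists (g : C(PS N, PS N)) (f : ℝ × (Fin N → ℝ) → (Fin N → ℝ))
    (hgf : ∀ s h y, g (s, h, y) = (h, 0, h • f (s, y))) {a : ℝ} (w : ℝ → Fin N → ℝ)
    (x : Fin N → ℝ) (h0 : w 0 = x) (hw : ∀ t ∈ Set.Ioo (-a) a, HasDerivAt w (f (t, w t)) t)
    (t : ℝ) (ht : t ∈ Set.Ioo (-a) a) :
    ∃ γ : C(unitInterval, PS N), γ = constC (PS N) (0, t, x) + VV (PS N) (nem g γ) ∧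
      (γ 1).2.2 = w t := by
  have hin : ∀ σ ∈ unitInterval, σ * t ∈ Set.Ioo (-a) a := by
    intro σ hσ
    rw [Set.mem_Ioo, ← abs_lt] at ht ⊢
    rw [abs_mul, abs_of_nonneg hσ.1]
    exact (mul_le_of_le_one_left (abs_nonneg _) hσ.2).trans_lt ht
  set Γ : ℝ → PS N := fun τ => (τ * t, t, w (τ * t)) with hΓ
  have hd : ∀ σ ∈ unitInterval, HasDerivAt Γ (g (Γ σ)) σ := by
    intro σ hσ
    rw [hΓ, hgf]
    have h1 : HasDerivAt (fun τ : ℝ => τ * t) t σ := by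
      simpa using (hasDerivAt_id σ).mul_const t
    exact h1.prodMk ((hasDerivAt_const σ t).prodMk
      ((hw _ (hin σ hσ)).scomp σ h1))
  let γ : C(unitInterval, PS N) := ⟨fun σ => Γ σ, by
    have : ContinuousOn Γ unitInterval := fun σ hσ => (hd σ hσ).continuousAt.continuousWithinAt
    exact continuousOn_iff_continuous_restrict.1 this⟩
  refine ⟨γ, ?_, ?_⟩
  · ext1 σ
    show Γ σ = (0, t, x) + ∫ s in (0:ℝ)..σ, extc (nem g γ) s
    have h := intervalIntegral.integral_eq_sub_of_hasDerivAt (a := 0) (b := (σ : ℝ)) (f := Γ)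
      (f' := extc (nem g γ)) (fun s hs => by
        rw [Set.uIcc_of_le σ.2.1] at hs
        have hs' : s ∈ unitInterval := ⟨hs.1, hs.2.trans σ.2.2⟩
        rw [ext_of_mem _ hs']
        exact hd s hs') (ext_int _ _ _)
    rw [h]
    have : Γ 0 = (0, t, x) := by simp [hΓ, h0]
    rw [this]; abel
  · show w (((1 : unitInterval) : ℝ) * t) = w t
    simp

lemma local_bound {m : ℕ → ℝ} (hm : RegularSeq m)
    (f : ℝ × (Fin N → ℝ) → (Fin N → ℝ))
    (hf : ∀ i : Fin N, ∀ D : Set (ℝ × (Fin N → ℝ)), IsOpen D → Bornology.IsBounded D →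
      CarlemanClass m D (fun q => f q i))
    (U : Set (Fin N → ℝ)) (hU : IsOpen U) (a : ℝ)
    (z : ℝ → (Fin N → ℝ) → (Fin N → ℝ))
    (hz0 : ∀ z₀ ∈ U, z 0 z₀ = z₀)
    (hzsol : ∀ z₀ ∈ U, ∀ t ∈ Set.Ioo (-a) a,
      HasDerivAt (fun s => z s z₀) (f (t, z t z₀)) t)
    (i : Fin N) (q₀ : ℝ × (Fin N → ℝ)) (hq₀ : q₀ ∈ Set.Ioo (-a) a ×ˢ U) :
    ∃ s : Set (ℝ × (Fin N → ℝ)), IsOpen s ∧ q₀ ∈ s ∧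
      (∀ q ∈ s, ContDiffAt ℝ (⊤ : ℕ∞) (fun q : ℝ × (Fin N → ℝ) => z q.1 q.2 i) q) ∧
      CBOn m s (fun q : ℝ × (Fin N → ℝ) => z q.1 q.2 i) := by
  have hM := Mon.of_regular hm
  obtain ⟨hg1, hg2⟩ := gf_smooth hm f hf
  let g : C(PS N, PS N) := ⟨gf f, hg1.continuous⟩
  have hgf : ∀ s h y, g (s, h, y) = (h, 0, h • f (s, y)) := gf_apply f
  have hcur : ∀ q ∈ Set.Ioo (-a) a ×ˢ U, ∃ γ : C(unitInterval, PS N),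
      γ = constC (PS N) (0, q) + VV (PS N) (nem g γ) ∧ (γ 1).2.2 = z q.1 q.2 := by
    intro q hq
    exact curve_exists g f hgf (fun s => z s q.2) q.2 (hz0 _ hq.2) (hzsol _ hq.2) q.1 hq.1
  obtain ⟨γ₀, hγ₀, -⟩ := hcur q₀ hq₀
  obtain ⟨ψ, s, hs, hps, hψs, hψ, K, hK, hKb⟩ := flow_local hm g hg1 hg2 (0, q₀) γ₀ hγ₀
  let L2 : ℝ × (Fin N → ℝ) →L[ℝ] C(unitInterval, PS N) :=
    (constC (PS N)).comp (ContinuousLinearMap.inr ℝ ℝ (ℝ × (Fin N → ℝ)))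
  let L1 : C(unitInterval, PS N) →L[ℝ] ℝ :=
    (ContinuousLinearMap.proj (R := ℝ) (φ := fun _ : Fin N => ℝ) i).comp
      ((ContinuousLinearMap.snd ℝ ℝ (Fin N → ℝ)).comp
        ((ContinuousLinearMap.snd ℝ ℝ (ℝ × (Fin N → ℝ))).comp
          (ContinuousMap.evalCLM ℝ (1 : unitInterval))))
  have hso : IsOpen (L2 ⁻¹' s) := hs.preimage L2.continuous
  have hO : IsOpen (L2 ⁻¹' s ∩ Set.Ioo (-a) a ×ˢ U) := hso.inter (isOpen_Ioo.prod hU)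
  have heq : ∀ q ∈ L2 ⁻¹' s ∩ Set.Ioo (-a) a ×ˢ U, z q.1 q.2 i = L1 (ψ (L2 q)) := by
    intro q hq
    obtain ⟨γ, hγ, hγ1⟩ := hcur q hq.2
    have h1 : ψ (L2 q) = constC (PS N) (0, q) + VV (PS N) (nem g (ψ (L2 q))) := hψ _ hq.1
    have h2 := int_unique g hg1 (0, q) _ _ hγ h1
    rw [← h2, ← hγ1]
    rfl
  have hev : ∀ q ∈ L2 ⁻¹' s ∩ Set.Ioo (-a) a ×ˢ U,
      (fun q : ℝ × (Fin N → ℝ) => z q.1 q.2 i) =ᶠ[𝓝 q] L1 ∘ (ψ ∘ L2) := by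
    intro q hq
    filter_upwards [hO.mem_nhds hq] with q' hq' using heq q' hq'
  have hcd : ∀ q ∈ L2 ⁻¹' s, ContDiffAt ℝ (⊤ : ℕ∞) (ψ ∘ L2) q := fun q hq =>
    (hψs.contDiffAt (hs.mem_nhds hq)).comp q L2.contDiff.contDiffAt
  refine ⟨_, hO, ⟨hps, hq₀⟩, ?_, ?_⟩
  · intro q hq
    exact (L1.contDiff.contDiffAt.comp q (hcd q hq.1)).congr_of_eventuallyEq (hev q hq)
  · refine CBOn.of_const hM (B := ‖L1‖) (C := K * (‖L2‖ + 1)) L1.opNorm_nonneg (mul_pos hK (add_pos_of_nonneg_of_pos L2.opNorm_nonneg one_pos)) ?_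
    intro n hn q hq
    rw [(Filter.EventuallyEq.iteratedFDeriv ℝ (hev q hq) n).eq_of_nhds]
    refine (L1.norm_iteratedFDeriv_comp_left (n := n) (hcd q hq.1) (by exact_mod_cast le_top)).trans ?_
    have e := L2.iteratedFDerivWithin_comp_right (i := n) hψs hs.uniqueDiffOn hso.uniqueDiffOn
      (x := q) hq.1 (by exact_mod_cast le_top)
    rw [← iteratedFDerivWithin_of_isOpen n hso hq.1, e]
    have hp := (hM.pos n hn).le
    have h3 := (ContinuousMultilinearMap.norm_compContinuousLinearMap_le
      (iteratedFDerivWithin ℝ n ψ s (L2 q)) (fun _ : Fin n => L2))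
    rw [Finset.prod_const, Finset.card_univ, Fintype.card_fin] at h3
    rw [mul_assoc]
    refine mul_le_mul_of_nonneg_left (h3.trans ?_) L1.opNorm_nonneg
    have hL2 := L2.opNorm_nonneg
    calc _ ≤ (K ^ n * m n) * (‖L2‖ + 1) ^ n := by
          gcongr
          · exact hKb n hn _ hq.1
          · linarith
      _ = _ := by rw [mul_pow]; ring
end main

/-- Carleman regularity of solutions of ODEs: if `f` is of Carleman class on every bounded
open set and the Cauchy problem `ż = f(t, z)`, `z(0) = z₀` has a `C¹` solution for every
`z₀ ∈ U`, then `(t, z₀) ↦ z(t; z₀)` is of Carleman class on every bounded open set with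
compact closure contained in `(−a, a) × U`. -/
theorem carleman_ode {N : ℕ} (m : ℕ → ℝ) (hm : RegularSeq m)
    (f : ℝ × (Fin N → ℝ) → (Fin N → ℝ))
    (hf : ∀ i : Fin N, ∀ D : Set (ℝ × (Fin N → ℝ)), IsOpen D → Bornology.IsBounded D →
      CarlemanClass m D (fun q => f q i))
    (U : Set (Fin N → ℝ)) (hU : IsOpen U) (a : ℝ) (ha : 0 < a)
    (z : ℝ → (Fin N → ℝ) → (Fin N → ℝ))
    (hz0 : ∀ z₀ ∈ U, z 0 z₀ = z₀)
    (hzsol : ∀ z₀ ∈ U, ∀ t ∈ Set.Ioo (-a) a,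
      HasDerivAt (fun s => z s z₀) (f (t, z t z₀)) t)
    (hzC1 : ∀ z₀ ∈ U, ContinuousOn (fun t => deriv (fun s => z s z₀) t) (Set.Ioo (-a) a)) :
    ∀ D : Set (ℝ × (Fin N → ℝ)), IsOpen D → IsCompact (closure D) →
      closure D ⊆ Set.Ioo (-a) a ×ˢ U →
      ∀ i : Fin N, CarlemanClass m D (fun q => z q.1 q.2 i) := by
  intro D hD hDc hDs i
  have hM := Mon.of_regular hm
  have hloc := fun q₀ (hq₀ : q₀ ∈ closure D) =>
    local_bound hm f hf U hU a z hz0 hzsol i q₀ (hDs hq₀)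
  choose! s hs1 hs2 hs3 hs4 using hloc
  choose! K hK hKb using hs4
  refine ⟨fun q hq => ((hs3 q (subset_closure hq)) q
    (hs2 q (subset_closure hq))).contDiffWithinAt, ?_⟩
  obtain ⟨T, hT1, hT2⟩ := hDc.elim_nhds_subcover s
    (fun q hq => (hs1 q hq).mem_nhds (hs2 q hq))
  refine ⟨1 + ∑ q ∈ T, K q, ?_, ?_⟩
  · have : 0 ≤ ∑ q ∈ T, K q := Finset.sum_nonneg fun q hq => (hK q (hT1 q hq)).le
    linarith
  · intro n hn x hx
    have hx' := hT2 (subset_closure hx)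
    simp only [Set.mem_iUnion] at hx'
    obtain ⟨q, hqT, hxq⟩ := hx'
    rw [iteratedFDerivWithin_of_isOpen n hD hx]
    refine (hKb q (hT1 q hqT) n hn x hxq).trans ?_
    have h1 : K q ≤ ∑ q ∈ T, K q :=
      Finset.single_le_sum (f := K) (fun q hq => (hK q (hT1 q hq)).le) hqT
    have hp := (hM.pos n hn).le
    have hk := (hK q (hT1 q hqT)).le
    gcongr
    linarith
end
end

section
/- Let (m_n) be a regular sequence. Then the class C(m_n) is quasianalytic if and only if the series Σ_{n=1}^∞ m_n^{−1/n} diverges. Precisely, the following are equivalent: (i) Σ_{n=1}^∞ m_n^{−1/n} = ∞; (ii) for every d ≥ 1, every connected open set D ⊆ ℝ^d, and every u ∈ C^∞(D) which belongs to C(m_n, D') for every bounded open D' with compact closure in D, if u and all partial derivatives of u vanish at some point of D then u is identically zero on D. -/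
open Real Set Filter MeasureTheory
open scoped BigOperators Topology

noncomputable section

theorem bang_step (F : ℕ → ℝ → ℝ) (M : ℕ → ℝ) (hM : ∀ n, 0 < M n)
    (hF : ∀ n, ∀ t ∈ Icc (0:ℝ) 1, HasDerivAt (F n) (F (n+1) t) t)
    (hb : ∀ n, ∀ t ∈ Icc (0:ℝ) 1, |F n t| ≤ M n)
    (N : ℕ) (hR : ∀ n ≤ N, M (n+1) ≤ M (N+1) / M N * M n)
    (s x : ℝ) (hs : 0 ≤ s) (hsx : s ≤ x) (hx : x ≤ 1)
    (hlen : x - s ≤ M N / (exp 1 * M (N+1)))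
    (hP : ∀ n, |F n s| ≤ exp ((n:ℝ) - (N+1)) * M n) :
    ∀ n, |F n x| ≤ exp ((n:ℝ) - N) * M n := by
  set R := M (N+1) / M N with hRdef
  have hRpos : 0 < R := div_pos (hM _) (hM _)
  have key : ∀ k, ∀ n, n + k = N + 1 → ∀ y ∈ Icc s x,
      |F n y| ≤ exp ((n:ℝ) - (N+1)) * M n * exp (exp 1 * R * (y - s)) := by
    intro k
    induction k with
    | zero =>
      intro n hn y hy
      have : n = N + 1 := by omega
      subst this
      have h1 := hb (N+1) y ⟨hs.trans hy.1, hy.2.trans hx⟩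
      have h2 : 1 ≤ exp (exp 1 * R * (y - s)) := by
        apply one_le_exp
        have : 0 ≤ y - s := by linarith [hy.1]
        positivity
      push_cast
      rw [sub_self, exp_zero, one_mul]
      nlinarith [hM (N+1)]
    | succ k ih =>
      intro n hn y hy
      have ih' := ih (n+1) (by omega)
      have hB : ∀ y, HasDerivAt (fun y => exp ((n:ℝ) - (N+1)) * M n * exp (exp 1 * R * (y - s)))
          (exp ((n:ℝ) - (N+1)) * M n * (exp (exp 1 * R * (y - s)) * (exp 1 * R))) y := by
        intro y
        have h0 : HasDerivAt (fun y => exp 1 * R * (y - s)) (exp 1 * R) y := by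
          simpa using ((hasDerivAt_id y).sub_const s).const_mul (exp 1 * R)
        exact (h0.exp).const_mul _
      have := image_norm_le_of_norm_deriv_right_le_deriv_boundary (f := F n) (f' := F (n+1))
        (a := s) (b := x)
        (fun t ht => (hF n t ⟨hs.trans ht.1, ht.2.trans hx⟩).continuousAt.continuousWithinAt)
        (fun t ht => (hF n t ⟨hs.trans ht.1, ht.2.le.trans hx⟩).hasDerivWithinAt)
        (B := fun y => exp ((n:ℝ) - (N+1)) * M n * exp (exp 1 * R * (y - s)))
        (B' := fun y => exp ((n:ℝ) - (N+1)) * M n * (exp (exp 1 * R * (y - s)) * (exp 1 * R)))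
        (by simpa using hP n) hB
        (by
          intro t ht
          have h1 := ih' t ⟨ht.1, ht.2.le⟩
          rw [Real.norm_eq_abs]
          refine h1.trans ?_
          have h2 := hR n (by omega)
          have h3 : exp (((n+1:ℕ):ℝ) - (N+1)) = exp ((n:ℝ) - (N+1)) * exp 1 := by
            rw [← exp_add]; congr 1; push_cast; ring
          rw [h3]
          calc exp ((n:ℝ) - (N+1)) * exp 1 * M (n+1) * exp (exp 1 * R * (t - s))
              ≤ exp ((n:ℝ) - (N+1)) * exp 1 * (R * M n) * exp (exp 1 * R * (t - s)) := by gcongr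
            _ = _ := by ring)
        hy
      simpa using this
  intro n
  rcases le_or_gt n (N+1) with h | h
  · have h1 := key (N+1-n) n (by omega) x ⟨hsx, le_rfl⟩
    refine h1.trans ?_
    have h2 : exp 1 * R * (x - s) ≤ 1 := by
      calc exp 1 * R * (x - s) ≤ exp 1 * R * (M N / (exp 1 * M (N+1))) := by gcongr
        _ = 1 := by
          rw [hRdef]
          have := hM N; have := hM (N+1); have := exp_pos 1
          field_simp
    have h3 : exp ((n:ℝ) - N) = exp ((n:ℝ) - (N+1)) * exp 1 := by
      rw [← exp_add]; congr 1; ring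
    rw [h3]
    calc _ ≤ exp ((n:ℝ) - (N+1)) * M n * exp 1 := by
          have := hM n
          gcongr
      _ = _ := by ring
  · refine (hb n x ⟨hs.trans hsx, hx⟩).trans ?_
    have : 1 ≤ exp ((n:ℝ) - N) := by
      apply one_le_exp
      have : ((N+1:ℕ):ℝ) < n := by exact_mod_cast h
      push_cast at this; linarith
    nlinarith [hM n]

theorem bang (F : ℕ → ℝ → ℝ) (M : ℕ → ℝ) (hM : ∀ n, 0 < M n)
    (hconv : ∀ n, M (n+1) / M n ≤ M (n+2) / M (n+1))
    (hdiv : ¬ Summable (fun n => M n / M (n+1)))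
    (hF : ∀ n, ∀ t ∈ Icc (0:ℝ) 1, HasDerivAt (F n) (F (n+1) t) t)
    (hb : ∀ n, ∀ t ∈ Icc (0:ℝ) 1, |F n t| ≤ M n)
    (h0 : ∀ n, F n 0 = 0) : F 0 1 = 0 := by
  have hmono : Monotone (fun n => M (n+1) / M n) := monotone_nat_of_le_succ hconv
  have key : ∀ k K : ℕ, ∀ x ∈ Icc (0:ℝ) 1,
      x ≤ (∑ j ∈ Finset.range k, M (K+j) / (exp 1 * M (K+j+1))) →
      ∀ n, |F n x| ≤ exp ((n:ℝ) - K) * M n := by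
    intro k
    induction k with
    | zero =>
      intro K x hx hle n
      have : x = 0 := le_antisymm (by simpa using hle) hx.1
      rw [this, h0, abs_zero]
      have := hM n
      positivity
    | succ k ih =>
      intro K x hx hle
      rw [Finset.sum_range_succ'] at hle
      set r := ∑ j ∈ Finset.range k, M (K+(j+1)) / (exp 1 * M (K+(j+1)+1)) with hr
      have hr0 : 0 ≤ r := Finset.sum_nonneg fun j _ => by
        have := hM (K+(j+1)); have := hM (K+(j+1)+1); positivity
      refine bang_step F M hM hF hb K ?_ (min x r) x (le_min hx.1 hr0) (min_le_left _ _) hx.2 ?_ ?_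
      · intro n hn
        have := hmono hn
        simp only at this
        rwa [div_le_iff₀ (hM n)] at this
      · have h1 : 0 ≤ M K / (exp 1 * M (K+1)) := by
          have := hM K; have := hM (K+1); positivity
        simp only [add_zero] at hle
        rcases min_cases x r with h | h <;> rw [h.1] <;> linarith
      · have := ih (K+1) (min x r) ⟨le_min hx.1 hr0, (min_le_left _ _).trans hx.2⟩ (by
          refine (min_le_right _ _).trans (le_of_eq ?_)
          rw [hr]
          refine Finset.sum_congr rfl fun j _ => ?_
          rw [show K + (j+1) = K + 1 + j by ring])
        intro n; simpa using this n
  have hall : ∀ K : ℕ, |F 0 1| ≤ exp (-(K:ℝ)) * M 0 := by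
    intro K
    have hnn : ∀ n, 0 ≤ M (K+n) / (exp 1 * M (K+n+1)) := fun n => by
      have := hM (K+n); have := hM (K+n+1); positivity
    have hd : ¬ Summable (fun n => M (K+n) / (exp 1 * M (K+n+1))) := by
      intro h
      apply hdiv
      rw [← summable_nat_add_iff K]
      have := h.mul_left (exp 1)
      refine this.congr fun n => ?_
      have := hM (K+n); have := hM (K+n+1); have := exp_pos 1
      rw [show n + K = K + n by ring]
      field_simp
    have ht := (not_summable_iff_tendsto_nat_atTop_of_nonneg hnn).1 hd
    obtain ⟨k, hk⟩ := (ht.eventually_ge_atTop 1).exists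
    simpa using key k K 1 ⟨zero_le_one, le_rfl⟩ hk 0
  have hlim : Tendsto (fun K : ℕ => exp (-(K:ℝ)) * M 0) atTop (𝓝 0) := by
    have : Tendsto (fun K : ℕ => exp (-(K:ℝ))) atTop (𝓝 0) :=
      tendsto_exp_neg_atTop_nhds_zero.comp tendsto_natCast_atTop_atTop
    simpa using this.mul_const (M 0)
  have := ge_of_tendsto' hlim hall
  exact abs_nonpos_iff.1 this

/-- Carleman inequality, qualitative form. -/
theorem carleman_summable (a : ℕ → ℝ) (ha : ∀ n, 0 < a n) (hs : Summable a) :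
    Summable (fun n : ℕ => (∏ j ∈ Finset.range (n+1), a j) ^ ((1:ℝ) / (n+1))) := by
  -- bound by e/(n+1)^2 * sum (j+1) a_j
  have hbound : ∀ n : ℕ, (∏ j ∈ Finset.range (n+1), a j) ^ ((1:ℝ) / (n+1)) ≤
      exp 1 * (∑ j ∈ Finset.range (n+1), (j+1) * a j) * (1/((n:ℝ)+1)^2) := by
    intro n
    have hn : (0:ℝ) < n + 1 := by positivity
    have h1 := Real.geom_mean_le_arith_mean_weighted (Finset.range (n+1))
      (fun _ => (1:ℝ)/(n+1)) (fun j => ((j:ℝ)+1) * a j) (fun _ _ => by positivity)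
      (by simp; field_simp) (fun j _ => by have := ha j; positivity)
    rw [Real.finsetProd_rpow _ _ (fun j _ => by have := ha j; positivity)] at h1
    rw [Finset.prod_mul_distrib, Real.mul_rpow (Finset.prod_nonneg fun _ _ => by positivity)
      (Finset.prod_nonneg fun j _ => (ha j).le)] at h1
    have h2 : (∏ j ∈ Finset.range (n+1), ((j:ℝ)+1)) = (Nat.factorial (n+1) : ℝ) := by
      rw [← Finset.prod_range_add_one_eq_factorial]; push_cast; rfl
    rw [h2, ← Finset.mul_sum] at h1
    set S := ∑ j ∈ Finset.range (n+1), ((j:ℝ)+1) * a j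
    set Q := (∏ j ∈ Finset.range (n+1), a j) ^ ((1:ℝ) / (n+1))
    have h3 : ((n:ℝ)+1) / exp 1 ≤ ((Nat.factorial (n+1) : ℝ)) ^ ((1:ℝ)/(n+1)) := by
      have h4 : (((n:ℝ)+1) / exp 1)^(n+1) ≤ (Nat.factorial (n+1) : ℝ) := by
        have h5 := Real.pow_div_factorial_le_exp ((n:ℝ)+1) hn.le (n+1)
        rw [div_pow, div_le_iff₀ (by positivity), ← exp_nat_mul, mul_one]
        rw [div_le_iff₀ (by positivity)] at h5
        push_cast; linarith
      have h6 := Real.rpow_le_rpow (by positivity) h4 (z := (1:ℝ)/(n+1)) (by positivity)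
      rw [← Real.rpow_natCast, ← Real.rpow_mul (by positivity)] at h6
      have h7 : ((n+1:ℕ):ℝ) * (1/((n:ℝ)+1)) = 1 := by push_cast; field_simp
      rwa [h7, Real.rpow_one] at h6
    have hQ : 0 ≤ Q := Real.rpow_nonneg (Finset.prod_nonneg fun j _ => (ha j).le) _
    have h8 : ((n:ℝ)+1) / exp 1 * Q ≤ 1/((n:ℝ)+1) * S := (mul_le_mul_of_nonneg_right h3 hQ).trans h1
    have he := exp_pos 1
    calc Q = exp 1 / (n+1) * (((n:ℝ)+1) / exp 1 * Q) := by field_simp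
      _ ≤ exp 1 / (n+1) * (1/((n:ℝ)+1) * S) := by gcongr
      _ = _ := by field_simp
  refine Summable.of_nonneg_of_le (fun n => Real.rpow_nonneg (Finset.prod_nonneg fun j _ => (ha j).le) _) hbound ?_
  have hnn : ∀ n : ℕ, 0 ≤ exp 1 * (∑ j ∈ Finset.range (n+1), ((j:ℝ)+1) * a j) * (1/((n:ℝ)+1)^2) := by
    intro n
    have : 0 ≤ ∑ j ∈ Finset.range (n+1), ((j:ℝ)+1) * a j :=
      Finset.sum_nonneg fun j _ => by have := ha j; positivity
    positivity
  -- invariant: partial sums ≤ 2 e (Σ_{j<N} a_j - (1/(N+1))...) 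
  have hinv : ∀ N : ℕ, ∑ n ∈ Finset.range N,
      (exp 1 * (∑ j ∈ Finset.range (n+1), ((j:ℝ)+1) * a j) * (1/((n:ℝ)+1)^2))
      ≤ 2 * exp 1 * (∑ j ∈ Finset.range N, a j
        - 1/((N:ℝ)+1) * ∑ j ∈ Finset.range N, ((j:ℝ)+1) * a j) := by
    intro N
    induction N with
    | zero => simp
    | succ N ih =>
      rw [Finset.sum_range_succ]
      refine (add_le_add_left ih _).trans ?_
      rw [Finset.sum_range_succ a, Finset.sum_range_succ (fun j : ℕ => ((j:ℝ)+1) * a j)]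
      set S := ∑ j ∈ Finset.range N, ((j:ℝ)+1) * a j
      set A := ∑ j ∈ Finset.range N, a j
      have hS : 0 ≤ S := Finset.sum_nonneg fun j _ => by have := ha j; positivity
      have haN := ha N
      have he := exp_pos 1
      have hN : (0:ℝ) ≤ N := by positivity
      have hw : (1:ℝ)/((N:ℝ)+1)^2 ≤ 2 * (1/((N:ℝ)+1) - 1/((N:ℝ)+2)) := by
        rw [div_sub_div _ _ (by positivity) (by positivity), ← mul_div_assoc,
          div_le_div_iff₀ (by positivity) (by positivity)]
        nlinarith
      have e1 : a N = 1/((N:ℝ)+1) * (((N:ℝ)+1) * a N) := by field_simp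
      have hT : 0 ≤ S + ((N:ℝ)+1) * a N := by positivity
      have hmain := mul_le_mul_of_nonneg_left hw (mul_nonneg he.le hT)
      push_cast
      rw [show (N:ℝ)+1+1 = N+2 by ring]
      generalize hb : ((N:ℝ)+1) * a N = b at *
      rw [e1]
      nlinarith
  refine summable_of_sum_range_le hnn (c := 2 * exp 1 * ∑' j, a j) fun N => (hinv N).trans ?_
  have h1 : ∑ j ∈ Finset.range N, a j ≤ ∑' j, a j := hs.sum_le_tsum _ (fun j _ => (ha j).le)
  have h2 : 0 ≤ 1/((N:ℝ)+1) * ∑ j ∈ Finset.range N, ((j:ℝ)+1) * a j := by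
    have : 0 ≤ ∑ j ∈ Finset.range N, ((j:ℝ)+1) * a j :=
      Finset.sum_nonneg fun j _ => by have := ha j; positivity
    positivity
  have := exp_pos 1
  gcongr
  linarith

def Jet (G : ℕ → ℝ → ℝ) : Prop := ∀ n x, HasDerivAt (G n) (G (n+1) x) x

theorem Jet.cont {G : ℕ → ℝ → ℝ} (h : Jet G) (n : ℕ) : Continuous (G n) :=
  continuous_iff_continuousAt.2 fun x => (h n x).continuousAt

def avg (a : ℝ) (g : ℝ → ℝ) (x : ℝ) : ℝ := ∫ s in (0:ℝ)..1, g (x - a * s)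

theorem avg_eq {a : ℝ} (ha : 0 < a) {g g' : ℝ → ℝ} (hg : ∀ x, HasDerivAt g (g' x) x)
    (hc : Continuous g') (x : ℝ) : avg a g' x = (g x - g (x - a)) / a := by
  have h : ∀ s ∈ uIcc (0:ℝ) 1, HasDerivAt (fun s => -(1/a) * g (x - a * s)) (g' (x - a * s)) s := by
    intro s _
    have h0 : HasDerivAt (fun s => x - a * s) (-a) s := by
      simpa using ((hasDerivAt_id s).const_mul a).const_sub x
    have h1 := ((hg (x - a * s)).comp s h0).const_mul (-(1/a))
    exact h1.congr_deriv (by field_simp)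
  unfold avg
  rw [intervalIntegral.integral_eq_sub_of_hasDerivAt h
    (Continuous.intervalIntegrable (by fun_prop) _ _)]
  simp only [mul_one, mul_zero, sub_zero]
  field_simp
  ring

theorem hasDerivAt_diff {a : ℝ} {g g' : ℝ → ℝ} (hg : ∀ x, HasDerivAt g (g' x) x) (x : ℝ) :
    HasDerivAt (fun x => (g x - g (x - a)) / a) ((g' x - g' (x - a)) / a) x := by
  have h2 : HasDerivAt (fun x => g (x - a)) (g' (x - a)) x := by
    simpa using (hg (x - a)).comp_sub_const x a
  exact ((hg x).sub h2).div_const a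

theorem hasDerivAt_avg {a : ℝ} (ha : 0 < a) {g g' : ℝ → ℝ} (hg : ∀ x, HasDerivAt g (g' x) x)
    (hc : Continuous g') (x : ℝ) : HasDerivAt (avg a g) (avg a g' x) x := by
  have hcg : Continuous g := continuous_iff_continuousAt.2 fun x => (hg x).continuousAt
  have hA : ∀ x, HasDerivAt (fun x => ∫ t in (0:ℝ)..x, g t) (g x) x := fun x =>
    intervalIntegral.integral_hasDerivAt_right (hcg.intervalIntegrable _ _)
      hcg.aestronglyMeasurable.stronglyMeasurableAtFilter hcg.continuousAt
  have e : avg a g = fun x => ((∫ t in (0:ℝ)..x, g t) - ∫ t in (0:ℝ)..(x - a), g t) / a :=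
    funext fun x => avg_eq ha hA hcg x
  rw [avg_eq ha hg hc x, e]
  exact hasDerivAt_diff hA x

theorem Jet.avg {a : ℝ} (ha : 0 < a) {G : ℕ → ℝ → ℝ} (h : Jet G) :
    Jet (fun n => avg a (G n)) := fun n x =>
  hasDerivAt_avg ha (h n) (h.cont (n+1)) x

theorem abs_avg_le {a B : ℝ} {g : ℝ → ℝ} (hg : ∀ x, |g x| ≤ B) (x : ℝ) : |avg a g x| ≤ B := by
  have := intervalIntegral.norm_integral_le_of_norm_le_const (a := (0:ℝ)) (b := 1)
    (f := fun s => g (x - a * s)) (C := B) (fun s _ => hg _)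
  simpa [_root_.avg] using this

theorem abs_avg_sub_le {a B : ℝ} (ha : 0 < a) {g g' : ℝ → ℝ} (hg : ∀ x, HasDerivAt g (g' x) x)
    (hB : ∀ x, |g' x| ≤ B) (x : ℝ) : |avg a g x - g x| ≤ a * B := by
  have hcg : Continuous g := continuous_iff_continuousAt.2 fun x => (hg x).continuousAt
  have e : avg a g x - g x = ∫ s in (0:ℝ)..1, (g (x - a * s) - g x) := by
    rw [intervalIntegral.integral_sub (Continuous.intervalIntegrable (by fun_prop) _ _)
      (by simp)]
    simp [_root_.avg]
  rw [e]
  have := intervalIntegral.norm_integral_le_of_norm_le_const (a := (0:ℝ)) (b := 1)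
    (f := fun s => g (x - a * s) - g x) (C := a * B) (fun s hs => by
      rw [uIoc_of_le zero_le_one] at hs
      have h1 := Convex.norm_image_sub_le_of_norm_hasDerivWithin_le (f := g) (f' := g')
        (s := univ) (C := B) (fun x _ => (hg x).hasDerivWithinAt) (fun x _ => hB x)
        convex_univ (mem_univ x) (mem_univ (x - a * s))
      refine h1.trans ?_
      have hB0 : 0 ≤ B := (abs_nonneg _).trans (hB 0)
      have : ‖x - a * s - x‖ ≤ a := by
        rw [show x - a * s - x = -(a * s) by ring, norm_neg, Real.norm_eq_abs,
          abs_of_nonneg (mul_nonneg ha.le hs.1.le)]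
        nlinarith [hs.2]
      nlinarith)
  simpa using this

def itAvg : ℕ → (ℕ → ℝ) → (ℝ → ℝ) → ℝ → ℝ
  | 0, _, g => g
  | k+1, a, g => itAvg k (fun j => a (j+1)) (avg (a 0) g)

theorem itAvg_succ' (k : ℕ) : ∀ (a : ℕ → ℝ) (g : ℝ → ℝ),
    itAvg (k+1) a g = avg (a k) (itAvg k a g) := by
  induction k with
  | zero => intro a g; rfl
  | succ k ih =>
    intro a g
    rw [itAvg, ih]; rfl

theorem Jet.itAvg {a : ℕ → ℝ} (ha : ∀ n, 0 < a n) {G : ℕ → ℝ → ℝ} (h : Jet G) (k : ℕ) :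
    Jet (fun n => itAvg k a (G n)) := by
  induction k with
  | zero => exact h
  | succ k ih =>
    simp only [itAvg_succ']
    exact ih.avg (ha k)

theorem abs_itAvg_le {a : ℕ → ℝ} {B : ℝ} {g : ℝ → ℝ} (hg : ∀ x, |g x| ≤ B) (k : ℕ) :
    ∀ x, |itAvg k a g x| ≤ B := by
  induction k with
  | zero => exact hg
  | succ k ih => rw [itAvg_succ']; exact abs_avg_le ih

theorem abs_itAvg_deriv_le (n : ℕ) : ∀ (k : ℕ) (a : ℕ → ℝ) (G : ℕ → ℝ → ℝ) (B : ℝ), n ≤ k →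
    (∀ n, 0 < a n) → Jet G → (∀ x, |G 0 x| ≤ B) →
    ∀ x, |itAvg k a (G n) x| ≤ (∏ j ∈ Finset.range n, 2 / a j) * B := by
  induction n with
  | zero =>
    intro k a G B _ _ _ hB x
    simpa using abs_itAvg_le hB k x
  | succ n ih =>
    intro k a G B hk ha hG hB x
    obtain ⟨k, rfl⟩ : ∃ k', k = k' + 1 := ⟨k-1, by omega⟩
    have e : avg (a 0) (G (n+1)) = fun x => (G n x - G n (x - a 0)) / a 0 :=
      funext fun x => avg_eq (ha 0) (hG n) (hG.cont (n+1)) x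
    rw [itAvg, e]
    have := ih k (fun j => a (j+1)) (fun n x => (G n x - G n (x - a 0)) / a 0) (2 / a 0 * B)
      (by omega) (fun n => ha _) (fun n x => hasDerivAt_diff (hG n) x) (fun x => by
        rw [abs_div, abs_of_pos (ha 0), div_mul_eq_mul_div]
        have := ha 0
        gcongr
        have h1 := abs_sub (G 0 x) (G 0 (x - a 0))
        linarith [hB x, hB (x - a 0)]) x
    rw [Finset.prod_range_succ']
    refine this.trans (le_of_eq (by ring))

theorem itAvg_zero {a : ℕ → ℝ} (ha : ∀ n, 0 < a n) {g : ℝ → ℝ} (hg : ∀ x ≤ 0, g x = 0) (k : ℕ) :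
    ∀ x ≤ 0, itAvg k a g x = 0 := by
  induction k with
  | zero => exact hg
  | succ k ih =>
    intro x hx
    rw [itAvg_succ', avg]
    rw [intervalIntegral.integral_congr (g := fun _ => 0)]
    · simp
    · intro s hs
      rw [uIcc_of_le zero_le_one] at hs
      refine ih _ ?_
      nlinarith [ha k, hs.1, mul_nonneg (ha k).le hs.1]

theorem itAvg_one {a : ℕ → ℝ} (ha : ∀ n, 0 < a n) {g : ℝ → ℝ} {c : ℝ} (hg : ∀ x, c ≤ x → g x = 1)
    (k : ℕ) : ∀ x, c + ∑ j ∈ Finset.range k, a j ≤ x → itAvg k a g x = 1 := by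
  induction k with
  | zero => intro x hx; exact hg x (by simpa using hx)
  | succ k ih =>
    intro x hx
    rw [itAvg_succ', avg]
    rw [intervalIntegral.integral_congr (g := fun _ => 1)]
    · simp
    · intro s hs
      rw [uIcc_of_le zero_le_one] at hs
      refine ih _ ?_
      rw [Finset.sum_range_succ] at hx
      nlinarith [ha k, hs.2]

theorem transition_jet : Jet (fun n => iteratedDeriv n Real.smoothTransition) := by
  intro n x
  have h : ContDiff ℝ (⊤ : ℕ∞) Real.smoothTransition := Real.smoothTransition.contDiff
  have := (h.differentiable_iteratedDeriv n (by exact_mod_cast WithTop.coe_lt_top n)) x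
  simp only [iteratedDeriv_succ]
  exact this.hasDerivAt

theorem transition_bdd (n : ℕ) :
    ∃ B, ∀ x, |iteratedDeriv (n+1) Real.smoothTransition x| ≤ B := by
  obtain ⟨B, hB⟩ := isCompact_Icc.exists_bound_of_continuousOn (s := Icc (0:ℝ) 1)
    (transition_jet.cont (n+1)).continuousOn
  refine ⟨B, fun x => ?_⟩
  have hB0 : 0 ≤ B := (norm_nonneg _).trans (hB 0 (by simp))
  by_cases hx : x ∈ Icc (0:ℝ) 1
  · exact hB x hx
  · have : ∃ c : ℝ, Real.smoothTransition =ᶠ[𝓝 x] fun _ => c := by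
      simp only [mem_Icc, not_and_or, not_le] at hx
      rcases hx with hx | hx
      · exact ⟨0, by filter_upwards [Iio_mem_nhds hx] with y hy using
          Real.smoothTransition.zero_of_nonpos (le_of_lt hy)⟩
      · exact ⟨1, by filter_upwards [Ioi_mem_nhds hx] with y hy using
          Real.smoothTransition.one_of_one_le (le_of_lt hy)⟩
    obtain ⟨c, hc⟩ := this
    rw [hc.iteratedDeriv_eq (n+1), iteratedDeriv_const]
    simpa using hB0

theorem exists_jet (a : ℕ → ℝ) (ha : ∀ n, 0 < a n) (hs : Summable a) :
    ∃ F : ℕ → ℝ → ℝ, Jet F ∧ (∀ n x, |F n x| ≤ ∏ j ∈ Finset.range n, 2 / a j) ∧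
      (∀ x ≤ 0, F 0 x = 0) ∧ ∃ x, F 0 x = 1 := by
  set G : ℕ → ℝ → ℝ := fun n => iteratedDeriv n Real.smoothTransition with hG
  have hJ : Jet G := transition_jet
  choose B hB using transition_bdd
  have hG0 : G 0 = Real.smoothTransition := iteratedDeriv_zero
  have hd : ∀ n x k, dist (itAvg k a (G n) x) (itAvg (k+1) a (G n) x) ≤ a k * B n := by
    intro n x k
    rw [dist_comm, Real.dist_eq, itAvg_succ']
    exact abs_avg_sub_le (ha k) ((hJ.itAvg ha k) n) (abs_itAvg_le (hB n) k) x
  have hsum : ∀ n, Summable (fun k => a k * B n) := fun n => hs.mul_right _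
  have hcau : ∀ n x, ∃ y, Tendsto (fun k => itAvg k a (G n) x) atTop (𝓝 y) := fun n x =>
    cauchySeq_tendsto_of_complete (cauchySeq_of_dist_le_of_summable _ (hd n x) (hsum n))
  choose F hF using hcau
  have hunif : ∀ n, TendstoUniformly (fun k => itAvg k a (G n)) (F n) atTop := by
    intro n
    rw [Metric.tendstoUniformly_iff]
    intro ε hε
    have ht := tendsto_sum_nat_add (fun k => a k * B n)
    filter_upwards [ht.eventually_lt_const hε] with k hk x
    rw [dist_comm]
    refine (dist_le_tsum_of_dist_le_of_tendsto _ (hd n x) (hsum n) (hF n x) k).trans_lt ?_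
    simpa [add_comm] using hk
  refine ⟨F, ?_, ?_, ?_, ?_⟩
  · intro n x
    exact hasDerivAt_of_tendstoUniformly (hunif (n+1))
      (Eventually.of_forall fun k x => (hJ.itAvg ha k) n x) (hF n) x
  · intro n x
    refine le_of_tendsto (hF n x).abs ?_
    filter_upwards [eventually_ge_atTop n] with k hk
    have := abs_itAvg_deriv_le n k a G 1 hk ha hJ (fun x => by
      rw [hG0, abs_of_nonneg (Real.smoothTransition.nonneg x)]
      exact Real.smoothTransition.le_one x) x
    simpa using this
  · intro x hx
    refine tendsto_nhds_unique (hF 0 x) ?_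
    simp only [itAvg_zero ha (g := G 0) (by
      intro x hx; rw [hG0]; exact Real.smoothTransition.zero_of_nonpos hx) _ x hx]
    exact tendsto_const_nhds
  · refine ⟨1 + ∑' j, a j, ?_⟩
    refine tendsto_nhds_unique (hF 0 _) ?_
    have : ∀ k, itAvg k a (G 0) (1 + ∑' j, a j) = 1 := fun k =>
      itAvg_one ha (c := 1) (by
        intro x hx; rw [hG0]; exact Real.smoothTransition.one_of_one_le hx) k _ (by
          have := hs.sum_le_tsum (Finset.range k) (fun j _ => (ha j).le)
          linarith)
    simp only [this]
    exact tendsto_const_nhds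

theorem Jet.iteratedDeriv_eq {F : ℕ → ℝ → ℝ} (h : Jet F) (n : ℕ) :
    iteratedDeriv n (F 0) = F n := by
  induction n with
  | zero => exact iteratedDeriv_zero
  | succ n ih => rw [iteratedDeriv_succ, ih]; exact funext fun x => (h n x).deriv

theorem Jet.contDiff {F : ℕ → ℝ → ℝ} (h : Jet F) : ContDiff ℝ (⊤ : ℕ∞) (F 0) := by
  refine contDiff_of_differentiable_iteratedDeriv fun n _ => ?_
  rw [h.iteratedDeriv_eq]
  exact fun x => (h n x).differentiableAt

theorem RegularSeq.ratio {m : ℕ → ℝ} (hm : RegularSeq m) (n : ℕ) (hn : 1 ≤ n) :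
    m (n+1) / m n ≤ m (n+2) / m (n+1) := by
  obtain ⟨hpos, -, -, -, hconv⟩ := hm
  have p0 := hpos n hn
  have p1 := hpos (n+1) (by omega)
  have p2 := hpos (n+2) (by omega)
  have f0 : (0:ℝ) < (Nat.factorial n : ℝ) := by exact_mod_cast Nat.factorial_pos n
  have f1 : (Nat.factorial (n+1) : ℝ) = (n+1) * Nat.factorial n := by
    rw [Nat.factorial_succ]; push_cast; ring
  have f2 : (Nat.factorial (n+2) : ℝ) = (n+2) * ((n+1) * Nat.factorial n) := by
    rw [Nat.factorial_succ, Nat.factorial_succ]; push_cast; ring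
  have h := hconv n hn
  rw [f1, f2] at h
  set q := (Nat.factorial n : ℝ)
  have hn0 : (0:ℝ) ≤ n := by positivity
  rw [← Real.log_mul (by positivity) (by positivity), le_div_iff₀ (by norm_num), mul_comm,
    show (2:ℝ) * Real.log (m (n+1) / ((n+1) * q)) =
      Real.log ((m (n+1) / ((n+1) * q)) ^ 2) by rw [Real.log_pow]; norm_num,
    Real.log_le_log_iff (by positivity) (by positivity)] at h
  have h2 : m (n+1) ^ 2 * (n+2) ≤ m n * m (n+2) * (n+1) := by
    have h3 := mul_le_mul_of_nonneg_left h
      (show 0 ≤ (((n:ℝ)+1) * q)^2 * (n+2) by positivity)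
    have e1 : (((n:ℝ)+1) * q)^2 * (n+2) * (m (n+1) / ((n+1) * q)) ^ 2 = m (n+1) ^ 2 * (n+2) := by
      field_simp
    have e2 : (((n:ℝ)+1) * q)^2 * (n+2) * (m n / q * (m (n+2) / ((n+2) * ((n+1) * q))))
        = m n * m (n+2) * (n+1) := by
      field_simp
    rwa [e1, e2] at h3
  rw [div_le_div_iff₀ p0 p1]
  have h4 : 0 < m n * m (n+2) := by positivity
  have h5 : m (n+1) ^ 2 * (n+2) ≤ m n * m (n+2) * (n+2) := by nlinarith
  have := le_of_mul_le_mul_right h5 (by positivity)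
  nlinarith

theorem RegularSeq.not_summable_ratio {m : ℕ → ℝ} (hm : RegularSeq m)
    (h : ¬ Summable (fun n : ℕ => (m (n + 1)) ^ (-(1 : ℝ) / (n + 1 : ℝ)))) :
    ¬ Summable (fun n : ℕ => m (n+1) / m (n+2)) := by
  intro hs
  apply h
  have hpos := hm.1
  let a : ℕ → ℝ := fun n => Nat.casesOn n (1 / m 1) (fun n => m (n+1) / m (n+2))
  have ha : ∀ n, 0 < a n := by
    intro n
    cases n with
    | zero => exact one_div_pos.2 (hpos 1 le_rfl)
    | succ n => exact div_pos (hpos _ (by omega)) (hpos _ (by omega))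
  have hsa : Summable a := (summable_nat_add_iff 1).1 hs
  have hprod : ∀ n, ∏ j ∈ Finset.range (n+1), a j = (m (n+1))⁻¹ := by
    intro n
    induction n with
    | zero => simp [a]
    | succ n ih =>
      rw [Finset.prod_range_succ, ih]
      have := hpos (n+1) (by omega)
      have := hpos (n+2) (by omega)
      change _ * (m (n+1) / m (n+2)) = _
      field_simp
  refine (carleman_summable a ha hsa).congr fun n => ?_
  rw [hprod, Real.inv_rpow (hpos _ (by omega)).le, ← Real.rpow_neg (hpos _ (by omega)).le, neg_div]

theorem RegularSeq.summable_ratio {m : ℕ → ℝ} (hm : RegularSeq m)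
    (h : Summable (fun n : ℕ => (m (n + 1)) ^ (-(1 : ℝ) / (n + 1 : ℝ)))) :
    Summable (fun n : ℕ => m (n+1) / m (n+2)) := by
  have hpos := hm.1
  have h1 : Summable (fun n : ℕ => (m (n + 2)) ^ (-(1 : ℝ) / (n + 2 : ℝ))) := by
    refine ((summable_nat_add_iff 1).2 h).congr fun n => ?_
    push_cast
    rw [show (n:ℝ)+1+1 = n+2 by ring]
  refine Summable.of_nonneg_of_le
    (fun n => (div_pos (hpos _ (by omega)) (hpos _ (by omega))).le) ?_
    (h1.mul_left (max 1 (m 1)))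
  intro n
  set r := m (n+1) / m (n+2) with hr
  have p1 := hpos (n+1) (by omega)
  have p2 := hpos (n+2) (by omega)
  have pm1 := hpos 1 le_rfl
  have hr0 : 0 < r := div_pos p1 p2
  have hr1 : r ≤ 1 := (div_le_one p2).2 (hm.2.1 (n+1) (by omega))
  have hmono : Monotone (fun n => m (n+2) / m (n+1)) :=
    monotone_nat_of_le_succ fun n => hm.ratio (n+1) (by omega)
  have hk : ∀ k ≤ n + 1, r ^ k * m (k+1) ≤ m 1 := by
    intro k
    induction k with
    | zero => simp
    | succ k ih =>
      intro hk
      have h2 := hmono (show k ≤ n by omega)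
      simp only at h2
      have pk := hpos (k+1) (by omega)
      have h3 : r * m (k+2) ≤ m (k+1) := by
        rw [hr, div_mul_eq_mul_div, div_le_iff₀ p2]
        rw [div_le_div_iff₀ pk p1] at h2
        linarith
      calc r^(k+1) * m (k+1+1) = r^k * (r * m (k+2)) := by ring_nf
        _ ≤ r^k * m (k+1) := by gcongr
        _ ≤ m 1 := ih (by omega)
  have h4 : r ^ (n+2) ≤ m 1 / m (n+2) := by
    rw [le_div_iff₀ p2]
    have := hk (n+1) le_rfl
    have h5 : r ^ (n+2) * m (n+2) = r * (r^(n+1) * m (n+2)) := by ring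
    rw [h5]
    have h6 : 0 ≤ r^(n+1) * m (n+2) := by positivity
    have h7 : r^(n+1) * m (n+2) ≤ m 1 := this
    nlinarith
  have h8 := Real.rpow_le_rpow (by positivity) h4 (z := (1:ℝ)/(n+2)) (by positivity)
  rw [← Real.rpow_natCast, ← Real.rpow_mul hr0.le] at h8
  have h9 : ((n+2:ℕ):ℝ) * (1/((n:ℝ)+2)) = 1 := by push_cast; field_simp
  rw [h9, Real.rpow_one, Real.div_rpow pm1.le p2.le, div_eq_mul_inv, ← Real.rpow_neg p2.le,
    ← neg_div] at h8
  refine h8.trans ?_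
  gcongr
  have e0 : (0:ℝ) ≤ 1/((n:ℝ)+2) := by positivity
  have e1 : (1:ℝ)/((n:ℝ)+2) ≤ 1 := by
    rw [div_le_one (by positivity)]
    have : (0:ℝ) ≤ n := by positivity
    linarith
  calc (m 1) ^ ((1:ℝ)/(n+2)) ≤ (max 1 (m 1)) ^ ((1:ℝ)/(n+2)) :=
        Real.rpow_le_rpow pm1.le (le_max_right _ _) e0
    _ ≤ (max 1 (m 1)) ^ (1:ℝ) := Real.rpow_le_rpow_of_exponent_le (le_max_left _ _) e1
    _ = _ := Real.rpow_one _

theorem local_zero {d : ℕ} (m : ℕ → ℝ) (hm : RegularSeq m)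
    (hdiv : ¬ Summable (fun n : ℕ => m (n+1) / m (n+2)))
    (D : Set (Fin d → ℝ)) (hD : IsOpen D) (u : (Fin d → ℝ) → ℝ)
    (hu : ContDiffOn ℝ (⊤ : ℕ∞) u D)
    (v : Fin d → ℝ) (r : ℝ) (hball : Metric.closedBall v r ⊆ D)
    (hC : CarlemanClass m (Metric.ball v r) u)
    (hv : ∀ n, iteratedFDeriv ℝ n u v = 0) (y : Fin d → ℝ) (hy : y ∈ Metric.ball v r) :
    u y = 0 := by
  obtain ⟨-, C, hC0, hC⟩ := hC
  have hpos := hm.1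
  set w := y - v with hw
  obtain ⟨S, hS⟩ := (isCompact_closedBall v r).exists_bound_of_continuousOn
    (hu.continuousOn.mono hball)
  set A := C * (‖w‖ + 1) with hA
  have hApos : 0 < A := by positivity
  have hseg : ∀ t ∈ Icc (0:ℝ) 1, v + t • w ∈ Metric.ball v r := by
    intro t ht
    rw [mem_ball_iff_norm, add_sub_cancel_left, norm_smul, Real.norm_eq_abs, abs_of_nonneg ht.1]
    rw [mem_ball_iff_norm] at hy
    nlinarith [norm_nonneg w, ht.2]
  let F : ℕ → ℝ → ℝ := fun n t => iteratedFDeriv ℝ n u (v + t • w) (fun _ => w)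
  let M : ℕ → ℝ := fun n =>
    Nat.casesOn n (max S ((A * m 1)^2 / (A^2 * m 2))) (fun n => A^(n+1) * m (n+1))
  have p1 := hpos 1 le_rfl
  have p2 := hpos 2 (by omega)
  have hM0 : (A * m 1)^2 / (A^2 * m 2) ≤ M 0 := le_max_right _ _
  have hMS : ∀ n, M (n+1) = A^(n+1) * m (n+1) := fun n => rfl
  have hM : ∀ n, 0 < M n := by
    intro n
    cases n with
    | zero => exact lt_of_lt_of_le (by positivity) hM0
    | succ n => rw [hMS]; have := hpos (n+1) (by omega); positivity
  have h01 : F 0 1 = u y := by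
    simp [F, hw]
  rw [← h01]
  refine bang F M hM ?_ ?_ ?_ ?_ ?_
  · intro n
    cases n with
    | zero =>
      rw [div_le_div_iff₀ (hM 0) (hM (0+1))]
      rw [div_le_iff₀ (by positivity)] at hM0
      change A^1 * m 1 * (A^1 * m 1) ≤ A^2 * m 2 * M 0
      nlinarith
    | succ n =>
      have h := hm.ratio (n+1) (by omega)
      rw [hMS, show n+1+1 = (n+1)+1 from rfl, hMS, show n+1+2 = (n+2)+1 from rfl, hMS]
      have q1 := hpos (n+1) (by omega)
      have q2 := hpos (n+2) (by omega)
      have e1 : A^(n+1+1) * m (n+1+1) / (A^(n+1) * m (n+1)) = A * (m (n+2) / m (n+1)) := by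
        rw [pow_succ A (n+1)]; field_simp
      have e2 : A^(n+2+1) * m (n+2+1) / (A^(n+1+1) * m (n+1+1)) = A * (m (n+3) / m (n+2)) := by
        rw [pow_succ A (n+2)]; field_simp
      rw [e1, e2]
      exact mul_le_mul_of_nonneg_left h hApos.le
  · intro hs
    apply hdiv
    have := ((summable_nat_add_iff 1).2 hs).mul_left A
    refine this.congr fun n => ?_
    rw [hMS, hMS]
    have q1 := hpos (n+1) (by omega)
    have q2 := hpos (n+2) (by omega)
    rw [pow_succ A (n+1)]
    field_simp
  · intro n t ht
    have hmem : v + t • w ∈ D := hball (Metric.ball_subset_closedBall (hseg t ht))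
    have hcd : ContDiffAt ℝ (⊤ : ℕ∞) u (v + t • w) := hu.contDiffAt (hD.mem_nhds hmem)
    have hdiff : DifferentiableAt ℝ (iteratedFDeriv ℝ n u) (v + t • w) :=
      hcd.differentiableAt_iteratedFDeriv (by exact_mod_cast WithTop.coe_lt_top n)
    have hline : HasDerivAt (fun t : ℝ => v + t • w) w t := by
      simpa using ((hasDerivAt_id t).smul_const w).const_add v
    have h1 := hdiff.hasFDerivAt.comp_hasDerivAt t hline
    have h2 := ((ContinuousMultilinearMap.apply ℝ (fun _ : Fin n => (Fin d → ℝ)) ℝ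
      (fun _ => w)).hasFDerivAt).comp_hasDerivAt t h1
    refine h2.congr_deriv ?_
    simp only [F, iteratedFDeriv_succ_apply_left]
    rfl
  · intro n t ht
    have hb := hseg t ht
    cases n with
    | zero =>
      refine le_trans ?_ (le_max_left _ _)
      simpa [F] using hS _ (Metric.ball_subset_closedBall hb)
    | succ n =>
      rw [hMS]
      have h1 := (iteratedFDeriv ℝ (n+1) u (v + t • w)).le_opNorm (fun _ => w)
      have h2 := hC (n+1) (by omega) _ hb
      rw [iteratedFDerivWithin_of_isOpen (n+1) Metric.isOpen_ball hb] at h2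
      rw [Finset.prod_const, Finset.card_univ, Fintype.card_fin] at h1
      refine h1.trans ?_
      have q1 := hpos (n+1) (by omega)
      calc _ ≤ C^(n+1) * m (n+1) * (‖w‖+1)^(n+1) := by
            gcongr
            linarith
        _ = _ := by rw [hA, mul_pow]; ring
  · intro n
    simp [F, hv n]

theorem forward (m : ℕ → ℝ) (hm : RegularSeq m)
    (hdiv : ¬ Summable (fun n : ℕ => m (n+1) / m (n+2)))
    (d : ℕ) (D : Set (Fin d → ℝ)) (hD : IsOpen D) (hDc : IsConnected D)
    (u : (Fin d → ℝ) → ℝ) (hu : ContDiffOn ℝ (⊤ : ℕ∞) u D)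
    (hC : ∀ D' : Set (Fin d → ℝ), IsOpen D' → IsCompact (closure D') → closure D' ⊆ D →
          CarlemanClass m D' u)
    (x₀ : Fin d → ℝ) (hx₀ : x₀ ∈ D) (h0 : ∀ n : ℕ, iteratedFDerivWithin ℝ n u D x₀ = 0) :
    ∀ x ∈ D, u x = 0 := by
  let V : Set (Fin d → ℝ) := {x | x ∈ D ∧ ∀ n, iteratedFDeriv ℝ n u x = 0}
  have hloc : ∀ v ∈ V, ∀ r, Metric.closedBall v r ⊆ D → Metric.ball v r ⊆ V := by
    intro v hv r hr
    have hCb : CarlemanClass m (Metric.ball v r) u :=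
      hC _ Metric.isOpen_ball
        ((isCompact_closedBall v r).of_isClosed_subset isClosed_closure
          Metric.closure_ball_subset_closedBall)
        (Metric.closure_ball_subset_closedBall.trans hr)
    have hz := local_zero m hm hdiv D hD u hu v r hr hCb hv.2
    intro y hy
    refine ⟨hr (Metric.ball_subset_closedBall hy), fun n => ?_⟩
    have he : u =ᶠ[𝓝 y] fun _ => 0 := by
      filter_upwards [Metric.isOpen_ball.mem_nhds hy] with z hz' using hz z hz'
    rw [(he.iteratedFDeriv ℝ n).eq_of_nhds]
    simp
  have hopen : IsOpen V := by
    rw [Metric.isOpen_iff]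
    intro v hv
    obtain ⟨r, hr, hs⟩ := Metric.nhds_basis_closedBall.mem_iff.1 (hD.mem_nhds hv.1)
    exact ⟨r, hr, hloc v hv r hs⟩
  have hsub : D ⊆ V := by
    refine hDc.isPreconnected.subset_of_closure_inter_subset hopen ⟨x₀, hx₀, hx₀, fun n => ?_⟩ ?_
    · rw [← iteratedFDerivWithin_of_isOpen n hD hx₀]; exact h0 n
    · rintro x ⟨hxV, hxD⟩
      obtain ⟨r, hr, hs⟩ := Metric.nhds_basis_closedBall.mem_iff.1 (hD.mem_nhds hxD)
      obtain ⟨v, hvV, hv⟩ := Metric.mem_closure_iff.1 hxV (r/2) (by positivity)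
      refine hloc v hvV (r/2) ?_ (Metric.mem_ball.2 hv)
      refine (Metric.closedBall_subset_closedBall' ?_).trans hs
      rw [dist_comm]; linarith
  intro x hx
  have := (hsub hx).2 0
  have h2 := congrArg (fun f => f (fun _ => 0)) this
  simpa using h2

theorem backward (m : ℕ → ℝ) (hm : RegularSeq m)
    (hs : Summable (fun n : ℕ => m (n+1) / m (n+2))) :
    ∃ u : (Fin 1 → ℝ) → ℝ, ContDiff ℝ (⊤ : ℕ∞) u ∧
      (∃ C : ℝ, 0 < C ∧ ∀ n : ℕ, 1 ≤ n → ∀ x, ‖iteratedFDeriv ℝ n u x‖ ≤ C ^ n * m n) ∧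
      (∃ x₀, ∀ n, iteratedFDeriv ℝ n u x₀ = 0) ∧ ∃ x, u x ≠ 0 := by
  have hpos := hm.1
  let a : ℕ → ℝ := fun n => Nat.casesOn n 1 (fun n => m (n+1) / m (n+2))
  have ha : ∀ n, 0 < a n := by
    intro n
    cases n with
    | zero => exact one_pos
    | succ n => exact div_pos (hpos _ (by omega)) (hpos _ (by omega))
  have hsa : Summable a := (summable_nat_add_iff 1).1 hs
  have p1 := hpos 1 le_rfl
  have hprod : ∀ n, ∏ j ∈ Finset.range (n+1), 2 / a j = 2^(n+1) * m (n+1) / m 1 := by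
    intro n
    induction n with
    | zero => simp [a]; field_simp
    | succ n ih =>
      rw [Finset.prod_range_succ, ih]
      have := hpos (n+1) (by omega)
      have := hpos (n+2) (by omega)
      change _ * (2 / (m (n+1) / m (n+2))) = _
      rw [pow_succ 2 (n+1)]
      field_simp
  obtain ⟨F, hJ, hb, hz, x1, hx1⟩ := exists_jet a ha hsa
  let p : (Fin 1 → ℝ) →L[ℝ] ℝ := ContinuousLinearMap.proj 0
  have hp : ‖p‖ ≤ 1 := ContinuousLinearMap.opNorm_le_bound _ zero_le_one fun x => by
    rw [one_mul]; exact norm_le_pi_norm x 0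
  have hnorm : ∀ n x, ‖iteratedFDeriv ℝ n (F 0 ∘ p) x‖ ≤ |F n (p x)| := by
    intro n x
    rw [p.iteratedFDeriv_comp_right hJ.contDiff x (by exact_mod_cast le_top)]
    refine (ContinuousMultilinearMap.norm_compContinuousLinearMap_le _ _).trans ?_
    rw [norm_iteratedFDeriv_eq_norm_iteratedDeriv, hJ.iteratedDeriv_eq, Finset.prod_const,
      Real.norm_eq_abs]
    exact mul_le_of_le_one_right (abs_nonneg _) (pow_le_one₀ (norm_nonneg _) hp)
  refine ⟨F 0 ∘ p, hJ.contDiff.comp p.contDiff, ⟨2 * max 1 (1 / m 1), by positivity, ?_⟩,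
    ⟨fun _ => -1, fun n => ?_⟩, ⟨fun _ => x1, ?_⟩⟩
  · intro n hn x
    refine (hnorm n x).trans ((hb n _).trans ?_)
    obtain ⟨k, rfl⟩ : ∃ k, n = k + 1 := ⟨n-1, by omega⟩
    rw [hprod, mul_pow]
    have q := hpos (k+1) hn
    have h1 : 1 / m 1 ≤ (max 1 (1 / m 1))^(k+1) :=
      (le_max_right _ _).trans (le_self_pow₀ (le_max_left _ _) (by omega))
    calc 2^(k+1) * m (k+1) / m 1 = 2^(k+1) * (1 / m 1) * m (k+1) := by ring
      _ ≤ _ := by gcongr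
  · have h1 := hnorm n (fun _ => -1)
    have h2 : F n (p (fun _ => -1)) = 0 := by
      change F n (-1) = 0
      rw [← hJ.iteratedDeriv_eq n]
      have he : F 0 =ᶠ[𝓝 (-1:ℝ)] fun _ => 0 := by
        filter_upwards [Iio_mem_nhds (show (-1:ℝ) < 0 by norm_num)] with z hz' using hz z (le_of_lt hz')
      rw [he.iteratedDeriv_eq n, iteratedDeriv_const]
      simp
    rw [h2, abs_zero] at h1
    exact norm_le_zero_iff.1 h1
  · change F 0 x1 ≠ 0
    rw [hx1]; exact one_ne_zero

/-- Carleman's criterion of quasianalyticity (Mandelbrojt): the class `C(m_n)` is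
quasianalytic if and only if `∑ m_n^{−1/n} = ∞`. -/
theorem quasianalytic_iff_divergent (m : ℕ → ℝ) (hm : RegularSeq m) :
    (¬ Summable (fun n : ℕ => (m (n + 1)) ^ (-(1 : ℝ) / (n + 1 : ℝ)))) ↔
    (∀ d : ℕ, 1 ≤ d → ∀ D : Set (Fin d → ℝ), IsOpen D → IsConnected D →
      ∀ u : (Fin d → ℝ) → ℝ, ContDiffOn ℝ (⊤ : ℕ∞) u D →
        (∀ D' : Set (Fin d → ℝ), IsOpen D' → IsCompact (closure D') → closure D' ⊆ D →
          CarlemanClass m D' u) →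
        ∀ x₀ ∈ D, (∀ n : ℕ, iteratedFDerivWithin ℝ n u D x₀ = 0) →
          ∀ x ∈ D, u x = 0) := by
  constructor
  · intro h d _ D hD hDc u hu hC x₀ hx₀ h0
    exact forward m hm (hm.not_summable_ratio h) d D hD hDc u hu hC x₀ hx₀ h0
  · intro h hs
    obtain ⟨u, hu, ⟨C, hC0, hC⟩, ⟨x₀, hx₀⟩, ⟨x, hx⟩⟩ := backward m hm (hm.summable_ratio hs)
    refine hx (h 1 le_rfl univ isOpen_univ isConnected_univ u hu.contDiffOn ?_ x₀ (mem_univ _)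
      ?_ x (mem_univ _))
    · intro D' hD' _ _
      refine ⟨hu.contDiffOn, C, hC0, fun n hn x hx => ?_⟩
      rw [iteratedFDerivWithin_of_isOpen n hD' hx]
      exact hC n hn x
    · intro n
      rw [iteratedFDerivWithin_univ]
      exact hx₀ n
end
end

section
/- Let h be a homogeneous Hamiltonian on T'ℝ^d with complete flow Φ(t; y, η) = (x*(t; y, η), ξ*(t; y, η)). Then the flow preserves the canonical 1-form ξ·dx: for all t ∈ ℝ, all (y, η) ∈ T'ℝ^d, and every index k ∈ {1, …, d}, Σ_{j=1}^d ξ*_j(t; y, η) · ∂x*_j/∂y_k(t; y, η) = η_k and Σ_{j=1}^d ξ*_j(t; y, η) · ∂x*_j/∂η_k(t; y, η) = 0. -/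
open Real Set Filter MeasureTheory
open scoped BigOperators Topology

noncomputable section

/-- The phase space `ℝ^d × ℝ^d`. -/
abbrev Phase (d : ℕ) := (Fin d → ℝ) × (Fin d → ℝ)

/-- `T'ℝ^d = ℝ^d × (ℝ^d ∖ {0})`. -/
def Tprime (d : ℕ) : Set (Phase d) := {p | p.2 ≠ 0}

/-- The Hamiltonian vector field `(∂h/∂ξ, −∂h/∂x)` of `h`. -/
def hamField {d : ℕ} (h : Phase d → ℝ) (p : Phase d) : Phase d :=
  (fun j => fderiv ℝ h p (0, Pi.single j 1), fun j => - fderiv ℝ h p (Pi.single j 1, 0))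

/-- `γ` solves Hamilton's equations `ẋ = h_ξ`, `ξ̇ = −h_x` on the set `I`. -/
def IsHamTrajOn {d : ℕ} (h : Phase d → ℝ) (γ : ℝ → Phase d) (I : Set ℝ) : Prop :=
  ∀ t ∈ I, HasDerivAt γ (hamField h (γ t)) t

/-- `h` is a homogeneous Hamiltonian: smooth and positive on `T'ℝ^d`, and positively
homogeneous of degree 1 in `ξ`. -/
def HomHamiltonian {d : ℕ} (h : Phase d → ℝ) : Prop :=
  ContDiffOn ℝ (⊤ : ℕ∞) h (Tprime d) ∧
  (∀ p ∈ Tprime d, 0 < h p) ∧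
  (∀ p ∈ Tprime d, ∀ c : ℝ, 0 < c → h (p.1, c • p.2) = c * h p)

/-- `Φ` is the complete flow of `h` on `T'ℝ^d`: it is smooth in `(t, y, η)`, starts at the
identity, stays in `T'ℝ^d`, solves Hamilton's equations for all time, and is the unique such
trajectory through each point. -/
def IsCompleteFlow {d : ℕ} (h : Phase d → ℝ) (Φ : ℝ → Phase d → Phase d) : Prop :=
  ContDiffOn ℝ (⊤ : ℕ∞) (fun q : ℝ × Phase d => Φ q.1 q.2) (Set.univ ×ˢ Tprime d) ∧
  ∀ p ∈ Tprime d,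
    Φ 0 p = p ∧ (∀ t : ℝ, Φ t p ∈ Tprime d) ∧
    IsHamTrajOn h (fun t => Φ t p) Set.univ ∧
    (∀ γ : ℝ → Phase d, γ 0 = p → (∀ t : ℝ, γ t ∈ Tprime d) →
      IsHamTrajOn h γ Set.univ → γ = fun t => Φ t p)

/-- The function `(y, η) ↦ |x*(T; y, η) − y|² + |ξ*(T; y, η) − η|²`. -/
def periodDefect {d : ℕ} (Φ : ℝ → Phase d → Phase d) (T : ℝ) (p : Phase d) : ℝ :=
  (∑ j, ((Φ T p).1 j - p.1 j) ^ 2) + (∑ j, ((Φ T p).2 j - p.2 j) ^ 2)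

/-- `p₀ ∈ T'ℝ^d` is absolutely `T`-periodic: the period defect vanishes to infinite
order at `p₀`. -/
def AbsPeriodic {d : ℕ} (Φ : ℝ → Phase d → Phase d) (T : ℝ) (p₀ : Phase d) : Prop :=
  p₀ ∈ Tprime d ∧
  ∀ n : ℕ, iteratedFDerivWithin ℝ n (periodDefect Φ T) (Tprime d) p₀ = 0

theorem isOpen_Tprime_aux (d : ℕ) : IsOpen (Tprime d) :=
  isOpen_ne_fun continuous_snd continuous_const

theorem fderiv_phase_aux {d : ℕ} (h : Phase d → ℝ) (p v : Phase d) :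
    fderiv ℝ h p v = ∑ j, (v.2 j * (hamField h p).1 j - v.1 j * (hamField h p).2 j) := by
  have hv : v = ∑ j, (v.1 j • ((Pi.single j 1, 0) : Phase d)
      + v.2 j • ((0, Pi.single j 1) : Phase d)) := by
    ext i
    · simp [Prod.fst_sum, Finset.sum_apply, Pi.single_apply]
    · simp [Prod.snd_sum, Finset.sum_apply, Pi.single_apply]
  conv_lhs => rw [hv]
  rw [map_sum]
  refine Finset.sum_congr rfl fun j _ => ?_
  rw [map_add, map_smul, map_smul]
  simp only [hamField, smul_eq_mul]
  ring

theorem euler_aux {d : ℕ} (h : Phase d → ℝ) (hh : HomHamiltonian h) (p : Phase d)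
    (hp : p ∈ Tprime d) : ∑ j, p.2 j * (hamField h p).1 j = h p := by
  have hd : HasFDerivAt h (fderiv ℝ h p) p :=
    ((hh.1.contDiffAt ((isOpen_Tprime_aux d).mem_nhds hp)).differentiableAt
      (by simp)).hasFDerivAt
  have hc : HasDerivAt (fun c : ℝ => ((p.1, c • p.2) : Phase d)) (0, p.2) 1 := by
    have := ((hasDerivAt_id (1 : ℝ)).smul_const p.2)
    simp only [id, one_smul] at this
    exact (hasDerivAt_const (1 : ℝ) p.1).prodMk this
  have h1 : HasDerivAt (fun c : ℝ => h (p.1, c • p.2)) (fderiv ℝ h p (0, p.2)) 1 := by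
    have hd' : HasFDerivAt h (fderiv ℝ h p) ((p.1, (1 : ℝ) • p.2) : Phase d) := by
      simpa using hd
    exact hd'.comp_hasDerivAt (1 : ℝ) hc
  have h2 : HasDerivAt (fun c : ℝ => h (p.1, c • p.2)) (h p) 1 := by
    have := (hasDerivAt_id (1 : ℝ)).mul_const (h p)
    simp only [id, one_mul] at this
    refine this.congr_of_eventuallyEq ?_
    filter_upwards [lt_mem_nhds (zero_lt_one' ℝ)] with c hc
    exact hh.2.2 p hp c hc
  have h3 := h1.unique h2
  rw [fderiv_phase_aux] at h3
  simpa using h3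

theorem one_form_aux {d : ℕ} (h : Phase d → ℝ)
    (hh : HomHamiltonian h) (Φ : ℝ → Phase d → Phase d) (hΦ : IsCompleteFlow h Φ)
    (p : Phase d) (hp : p ∈ Tprime d) (v : Phase d) (t : ℝ) :
    ∑ j, (Φ t p).2 j * fderiv ℝ (fun q : Phase d => (Φ t q).1 j) p v = ∑ j, p.2 j * v.1 j := by
  obtain ⟨hsm, hfl⟩ := hΦ
  have hU : IsOpen ((Set.univ : Set ℝ) ×ˢ Tprime d) := isOpen_univ.prod (isOpen_Tprime_aux d)
  set F : ℝ × Phase d → Phase d := fun q => Φ q.1 q.2 with hF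
  set G := fderiv ℝ F with hG
  have hFc : ∀ t, ∀ q ∈ Tprime d, ContDiffAt ℝ (⊤ : ℕ∞) F (t, q) := fun t q hq =>
    hsm.contDiffAt (hU.mem_nhds ⟨Set.mem_univ _, hq⟩)
  have hFd : ∀ t, ∀ q ∈ Tprime d, HasFDerivAt F (G (t, q)) (t, q) := fun t q hq =>
    ((hFc t q hq).differentiableAt (by simp)).hasFDerivAt
  have hGd : ∀ t, HasFDerivAt G (fderiv ℝ G (t, p)) (t, p) := fun t =>
    (((hFc t p hp).fderiv_right (m := 1) (by norm_cast)).differentiableAt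
      (by simp)).hasFDerivAt
  have hsymm : ∀ t a b, fderiv ℝ G (t, p) a b = fderiv ℝ G (t, p) b a := fun t a b =>
    ((hFc t p hp).isSymmSndFDerivAt (by simp; norm_cast)) a b
  -- spatial derivative
  have hsp : ∀ t, HasFDerivAt (fun q => Φ t q)
      ((G (t, p)).comp (ContinuousLinearMap.inr ℝ ℝ (Phase d))) p := fun t =>
    (hFd t p hp).comp p (hasFDerivAt_prodMk_right t p)
  have htime : ∀ t, ∀ q ∈ Tprime d, G (t, q) (1, 0) = hamField h (Φ t q) := by
    intro t q hq
    have h1 : HasDerivAt (fun s => Φ s q) (G (t, q) (1, 0)) t :=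
      HasFDerivAt.comp_hasDerivAt (l := F) (f := fun s : ℝ => (s, q)) t (hFd t q hq)
        ((hasDerivAt_id t).prodMk (hasDerivAt_const t q))
    exact h1.unique ((hfl q hq).2.2.1 t (Set.mem_univ _))
  -- first components
  have hx : ∀ t j, HasFDerivAt (fun q => (Φ t q).1 j) (((ContinuousLinearMap.proj (R := ℝ) (φ := fun _ : Fin d => ℝ) j).comp
      (ContinuousLinearMap.fst ℝ (Fin d → ℝ) (Fin d → ℝ))).comp
      ((G (t, p)).comp (ContinuousLinearMap.inr ℝ ℝ (Phase d)))) p := fun t j =>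
    ((ContinuousLinearMap.proj (R := ℝ) (φ := fun _ : Fin d => ℝ) j).comp
      (ContinuousLinearMap.fst ℝ (Fin d → ℝ) (Fin d → ℝ))).hasFDerivAt.comp p (hsp t)
  have key : ∀ t, ∑ j, (Φ t p).2 j * fderiv ℝ (fun q : Phase d => (Φ t q).1 j) p v
      = ∑ j, (Φ t p).2 j * (G (t, p) (0, v)).1 j := by
    intro t
    refine Finset.sum_congr rfl fun j _ => ?_
    rw [(hx t j).fderiv]
    simp
  rw [key]
  -- curve derivatives along a direction
  let c : ℝ → Phase d := fun s => p + s • v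
  have hc0 : c 0 = p := by simp [c]
  have hcd : HasDerivAt c v 0 := by
    have := ((hasDerivAt_id (0 : ℝ)).smul_const v).const_add p
    simpa [c] using this
  have hcT : ∀ᶠ s in 𝓝 (0 : ℝ), c s ∈ Tprime d := by
    apply hcd.continuousAt.eventually_mem
    rw [hc0]; exact (isOpen_Tprime_aux d).mem_nhds hp
  have hder : ∀ t, HasDerivAt (fun t => ∑ j, (Φ t p).2 j * (G (t, p) (0, v)).1 j) 0 t := by
    intro t
    have hw : HasDerivAt (fun t => G (t, p) (0, v)) (fderiv ℝ G (t, p) (0, v) (1, 0)) t := by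
      rw [hsymm]
      have h1 : HasDerivAt (fun t => G (t, p)) (fderiv ℝ G (t, p) (1, 0)) t :=
        (hGd t).comp_hasDerivAt t ((hasDerivAt_id t).prodMk (hasDerivAt_const t p))
      simpa using h1.clm_apply (hasDerivAt_const t ((0, v) : ℝ × Phase d))
    have hX : HasDerivAt (fun s => hamField h (Φ t (c s))) (fderiv ℝ G (t, p) (0, v) (1, 0)) 0 := by
      have hg : HasFDerivAt G (fderiv ℝ G (t, p)) (t, c 0) := by rw [hc0]; exact hGd t
      have h1 : HasDerivAt (fun s => G (t, c s)) (fderiv ℝ G (t, p) (0, v)) 0 :=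
        hg.comp_hasDerivAt (0 : ℝ) ((hasDerivAt_const (0 : ℝ) t).prodMk hcd)
      have h2 := h1.clm_apply (hasDerivAt_const (0 : ℝ) ((1, 0) : ℝ × Phase d))
      simp only [map_zero, add_zero] at h2
      refine h2.congr_of_eventuallyEq ?_
      filter_upwards [hcT] with s hs
      exact (htime t _ hs).symm
    have hPhi : HasDerivAt (fun s => Φ t (c s)) (G (t, p) (0, v)) 0 := by
      have hg : HasFDerivAt F (G (t, p)) (t, c 0) := by rw [hc0]; exact hFd t p hp
      exact hg.comp_hasDerivAt (0 : ℝ) ((hasDerivAt_const (0 : ℝ) t).prodMk hcd)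
    set w := G (t, p) (0, v) with hwdef
    set L := fderiv ℝ G (t, p) (0, v) (1, 0) with hL
    have fst_d : ∀ {f : ℝ → Phase d} {f' : Phase d} {s : ℝ}, HasDerivAt f f' s → ∀ j,
        HasDerivAt (fun s => (f s).1 j) (f'.1 j) s := fun hf j =>
      hasDerivAt_pi.1 ((hasFDerivAt_fst (𝕜 := ℝ)).comp_hasDerivAt _ hf) j
    have snd_d : ∀ {f : ℝ → Phase d} {f' : Phase d} {s : ℝ}, HasDerivAt f f' s → ∀ j,
        HasDerivAt (fun s => (f s).2 j) (f'.2 j) s := fun hf j =>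
      hasDerivAt_pi.1 ((hasFDerivAt_snd (𝕜 := ℝ)).comp_hasDerivAt _ hf) j
    have hΦT := (hfl p hp).2.1 t
    have e1 : HasDerivAt (fun s => h (Φ t (c s))) (fderiv ℝ h (Φ t p) w) 0 := by
      have hd : HasFDerivAt h (fderiv ℝ h (Φ t p)) (Φ t (c 0)) := by
        rw [hc0]
        exact ((hh.1.contDiffAt ((isOpen_Tprime_aux d).mem_nhds hΦT)).differentiableAt
          (by simp)).hasFDerivAt
      exact hd.comp_hasDerivAt (0 : ℝ) hPhi
    have e2 : HasDerivAt (fun s => h (Φ t (c s)))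
        (∑ j, (w.2 j * (hamField h (Φ t p)).1 j + (Φ t p).2 j * L.1 j)) 0 := by
      have : HasDerivAt (fun s => ∑ j, (Φ t (c s)).2 j * (hamField h (Φ t (c s))).1 j)
        (∑ j, (w.2 j * (hamField h (Φ t p)).1 j + (Φ t p).2 j * L.1 j)) 0 := by
        refine HasDerivAt.fun_sum fun j _ => ?_
        have := (snd_d hPhi j).mul (fst_d hX j)
        rw [hc0] at this
        exact this
      refine this.congr_of_eventuallyEq ?_
      filter_upwards [hcT] with s hs
      exact (euler_aux h hh _ ((hfl _ hs).2.1 t)).symm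
    have e3 := e1.unique e2
    rw [fderiv_phase_aux] at e3
    have e4 : HasDerivAt (fun t => ∑ j, (Φ t p).2 j * (G (t, p) (0, v)).1 j)
        (∑ j, ((hamField h (Φ t p)).2 j * w.1 j + (Φ t p).2 j * L.1 j)) t := by
      refine HasDerivAt.fun_sum fun j _ => ?_
      exact (snd_d ((hfl p hp).2.2.1 t (Set.mem_univ _)) j).mul (fst_d hw j)
    have e5 : (∑ j, ((hamField h (Φ t p)).2 j * w.1 j + (Φ t p).2 j * L.1 j)) = 0 := by
      rw [← sub_eq_zero.2 e3.symm, ← Finset.sum_sub_distrib]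
      refine Finset.sum_congr rfl fun j _ => ?_
      ring
    rwa [e5] at e4
  have hconst := is_const_of_deriv_eq_zero (fun t => (hder t).differentiableAt)
    (fun t => (hder t).deriv) t 0
  rw [hconst]
  have h0 : G (0, p) (0, v) = v := by
    have h1 : HasFDerivAt (fun q => Φ 0 q) (ContinuousLinearMap.id ℝ (Phase d)) p := by
      refine (hasFDerivAt_id p).congr_of_eventuallyEq ?_
      filter_upwards [(isOpen_Tprime_aux d).mem_nhds hp] with q hq
      exact (hfl q hq).1
    have h2 := (hsp 0).unique h1
    simpa using congrArg (fun A => A v) h2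
  rw [h0, (hfl p hp).1]

/-- A complete homogeneous Hamiltonian flow preserves the canonical 1-form `ξ · dx`:
`∑_j ξ*_j ∂x*_j/∂y_k = η_k` and `∑_j ξ*_j ∂x*_j/∂η_k = 0`. -/
theorem flow_preserves_canonical_one_form {d : ℕ} (h : Phase d → ℝ)
    (hh : HomHamiltonian h) (Φ : ℝ → Phase d → Phase d) (hΦ : IsCompleteFlow h Φ) :
    ∀ t : ℝ, ∀ p ∈ Tprime d, ∀ k : Fin d,
      (∑ j, (Φ t p).2 j *
          fderiv ℝ (fun q : Phase d => (Φ t q).1 j) p (Pi.single k 1, 0) = p.2 k) ∧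
      (∑ j, (Φ t p).2 j *
          fderiv ℝ (fun q : Phase d => (Φ t q).1 j) p (0, Pi.single k 1) = 0) := by
  intro t p hp k
  rw [one_form_aux h hh Φ hΦ p hp, one_form_aux h hh Φ hΦ p hp]
  constructor
  · simp [Pi.single_apply]
  · simp
end
end
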